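/- arXiv:2604.04587 — 4 statements merged into one kernel-verified Lean document; each statement's English description precedes it below -/
import Mathlib

section
/- Let q be a power of a prime p, n ≥ 6 an even integer, L = PSp_{2n}(q), and ε ∈ {+1,−1}. Let s1 and s2 be primes such that the multiplicative order of q modulo s1 equals 2n and e(s2, εq) = n−1 (that is, the multiplicative order of q modulo s2 is n−1 if ε = +1, and 2(n−1) if ε = −1). Then: (i) s1·s2 ∉ ω(L) and there is no prime r with both r·s1 ∈ ω(L) and r·s2 ∈ ω(L); (ii) the number (q^n+1)/gcd(2,q−1) lies in ω(L) and every element of ω(L) divisible by s1 divides it; moreover, both (q^{n−1}−ε)(q+ε)/gcd(2,q−1) and p·(q^{n−1}−ε) lie in ω(L), and every element of ω(L) divisible by s2 divides at least one of these two numbers. -/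
/-- The spectrum of a group `G`: the set of element orders of `G`. -/
def elementOrders (G : Type*) [Monoid G] : Set ℕ := {n | ∃ g : G, orderOf g = n}

/-- `PSL n F`: the projective special linear group over `F`,
i.e. the quotient of `SL_n(F)` by its center. -/
abbrev PSL (n : ℕ) (F : Type*) [Field F] :=
  Matrix.SpecialLinearGroup (Fin n) F ⧸
    Subgroup.center (Matrix.SpecialLinearGroup (Fin n) F)

/-- `PSp n F`: the projective symplectic group, i.e. the quotient of the
symplectic group `Sp_{2n}(F)` (2n×2n matrices preserving the standard symplectic
form) by its center. -/
abbrev PSp (n : ℕ) (F : Type*) [Field F] :=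
  Matrix.symplecticGroup (Fin n) F ⧸
    Subgroup.center (Matrix.symplecticGroup (Fin n) F)

/-- `G` is an almost simple group with socle isomorphic to `L`: there is an
injective homomorphism `ι : G → Aut L` whose image contains the inner
automorphisms `Inn L`. -/
def IsAlmostSimpleWithSocle (G : Type*) [Group G] (L : Type*) [Group L] : Prop :=
  ∃ ι : G →* MulAut L, Function.Injective ι ∧ (MulAut.conj (G := L)).range ≤ ι.range

section ElementOrdersOfPSp

open Matrix

theorem Matrix.SymplecticGroup.eq_one_or_neg_one_of_mem_center {l F : Type*} [Fintype l] [DecidableEq l]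
    [Nonempty l] [Field F] {z : symplecticGroup l F}
    (hz : z ∈ Subgroup.center (symplecticGroup l F)) :
    (z : Matrix (l ⊕ l) (l ⊕ l) F) = 1 ∨ (z : Matrix (l ⊕ l) (l ⊕ l) F) = -1 := by
  obtain ⟨Z, hZ⟩ := z
  obtain ⟨A, B, C, D, rfl⟩ : ∃ A B C D, Z = fromBlocks A B C D :=
    ⟨_, _, _, _, (fromBlocks_toBlocks Z).symm⟩
  have comm (S : Matrix l l F) (hS : Sᵀ = S) :
      A * S = S * D ∧ C * S = 0 ∧ S * C = 0 := by
    have hm : fromBlocks 1 S 0 1 ∈ symplecticGroup l F := by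
      rw [SymplecticGroup.fromBlocks_mem_iff]
      simp [hS]
    have h := congrArg Subtype.val (Subgroup.mem_center_iff.1 hz ⟨_, hm⟩)
    simp only [Submonoid.coe_mul, fromBlocks_multiply, fromBlocks_inj] at h
    obtain ⟨h1, h2, h3, h4⟩ := h
    simp only [one_mul, mul_one, mul_zero, add_zero, zero_mul, zero_add] at h1 h2 h3 h4
    refine ⟨?_, ?_, ?_⟩
    · rw [add_comm] at h2; exact (add_right_cancel h2).symm
    · simpa using h4
    · simpa using h1
  have hB : B = 0 := by
    have hm : fromBlocks 1 0 1 1 ∈ symplecticGroup l F := by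
      rw [SymplecticGroup.fromBlocks_mem_iff]
      simp
    have h := congrArg Subtype.val (Subgroup.mem_center_iff.1 hz ⟨_, hm⟩)
    simp only [Submonoid.coe_mul, fromBlocks_multiply, fromBlocks_inj] at h
    simpa using h.1
  have hC : C = 0 := by simpa using (comm 1 (by simp)).2.1
  have hD : A = D := by simpa using (comm 1 (by simp)).1
  subst hB hC hD
  have hcomm (S : Matrix l l F) (hS : Sᵀ = S) : A * S = S * A := (comm S hS).1
  have hoff (i j : l) (hij : i ≠ j) : A i j = 0 := by
    have h := congrFun (congrFun (hcomm (single j j 1) (by simp)) i) j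
    simpa [Matrix.mul_single_apply_same, Matrix.single_mul_apply_of_ne, hij] using h
  have hdiag (i j : l) : A i i = A j j := by
    have h := congrFun (congrFun (hcomm (single i j 1 + single j i 1)
      (by simp [add_comm])) i) j
    by_cases hij : i = j
    · rw [hij]
    · simpa [mul_add, add_mul, hij, Ne.symm hij] using h
  inhabit l
  set c := A default default
  have hA : A = c • 1 := by
    ext i j
    by_cases hij : i = j
    · subst hij; simp [hdiag i default, c]
    · simp [hij, hoff i j hij]
  have hc : c * c = 1 := by
    have h := (SymplecticGroup.fromBlocks_mem_iff.1 hZ).2.2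
    have := congrFun (congrFun h default) default
    rw [hA] at this
    simpa using this
  rcases mul_self_eq_one_iff.1 hc with h | h
  · left; simp [hA, h]
  · right; simp [hA, h, ← fromBlocks_one, fromBlocks_neg]

/-- Restriction of scalars along a commutative Frobenius algebra `R` over `F` embeds `SL₂(R)` into
a symplectic group over `F`. -/
theorem exists_hom_specialLinearGroup_symplecticGroup {F R : Type*} [Field F] [CommRing R]
    [Algebra F R] [Module.Finite F R] {n : ℕ} (hn : Module.finrank F R = n) (f : R →ₗ[F] F)
    (hf : ∀ x, (∀ y, f (x * y) = 0) → x = 0) :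
    ∃ φ : SpecialLinearGroup (Fin 2) R →* symplecticGroup (Fin n) F, ∀ g,
      (φ g = 1 → g = 1) ∧
      ((φ g).val = -1 → (g : Matrix (Fin 2) (Fin 2) R) = -1) := by
  let b := Module.finBasisOfFinrankEq F R hn
  let M := Algebra.leftMulMatrix b
  let T : Matrix (Fin n) (Fin n) F := Matrix.of fun i j => f (b i * b j)
  have hT : Tᵀ = T := by
    ext i j
    simp [T, mul_comm]
  have hTM (x : R) : (M x)ᵀ * T = T * M x := by
    have key (i j : Fin n) : (T * M x) i j = f (b i * (x * b j)) := by
      rw [← b.sum_repr (x * b j), Finset.mul_sum, map_sum, Matrix.mul_apply]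
      refine Finset.sum_congr rfl fun k _ => ?_
      rw [mul_smul_comm, map_smul, smul_eq_mul, mul_comm]
      simp [T, M, Algebra.leftMulMatrix_eq_repr_mul]
    have : (M x)ᵀ * T = (T * M x)ᵀ := by rw [transpose_mul, hT]
    rw [this]
    ext i j
    rw [transpose_apply, key, key]
    congr 1
    ring
  have hdet : IsUnit T.det := by
    rw [isUnit_iff_ne_zero]
    intro h0
    obtain ⟨v, hv, hv0⟩ := Matrix.exists_mulVec_eq_zero_iff.2 h0
    apply hv
    have hx : ∑ j, v j • b j = 0 := by
      refine hf _ fun y => ?_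
      have hlin : f ∘ₗ LinearMap.mulLeft F (∑ j, v j • b j) = 0 := by
        refine b.ext fun i => ?_
        have := congrFun hv0 i
        simp only [Matrix.mulVec, dotProduct, T, Matrix.of_apply, Pi.zero_apply] at this
        simp only [LinearMap.comp_apply, LinearMap.mulLeft_apply, LinearMap.zero_apply]
        rw [Finset.sum_mul, map_sum, ← this]
        refine Finset.sum_congr rfl fun k _ => ?_
        rw [smul_mul_assoc, map_smul, smul_eq_mul, mul_comm, mul_comm (b k)]
      exact LinearMap.congr_fun hlin y
    exact funext fun j => Fintype.linearIndependent_iff.1 b.linearIndependent v hx j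
  have hTi : T⁻¹ * T = 1 := nonsing_inv_mul _ hdet
  have hiT : T * T⁻¹ = 1 := mul_nonsing_inv _ hdet
  have hiTt : (T⁻¹)ᵀ = T⁻¹ := by rw [transpose_nonsing_inv, hT]
  have hinj : Function.Injective M := Algebra.leftMulMatrix_injective b
  have cancel (X : Matrix (Fin n) (Fin n) F) : T⁻¹ * (T * X) = X := by
    rw [← mul_assoc, hTi, one_mul]
  have cancel' (X : Matrix (Fin n) (Fin n) F) : T * (T⁻¹ * X) = X := by
    rw [← mul_assoc, hiT, one_mul]
  have hTM' (x : R) (X : Matrix (Fin n) (Fin n) F) : (M x)ᵀ * (T * X) = T * (M x * X) := by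
    rw [← mul_assoc, hTM, mul_assoc]
  let ψ : Matrix (Fin 2) (Fin 2) R → Matrix (Fin n ⊕ Fin n) (Fin n ⊕ Fin n) F := fun g =>
    fromBlocks (M (g 0 0)) (M (g 0 1) * T⁻¹) (T * M (g 1 0)) (T * (M (g 1 1) * T⁻¹))
  have hψ (g : SpecialLinearGroup (Fin 2) R) : ψ g ∈ symplecticGroup (Fin n) F := by
    have hd := g.2
    rw [det_fin_two] at hd
    rw [SymplecticGroup.fromBlocks_mem_iff]
    refine ⟨?_, ?_, ?_⟩
    · rw [transpose_mul, hT, hTM', mul_assoc, ← map_mul, hTM', ← map_mul, mul_comm]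
    · simp only [transpose_mul, hT, hiTt, mul_assoc, hTM, hTM', cancel]
      rw [← mul_assoc, ← mul_assoc, ← map_mul, ← map_mul, mul_comm]
    · simp only [transpose_mul, hT, mul_assoc, hTM']
      rw [← mul_sub, ← mul_assoc, ← mul_assoc, ← sub_mul, ← map_mul, ← map_mul, ← map_sub,
        mul_comm (g 1 0), hd, map_one, one_mul, hiT]
  have hψ1 : ψ 1 = 1 := by
    simp [ψ, hiT]
  have hψmul (g h : Matrix (Fin 2) (Fin 2) R) : ψ (g * h) = ψ g * ψ h := by
    simp only [ψ, fromBlocks_multiply, Matrix.mul_apply, Fin.sum_univ_two, map_add, map_mul,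
      mul_assoc, cancel, add_mul, mul_add]
  have hψinj {g h : Matrix (Fin 2) (Fin 2) R} (e : ψ g = ψ h) : g = h := by
    obtain ⟨h1, h2, h3, h4⟩ := fromBlocks_inj.1 e
    have h2' := congrArg (· * T) h2
    have h3' := congrArg (T⁻¹ * ·) h3
    have h4' := congrArg (fun X => T⁻¹ * X * T) h4
    simp only [mul_assoc, hTi, mul_one, cancel] at h2' h3' h4'
    ext i j
    fin_cases i <;> fin_cases j
    exacts [hinj h1, hinj h2', hinj h3', hinj h4']
  have hψneg : ψ (-1) = -1 := by
    simp [ψ, hiT, ← fromBlocks_one, fromBlocks_neg]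
  refine ⟨{ toFun := fun g => ⟨ψ g, hψ g⟩, map_one' := Subtype.ext ?_, map_mul' := ?_ }, ?_⟩
  · simpa using hψ1
  · intro g h
    exact Subtype.ext (by simpa using hψmul g h)
  · intro g
    refine ⟨fun h => ?_, fun h => ?_⟩
    · have h' : ψ g = ψ 1 := (congrArg Subtype.val h).trans hψ1.symm
      exact Subtype.ext (by simpa using hψinj h')
    · exact hψinj (h.trans hψneg.symm)

theorem exists_linearMap_nondegenerate (F K : Type*) [Field F] [Finite F] [Field K] [Algebra F K]
    [Module.Finite F K] : ∃ f : K →ₗ[F] F, ∀ x, (∀ y, f (x * y) = 0) → x = 0 := by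
  refine ⟨Algebra.trace F K, fun x hx => ?_⟩
  by_contra h
  refine Algebra.trace_ne_zero F K (LinearMap.ext fun y => ?_)
  simpa [h] using hx (x⁻¹ * y)

/-- `SL₂(q^m) × SL₂(q)` embeds into `Sp_{2(m+1)}(q)`. -/
theorem exists_hom_prod_specialLinearGroup_symplecticGroup {F K : Type*} [Field F] [Finite F]
    [Field K] [Algebra F K] [Module.Finite F K] {n : ℕ} (hn : Module.finrank F K + 1 = n) :
    ∃ φ : SpecialLinearGroup (Fin 2) K × SpecialLinearGroup (Fin 2) F →* symplecticGroup (Fin n) F,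
      ∀ g, (φ g = 1 → g = 1) ∧
        ((φ g).val = -1 → (g.1 : Matrix (Fin 2) (Fin 2) K) = -1 ∧
          (g.2 : Matrix (Fin 2) (Fin 2) F) = -1) := by
  obtain ⟨f, hf⟩ := exists_linearMap_nondegenerate F K
  obtain ⟨φ, hφ⟩ := exists_hom_specialLinearGroup_symplecticGroup (F := F) (R := K × F)
    (n := n) (by rw [Module.finrank_prod, Module.finrank_self, hn]) (f.coprod LinearMap.id) (by
      rintro ⟨a, c⟩ h
      have h1 : a = 0 := hf a fun y => by simpa using h (y, 0)
      have h2 : c = 0 := by simpa using h (0, 1)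
      rw [h1, h2]; rfl)
  let ι : SpecialLinearGroup (Fin 2) K × SpecialLinearGroup (Fin 2) F →
      Matrix (Fin 2) (Fin 2) (K × F) := fun g => Matrix.of fun i j => (g.1 i j, g.2 i j)
  have hι (g) : (ι g).det = 1 := by
    have h1 := g.1.2
    have h2 := g.2.2
    rw [det_fin_two] at h1 h2 ⊢
    exact Prod.ext h1 h2
  let ψ : SpecialLinearGroup (Fin 2) K × SpecialLinearGroup (Fin 2) F →*
      SpecialLinearGroup (Fin 2) (K × F) :=
    { toFun := fun g => ⟨ι g, hι g⟩
      map_one' := by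
        ext i j <;> fin_cases i <;> fin_cases j <;> simp [ι]
      map_mul' := by
        intro g h
        refine Subtype.ext (Matrix.ext fun i j => ?_)
        change (g.1.val * h.1.val, g.2.val * h.2.val).map (· i j) (· i j) = (ι g * ι h) i j
        simp [ι, Matrix.mul_apply] }
  refine ⟨φ.comp ψ, fun g => ⟨fun h => ?_, fun h => ?_⟩⟩
  · have h1 (i j) : (g.1 i j, g.2 i j) = (1 : Matrix (Fin 2) (Fin 2) (K × F)) i j :=
      congrFun (congrFun (congrArg Subtype.val ((hφ _).1 h)) i) j
    refine Prod.ext (Subtype.ext (Matrix.ext fun i j => ?_)) (Subtype.ext (Matrix.ext fun i j => ?_))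
    · refine (congrArg Prod.fst (h1 i j)).trans ?_
      fin_cases i <;> fin_cases j <;> simp
    · refine (congrArg Prod.snd (h1 i j)).trans ?_
      fin_cases i <;> fin_cases j <;> simp
  · have h1 (i j) : (g.1 i j, g.2 i j) = (-1 : Matrix (Fin 2) (Fin 2) (K × F)) i j :=
      congrFun (congrFun ((hφ _).2 h) i) j
    refine ⟨Matrix.ext fun i j => ?_, Matrix.ext fun i j => ?_⟩
    · refine (congrArg Prod.fst (h1 i j)).trans ?_
      fin_cases i <;> fin_cases j <;> simp
    · refine (congrArg Prod.snd (h1 i j)).trans ?_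
      fin_cases i <;> fin_cases j <;> simp

theorem exists_specialLinearGroup_orderOf_eq_card_sub_one (K : Type*) [Field K] [Finite K] :
    ∃ g : SpecialLinearGroup (Fin 2) K, orderOf g = Nat.card K - 1 := by
  obtain ⟨u, hu⟩ := IsCyclic.exists_ofOrder_eq_natCard (α := Kˣ)
  let g : SpecialLinearGroup (Fin 2) K := ⟨diagonal ![(u : K), ((u⁻¹ : Kˣ) : K)], by simp⟩
  refine ⟨g, ?_⟩
  rw [← Nat.card_units, ← hu]
  refine orderOf_eq_orderOf_iff.2 fun k => ?_
  have hg : ((g ^ k : SpecialLinearGroup (Fin 2) K) : Matrix (Fin 2) (Fin 2) K) =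
      diagonal ![(u : K) ^ k, ((u⁻¹ : Kˣ) : K) ^ k] := by
    change (diagonal ![(u : K), ((u⁻¹ : Kˣ) : K)]) ^ k = _
    simp only [diagonal_pow]
    congr 1
    ext i
    fin_cases i <;> simp
  constructor
  · intro h
    rw [h] at hg
    have := congrFun (congrFun hg 0) 0
    exact Units.ext (by simpa using this.symm)
  · intro h
    have h1 : (u : K) ^ k = 1 := by rw [← Units.val_pow_eq_pow_val, h, Units.val_one]
    apply Subtype.ext
    rw [hg]
    ext i j
    fin_cases i <;> fin_cases j <;> simp [h1]

theorem exists_specialLinearGroup_orderOf_eq_card_add_one (K : Type*) [Field K] [Finite K] :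
    ∃ g : SpecialLinearGroup (Fin 2) K, orderOf g = Nat.card K + 1 := by
  obtain ⟨p, hp⟩ := CharP.exists K
  have : Fact p.Prime := ⟨CharP.char_is_prime K p⟩
  let L := FiniteField.Extension K p 2
  have hL : Nat.card L = Nat.card K ^ 2 := FiniteField.natCard_extension K p 2
  have hK : 1 < Nat.card K := Finite.one_lt_card
  obtain ⟨u, hu⟩ := IsCyclic.exists_ofOrder_eq_natCard (α := Lˣ)
  have hsq : Nat.card K ^ 2 - 1 = (Nat.card K - 1) * (Nat.card K + 1) := by
    rw [mul_comm]; simpa using Nat.sq_sub_sq (Nat.card K) 1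
  rw [Nat.card_units, hL, hsq] at hu
  have hθ : orderOf ((u ^ (Nat.card K - 1) : Lˣ) : L) = Nat.card K + 1 := by
    rw [orderOf_units, orderOf_pow_of_dvd (by omega) (by rw [hu]; exact dvd_mul_right _ _), hu,
      Nat.mul_div_cancel_left _ (by omega)]
  set θ : L := ((u ^ (Nat.card K - 1) : Lˣ) : L)
  let b := Module.finBasisOfFinrankEq K L (FiniteField.finrank_extension K p 2)
  have hdet : (Algebra.leftMulMatrix b θ).det = 1 := by
    rw [← Algebra.norm_eq_matrix_det]
    apply (algebraMap K L).injective
    rw [FiniteField.algebraMap_norm_eq_pow, map_one, hL, hsq,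
      Nat.mul_div_cancel_left _ (by omega), ← hθ, pow_orderOf_eq_one]
  refine ⟨⟨_, hdet⟩, ?_⟩
  rw [← hθ]
  refine orderOf_eq_orderOf_iff.2 fun k => ?_
  rw [← (Algebra.leftMulMatrix_injective b).eq_iff, map_pow, map_one]
  exact Subtype.ext_iff

theorem exists_specialLinearGroup_orderOf_eq_char (K : Type*) [Field K] (p : ℕ) [CharP K p] :
    ∃ g : SpecialLinearGroup (Fin 2) K, orderOf g = p ∧
      ∀ k : ℕ, ((g ^ k : SpecialLinearGroup (Fin 2) K) : Matrix (Fin 2) (Fin 2) K) = -1 →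
        (-1 : K) = 1 := by
  let g : SpecialLinearGroup (Fin 2) K := ⟨!![1, 1; 0, 1], by simp⟩
  have hg (k : ℕ) : ((g ^ k : SpecialLinearGroup (Fin 2) K) : Matrix (Fin 2) (Fin 2) K) =
      !![1, (k : K); 0, 1] := by
    induction k with
    | zero => simp [Matrix.one_fin_two]
    | succ k ih =>
      rw [pow_succ]
      refine (congrArg (· * !![1, 1; 0, 1]) ih).trans ?_
      simp [add_comm]
  refine ⟨g, ?_, fun k hk => ?_⟩
  · refine Nat.dvd_antisymm (orderOf_dvd_of_pow_eq_one (Subtype.ext ?_)) ?_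
    · exact (hg p).trans (by simp [Matrix.one_fin_two])
    · have h := (hg (orderOf g)).symm.trans (congrArg Subtype.val (pow_orderOf_eq_one g))
      exact (CharP.cast_eq_zero_iff K p _).1 (by simpa using congrFun (congrFun h 0) 1)
  · rw [hg] at hk
    simpa using (congrFun (congrFun hk 0) 0).symm

theorem dvd_orderOf_mk {n : ℕ} [NeZero n] {F : Type*} [Field F] {A : symplecticGroup (Fin n) F} {d : ℕ}
    (h : ∀ k, A ^ k = 1 ∨ (A ^ k).val = -1 → d ∣ k) : d ∣ orderOf (QuotientGroup.mk A : PSp n F) := by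
  apply h
  have h1 := pow_orderOf_eq_one (QuotientGroup.mk A : PSp n F)
  rw [← QuotientGroup.mk_pow, QuotientGroup.eq_one_iff] at h1
  refine (SymplecticGroup.eq_one_or_neg_one_of_mem_center h1).imp (fun h => Subtype.ext h) id

theorem orderOf_mk_dvd {n : ℕ} {F : Type*} [Field F] {A : symplecticGroup (Fin n) F} {d : ℕ}
    (h : (A ^ d).val = 1 ∨ (A ^ d).val = -1) : orderOf (QuotientGroup.mk A : PSp n F) ∣ d := by
  rw [orderOf_dvd_iff_pow_eq_one, ← QuotientGroup.mk_pow, QuotientGroup.eq_one_iff,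
    Subgroup.mem_center_iff]
  intro B
  apply Subtype.ext
  rcases h with h | h <;> simp [h]

open Polynomial in
theorem prod_X_sub_C_dvd_pow {K : Type*} [Field K] [DecidableEq K] {R : Multiset K} {f : K[X]} {m : ℕ}
    (hf : ∀ x ∈ R, f.IsRoot x) (hm : ∀ x, R.count x ≤ m) :
    (R.map fun x => X - C x).prod ∣ f ^ m := by
  rw [Finset.prod_multiset_map_count]
  refine dvd_trans (Finset.prod_dvd_prod_of_dvd _ (fun x => (X - C x) ^ m)
    fun x _ => pow_dvd_pow _ (hm x)) ?_
  rw [Finset.prod_pow]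
  refine pow_dvd_pow_of_dvd (Finset.prod_dvd_of_coprime
    (fun x _ y _ h => pairwise_coprime_X_sub_C Function.injective_id h) fun x hx => ?_) m
  exact dvd_iff_isRoot.2 (hf x (Multiset.mem_toFinset.1 hx))

open Polynomial in
theorem aeval_eq_zero_of_roots {ι F K : Type*} [Fintype ι] [DecidableEq ι] [Field F] [Field K]
    [DecidableEq K] [Algebra F K] {A : Matrix ι ι F}
    (hsplit : (A.charpoly.map (algebraMap F K)).Splits) {f : F[X]} {m : ℕ}
    (hf : ∀ x ∈ (A.charpoly.map (algebraMap F K)).roots, aeval x f = 0)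
    (hm : ∀ x, (A.charpoly.map (algebraMap F K)).roots.count x ≤ m) :
    aeval A f ^ m = 0 := by
  have h : A.charpoly.map (algebraMap F K) ∣ (f ^ m).map (algebraMap F K) := by
    rw [hsplit.eq_prod_roots_of_monic (A.charpoly_monic.map _), Polynomial.map_pow]
    refine prod_X_sub_C_dvd_pow (fun x hx => ?_) hm
    rw [IsRoot.def, eval_map_algebraMap]
    exact hf x hx
  obtain ⟨g, hg⟩ := (map_dvd_map' _).1 h
  rw [← map_pow, hg, map_mul, Matrix.aeval_self_charpoly, zero_mul]

open Polynomial in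
/-- If a prime different from the characteristic divides the order of `A`, it divides the order of
an eigenvalue of `A`. -/
theorem exists_mem_roots_charpoly_dvd_orderOf {ι F K : Type*} [Fintype ι] [DecidableEq ι] [Field F]
    [Field K] [Finite K] [Algebra F K] {p s : ℕ} (hp : p.Prime) [CharP F p] (hs : s.Prime)
    (hsp : s ≠ p) {A : Matrix ι ι F} (hsplit : (A.charpoly.map (algebraMap F K)).Splits)
    (hA : s ∣ orderOf A) :
    ∃ θ ∈ (A.charpoly.map (algebraMap F K)).roots, s ∣ orderOf θ := by
  classical
  by_contra! hcon
  have : Fact p.Prime := ⟨hp⟩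
  set R := (A.charpoly.map (algebraMap F K)).roots
  let M := (R.map orderOf).prod
  let t := R.card
  have hM : ¬ s ∣ M := fun h => by
    obtain ⟨x, hx, hx'⟩ := hs.prime.exists_mem_multiset_map_dvd h
    exact hcon x hx hx'
  have h1 : aeval A (X ^ M - 1 : F[X]) ^ p ^ t = 0 := by
    refine aeval_eq_zero_of_roots (K := K) hsplit (fun x hx => ?_) (fun x => ?_)
    · rw [map_sub, map_pow, aeval_X, map_one, sub_eq_zero]
      exact orderOf_dvd_iff_pow_eq_one.1 (Multiset.dvd_prod (Multiset.mem_map_of_mem _ hx))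
    · exact (Multiset.count_le_card _ _).trans (Nat.lt_pow_self hp.one_lt).le
  rw [← map_pow, sub_pow_char_pow, one_pow, ← pow_mul, map_sub, map_pow, aeval_X, map_one,
    sub_eq_zero] at h1
  rcases hs.dvd_mul.1 (hA.trans (orderOf_dvd_of_pow_eq_one h1)) with h | h
  · exact hM h
  · exact hsp ((Nat.prime_dvd_prime_iff_eq hs hp).1 (hs.dvd_of_dvd_pow h))

open Polynomial in
theorem Matrix.SymplecticGroup.isRoot_charpoly_inv {l K : Type*} [Fintype l] [DecidableEq l] [Field K]
    {A : Matrix (l ⊕ l) (l ⊕ l) K} (hA : A ∈ symplecticGroup l K) {θ : K}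
    (hθ : A.charpoly.IsRoot θ) : θ ≠ 0 ∧ A.charpoly.IsRoot θ⁻¹ := by
  rw [IsRoot.def, Matrix.eval_charpoly] at hθ
  have h0 : θ ≠ 0 := by
    rintro rfl
    rw [map_zero, zero_sub, det_neg] at hθ
    have := (SymplecticGroup.symplectic_det hA).ne_zero
    simp_all
  refine ⟨h0, ?_⟩
  rw [← charpoly_transpose, IsRoot.def, Matrix.eval_charpoly]
  have hJ := (isUnit_det_J l K).ne_zero
  have key : (scalar (l ⊕ l) θ⁻¹ - Aᵀ) * J l K = -(θ⁻¹ • (Aᵀ * J l K * (scalar (l ⊕ l) θ - A))) := by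
    rw [mul_sub, SymplecticGroup.mem_iff'.1 hA, sub_mul]
    simp only [scalar_apply, ← smul_one_eq_diagonal, Matrix.smul_mul, one_mul, Matrix.mul_smul, mul_one, smul_sub,
      smul_smul, inv_mul_cancel₀ h0, one_smul]
    abel
  have := congrArg det key
  rw [det_mul, det_neg, det_smul, det_mul _ (_ - _), hθ, mul_zero, mul_zero, mul_zero] at this
  exact (mul_eq_zero.1 this).resolve_right hJ

section FrobeniusOrbits

variable {K : Type*} [Field K] {q : ℕ} {θ : K} {s : ℕ}

theorem pow_pow_mem_of_map_eq {R : Multiset K} (hfrob : R.map (· ^ q) = R) (hθ : θ ∈ R) (i : ℕ) :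
    θ ^ q ^ i ∈ R := by
  induction i with
  | zero => simpa using hθ
  | succ i ih =>
    rw [pow_succ, pow_mul, ← hfrob]
    exact Multiset.mem_map_of_mem (· ^ q) ih

theorem pow_sub_one_eq_one {x : K} (hx : x ≠ 0) {k : ℕ} (hk : 0 < k) (h : x ^ k = x) :
    x ^ (k - 1) = 1 := by
  apply mul_right_cancel₀ hx
  rw [← pow_succ, Nat.sub_add_cancel hk, h, one_mul]

theorem cast_pow_eq_one_of_pow_eq_self (h0 : θ ≠ 0) (hs : s ∣ orderOf θ) (hq : 0 < q) {j : ℕ}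
    (h : θ ^ q ^ j = θ) : (q : ZMod s) ^ j = 1 := by
  have h2 : s ∣ q ^ j - 1 :=
    hs.trans (orderOf_dvd_of_pow_eq_one (pow_sub_one_eq_one h0 (Nat.pow_pos hq) h))
  have h3 := (ZMod.natCast_eq_zero_iff _ _).2 h2
  rw [Nat.cast_sub (Nat.pow_pos hq), sub_eq_zero] at h3
  exact_mod_cast h3

theorem pow_mul_self_ne_of_two_lt_orderOf (hinj : Function.Injective fun x : K => x ^ q)
    (h0 : θ ≠ 0) (hs : s ∣ orderOf θ) (hq : 0 < q) (ho : 2 < orderOf (q : ZMod s)) (i : ℕ) :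
    (θ ^ q ^ i) ^ (q * q) ≠ θ ^ q ^ i := by
  intro h
  have hinj' : Function.Injective fun x : K => x ^ q ^ i := by
    have := hinj.iterate i
    rwa [pow_iterate] at this
  have h1 : θ ^ q ^ 2 = θ := by
    apply hinj'
    rw [pow_right_comm, ← sq] at h
    exact h
  have := Nat.le_of_dvd two_pos
    (orderOf_dvd_of_pow_eq_one (cast_pow_eq_one_of_pow_eq_self h0 hs hq h1))
  omega

theorem exists_frobenius_orbit [DecidableEq K] [Finite K]
    (hinj : Function.Injective fun x : K => x ^ q)
    (h0 : θ ≠ 0) (hs : s ∣ orderOf θ) (hq : 0 < q) :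
    ∃ O : Finset K, 0 < O.card ∧ orderOf (q : ZMod s) ∣ O.card ∧ θ ^ q ^ O.card = θ ∧
      ∀ x, x ∈ O ↔ ∃ i < O.card, x = θ ^ q ^ i := by
  set φ := fun x : K => x ^ q
  have hφ (i : ℕ) : φ^[i] θ = θ ^ q ^ i := congrFun (pow_iterate q i) θ
  set e := Function.minimalPeriod φ θ
  let O := (Finset.range e).image fun i => φ^[i] θ
  have hO : O.card = e := by
    rw [Finset.card_image_of_injOn, Finset.card_range]
    rw [Finset.coe_range]
    exact Function.iterate_injOn_Iio_minimalPeriod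
  have he : θ ^ q ^ e = θ := by
    rw [← hφ]
    exact Function.iterate_minimalPeriod
  refine ⟨O, ?_, ?_, ?_, fun x => ?_⟩
  · rw [hO]
    exact Function.minimalPeriod_pos_of_mem_periodicPts (hinj.mem_periodicPts θ)
  · rw [hO]
    refine orderOf_dvd_of_pow_eq_one ?_
    exact cast_pow_eq_one_of_pow_eq_self h0 hs hq he
  · rw [hO, he]
  · rw [hO]
    simp [O, hφ, eq_comm]

theorem pow_pow_mem_of_mem_orbit {O : Finset K} (hO : θ ^ q ^ O.card = θ)
    (hmem : ∀ x, x ∈ O ↔ ∃ i < O.card, x = θ ^ q ^ i) {x : K} (hx : x ∈ O) : x ^ q ∈ O := by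
  obtain ⟨i, hi, rfl⟩ := (hmem x).1 hx
  rw [hmem]
  rcases Nat.lt_or_ge (i + 1) O.card with h | h
  · exact ⟨i + 1, h, by rw [← pow_mul, pow_succ]⟩
  · refine ⟨0, by omega, ?_⟩
    rw [← pow_mul, ← pow_succ, show i + 1 = O.card by omega, hO, pow_zero, pow_one]

theorem cast_pow_eq_neg_cast_pow_of_mul_eq_one (hs : s ∣ orderOf θ) {i j : ℕ}
    (h : θ ^ q ^ i * θ ^ q ^ j = 1) : (q : ZMod s) ^ i = -(q : ZMod s) ^ j := by
  rw [← pow_add] at h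
  have := (ZMod.natCast_eq_zero_iff _ _).2 (hs.trans (orderOf_dvd_of_pow_eq_one h))
  push_cast at this
  exact eq_neg_of_add_eq_zero_left this

theorem cast_pow_eq_neg_one_of_mul_eq_one (hs : s ∣ orderOf θ) {j : ℕ}
    (h : θ⁻¹ = θ ^ q ^ j) (h0 : θ ≠ 0) : (q : ZMod s) ^ j = -1 := by
  have := cast_pow_eq_neg_cast_pow_of_mul_eq_one (i := j) (j := 0) (q := q) hs
    (by rw [← h]; simp [h0])
  simpa using this

end FrobeniusOrbits

theorem one_ne_neg_one_of_two_le_orderOf {s d : ℕ} (hs : s.Prime) {a : ZMod s} (ha : orderOf a = d)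
    (hd : 2 ≤ d) : (1 : ZMod s) ≠ -1 ∧ a ≠ 0 := by
  have : Fact s.Prime := ⟨hs⟩
  have h0 : a ≠ 0 := by
    rintro rfl
    have := pow_orderOf_eq_one (0 : ZMod s)
    rw [ha, zero_pow (by omega)] at this
    exact zero_ne_one this
  refine ⟨fun h => ?_, h0⟩
  have h1 := Nat.le_of_dvd (by have := hs.two_le; omega) (ZMod.orderOf_dvd_card_sub_one h0)
  have h2 : ((2 : ℕ) : ZMod s) = 0 := by
    push_cast
    linear_combination h
  have h3 := Nat.le_of_dvd (by omega) ((ZMod.natCast_eq_zero_iff _ _).1 h2)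
  omega

section EigenvalueMultisets

variable {K : Type*} [Field K] [DecidableEq K] {q : ℕ} {θ : K} {s n : ℕ} {R : Multiset K}

/-- The eigenvalues of a symplectic transformation with an eigenvalue whose order is divisible by a
primitive prime divisor of `q ^ (2 * n) - 1`. -/
theorem eigenvalues_of_orderOf_eq_two_mul [Finite K]
    (hinj : Function.Injective fun x : K => x ^ q)
    (hq : 0 < q) (hn : 0 < n) (hR : R.card = 2 * n) (h0 : (0 : K) ∉ R) (hθ : θ ∈ R)
    (hfrob : R.map (· ^ q) = R) (hinv : ∀ x ∈ R, x⁻¹ ∈ R) (hs : s.Prime) (hsθ : s ∣ orderOf θ)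
    (ho : orderOf (q : ZMod s) = 2 * n) :
    R.Nodup ∧ θ ^ (q ^ n + 1) = 1 ∧ ∀ x ∈ R, ∃ i, x = θ ^ q ^ i := by
  have hθ0 : θ ≠ 0 := fun h => h0 (h ▸ hθ)
  obtain ⟨O, hpos, hdvd, hfix, hmem⟩ := exists_frobenius_orbit hinj hθ0 hsθ hq
  have hOR : O.val ≤ R := by
    refine (Multiset.le_iff_subset O.nodup).2 fun x hx => ?_
    obtain ⟨i, -, rfl⟩ := (hmem x).1 hx
    exact pow_pow_mem_of_map_eq hfrob hθ i
  have hcard : R.card ≤ O.val.card := by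
    rw [hR]
    rw [ho] at hdvd
    exact Nat.le_of_dvd hpos hdvd
  obtain rfl := Multiset.eq_of_le_of_card_le hOR hcard
  obtain ⟨hne, hq0⟩ := one_ne_neg_one_of_two_le_orderOf hs ho (by omega)
  refine ⟨O.nodup, ?_, fun x hx => ?_⟩
  · obtain ⟨j, hj, hj'⟩ := (hmem _).1 (hinv θ hθ)
    have h1 := cast_pow_eq_neg_one_of_mul_eq_one hsθ hj' hθ0
    have h2 : 2 * n ∣ 2 * j := by
      rw [← ho]
      refine orderOf_dvd_of_pow_eq_one ?_
      rw [mul_comm, pow_mul, h1, neg_one_sq]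
    obtain ⟨c, rfl⟩ := Nat.dvd_of_mul_dvd_mul_left two_pos h2
    have hc : c < 2 := by
      have : O.card = 2 * n := hR
      rw [this] at hj
      by_contra h
      have : n * 2 ≤ n * c := Nat.mul_le_mul_left n (by omega)
      omega
    interval_cases c
    · exact absurd (by simpa using h1) hne
    · rw [pow_succ, ← mul_one n, ← hj', inv_mul_cancel₀ hθ0]
  · obtain ⟨i, -, hi⟩ := (hmem x).1 hx
    exact ⟨i, hi⟩

theorem exists_eigenvalues_of_orderOf_eq_odd [Finite K]
    (hinj : Function.Injective fun x : K => x ^ q)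
    (hq : 0 < q) {m : ℕ} (hm : 2 < m) (hmodd : Odd m) (hR : R.card = 2 * (m + 1)) (h0 : (0 : K) ∉ R)
    (hθ : θ ∈ R)
    (hfrob : R.map (· ^ q) = R) (hinv : ∀ x ∈ R, x⁻¹ ∈ R) (hs : s.Prime) (hsθ : s ∣ orderOf θ)
    (ho : orderOf (q : ZMod s) = m) :
    ∃ S : Finset K, S.card = 2 * m ∧ S.val ≤ R ∧ (∀ x ∈ S, x ^ q ∈ S) ∧
      (∀ x ∈ S, x ^ (q * q) ≠ x) ∧ ∀ x ∈ S, x ^ (q ^ m - 1) = 1 := by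
  have hθ0 : θ ≠ 0 := fun h => h0 (h ▸ hθ)
  obtain ⟨O, hpos, hdvd, hfix, hmem⟩ := exists_frobenius_orbit hinj hθ0 hsθ hq
  have hOR : ∀ x ∈ O, x ∈ R := fun x hx => by
    obtain ⟨i, -, rfl⟩ := (hmem x).1 hx
    exact pow_pow_mem_of_map_eq hfrob hθ i
  have hO' : (O.image (·⁻¹)).card = O.card := Finset.card_image_of_injective _ inv_injective
  obtain ⟨hne, hq0⟩ := one_ne_neg_one_of_two_le_orderOf hs ho (by omega)
  have : Fact s.Prime := ⟨hs⟩
  have hne' (i : ℕ) : (q : ZMod s) ^ i ≠ -1 := fun h => by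
    have h1 : m ∣ 2 * i := by
      rw [← ho]
      refine orderOf_dvd_of_pow_eq_one ?_
      rw [mul_comm, pow_mul, h, neg_one_sq]
    replace h1 := hmodd.coprime_two_right.dvd_of_dvd_mul_left h1
    rw [← ho] at h1
    exact hne (by rw [← h, orderOf_dvd_iff_pow_eq_one.1 h1])
  have hmul (i j : ℕ) : (q : ZMod s) ^ i ≠ -(q : ZMod s) ^ j := fun h => by
    rcases Nat.le_total i j with hij | hij
    · obtain ⟨c, rfl⟩ := Nat.exists_eq_add_of_le hij
      refine hne' c (mul_left_cancel₀ (pow_ne_zero i hq0) ?_)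
      rw [← pow_add, mul_neg_one, h, neg_neg]
    · obtain ⟨c, rfl⟩ := Nat.exists_eq_add_of_le hij
      refine hne' c (mul_left_cancel₀ (pow_ne_zero j hq0) ?_)
      rw [← pow_add, mul_neg_one, h]
  have hdisj : Disjoint O (O.image (·⁻¹)) := by
    rw [Finset.disjoint_left]
    intro x hx hx'
    obtain ⟨y, hy, rfl⟩ := Finset.mem_image.1 hx'
    obtain ⟨i, -, hi⟩ := (hmem _).1 hx
    obtain ⟨j, -, rfl⟩ := (hmem _).1 hy
    refine hmul i j (cast_pow_eq_neg_cast_pow_of_mul_eq_one hsθ ?_)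
    rw [← hi, inv_mul_cancel₀ (pow_ne_zero _ hθ0)]
  have hS : (O ∪ O.image (·⁻¹)).val ≤ R := by
    refine (Multiset.le_iff_subset (Finset.nodup _)).2 fun x hx => ?_
    rcases Finset.mem_union.1 hx with hx | hx
    · exact hOR x hx
    · obtain ⟨y, hy, rfl⟩ := Finset.mem_image.1 hx
      exact hinv y (hOR y hy)
  have hScard := Finset.card_union_of_disjoint hdisj
  have hle := Multiset.card_le_card hS
  rw [hR, Finset.card_val, hScard, hO'] at hle
  have hOm : O.card = m := by
    rw [ho] at hdvd
    obtain ⟨c, hc⟩ := hdvd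
    have : c < 2 := by
      by_contra h
      have : m * 2 ≤ m * c := Nat.mul_le_mul_left m (by omega)
      omega
    interval_cases c <;> omega
  rw [hOm] at hfix
  have hord (x : K) (hx : x ∈ O) : x ^ (q ^ m - 1) = 1 := by
    obtain ⟨i, -, rfl⟩ := (hmem x).1 hx
    rw [pow_right_comm, pow_sub_one_eq_one hθ0 (Nat.pow_pos hq) hfix, one_pow]
  have hsq (x : K) (hx : x ∈ O) : x ^ (q * q) ≠ x := by
    obtain ⟨i, -, rfl⟩ := (hmem x).1 hx
    exact pow_mul_self_ne_of_two_lt_orderOf hinj hθ0 hsθ hq (by omega) i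
  have hfr (x : K) (hx : x ∈ O) : x ^ q ∈ O := pow_pow_mem_of_mem_orbit (by rw [hOm, hfix]) hmem hx
  refine ⟨_, by rw [hScard, hO']; omega, hS, fun x hx => ?_, fun x hx => ?_, fun x hx => ?_⟩ <;>
    rcases Finset.mem_union.1 hx with hx | hx
  · exact Finset.mem_union_left _ (hfr x hx)
  · obtain ⟨y, hy, rfl⟩ := Finset.mem_image.1 hx
    exact Finset.mem_union_right _ (Finset.mem_image.2 ⟨_, hfr y hy, (inv_pow y q).symm⟩)
  · exact hsq x hx
  · obtain ⟨y, hy, rfl⟩ := Finset.mem_image.1 hx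
    simpa using hsq y hy
  · exact hord x hx
  · obtain ⟨y, hy, rfl⟩ := Finset.mem_image.1 hx
    simpa using hord y hy

theorem exists_eigenvalues_of_orderOf_eq_two_mul_odd [Finite K]
    (hinj : Function.Injective fun x : K => x ^ q)
    (hq : 0 < q) {m : ℕ} (hm : 2 < m) (hR : R.card = 2 * (m + 1)) (h0 : (0 : K) ∉ R)
    (hθ : θ ∈ R)
    (hfrob : R.map (· ^ q) = R) (hinv : ∀ x ∈ R, x⁻¹ ∈ R) (hs : s.Prime) (hsθ : s ∣ orderOf θ)
    (ho : orderOf (q : ZMod s) = 2 * m) :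
    ∃ S : Finset K, S.card = 2 * m ∧ S.val ≤ R ∧ (∀ x ∈ S, x ^ q ∈ S) ∧
      (∀ x ∈ S, x ^ (q * q) ≠ x) ∧ ∀ x ∈ S, x ^ (q ^ m + 1) = 1 := by
  have hθ0 : θ ≠ 0 := fun h => h0 (h ▸ hθ)
  obtain ⟨O, hpos, hdvd, hfix, hmem⟩ := exists_frobenius_orbit hinj hθ0 hsθ hq
  have hOR : ∀ x ∈ O, x ∈ R := fun x hx => by
    obtain ⟨i, -, rfl⟩ := (hmem x).1 hx
    exact pow_pow_mem_of_map_eq hfrob hθ i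
  have hO' : (O.image (·⁻¹)).card = O.card := Finset.card_image_of_injective _ inv_injective
  obtain ⟨hne, hq0⟩ := one_ne_neg_one_of_two_le_orderOf hs ho (by omega)
  have hOm : O.card = 2 * m := by
    have hle := Multiset.card_le_card ((Multiset.le_iff_subset O.nodup).2 hOR)
    rw [hR, Finset.card_val] at hle
    rw [ho] at hdvd
    obtain ⟨c, hc⟩ := hdvd
    have : c < 2 := by
      by_contra h
      have : 2 * m * 2 ≤ 2 * m * c := Nat.mul_le_mul_left _ (by omega)
      omega
    interval_cases c <;> omega
  have hθinv : θ⁻¹ ∈ O := by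
    by_contra hcon
    have hdisj : Disjoint O (O.image (·⁻¹)) := by
      rw [Finset.disjoint_left]
      intro x hx hx'
      obtain ⟨y, hy, rfl⟩ := Finset.mem_image.1 hx'
      obtain ⟨j, hj, rfl⟩ := (hmem _).1 hy
      have key (i : ℕ) : (θ ^ q ^ (j + i))⁻¹ ∈ O := by
        induction i with
        | zero => exact hx
        | succ i ih =>
          have := pow_pow_mem_of_mem_orbit hfix hmem ih
          rwa [inv_pow, ← pow_mul, ← pow_succ] at this
      refine hcon ?_
      have := key (O.card - j)
      rwa [Nat.add_sub_cancel' hj.le, hfix] at this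
    have hS : (O ∪ O.image (·⁻¹)).val ≤ R := by
      refine (Multiset.le_iff_subset (Finset.nodup _)).2 fun x hx => ?_
      rcases Finset.mem_union.1 hx with hx | hx
      · exact hOR x hx
      · obtain ⟨y, hy, rfl⟩ := Finset.mem_image.1 hx
        exact hinv y (hOR y hy)
    have hle := Multiset.card_le_card hS
    rw [hR, Finset.card_val, Finset.card_union_of_disjoint hdisj, hO', hOm] at hle
    omega
  have hθm : θ ^ (q ^ m + 1) = 1 := by
    obtain ⟨j, hj, hj'⟩ := (hmem _).1 hθinv
    have h1 := cast_pow_eq_neg_one_of_mul_eq_one hsθ hj' hθ0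
    have h2 : 2 * m ∣ 2 * j := by
      rw [← ho]
      refine orderOf_dvd_of_pow_eq_one ?_
      rw [mul_comm, pow_mul, h1, neg_one_sq]
    obtain ⟨c, rfl⟩ := Nat.dvd_of_mul_dvd_mul_left two_pos h2
    have hc : c < 2 := by
      by_contra h
      have : m * 2 ≤ m * c := Nat.mul_le_mul_left m (by omega)
      omega
    interval_cases c
    · exact absurd (by simpa using h1) hne
    · rw [pow_succ, ← mul_one m, ← hj', inv_mul_cancel₀ hθ0]
  refine ⟨O, hOm, (Multiset.le_iff_subset O.nodup).2 hOR,
    fun x hx => pow_pow_mem_of_mem_orbit hfix hmem hx, fun x hx => ?_, fun x hx => ?_⟩ <;>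
    obtain ⟨i, -, rfl⟩ := (hmem x).1 hx
  · exact pow_mul_self_ne_of_two_lt_orderOf hinj hθ0 hsθ hq (by omega) i
  · rw [pow_right_comm, hθm, one_pow]

theorem residual_eigenvalues (hinj : Function.Injective fun x : K => x ^ q) {S : Finset K}
    (hcard : R.card = S.card + 2) (hS : S.val ≤ R) (hfrob : R.map (· ^ q) = R)
    (hinv : ∀ x ∈ R, x⁻¹ ∈ R) (h0 : (0 : K) ∉ R) (hSq : ∀ x ∈ S, x ^ q ∈ S)
    (hSne : ∀ x ∈ S, x ^ (q * q) ≠ x) (hq : 0 < q) :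
    (R.Nodup ∧ ∀ x ∈ R, x ∈ S ∨ x ^ (q - 1) = 1) ∨ (R.Nodup ∧ ∀ x ∈ R, x ∈ S ∨ x ^ (q + 1) = 1) ∨
      ((∀ x, R.count x ≤ 2) ∧ ∀ x ∈ R, x ∈ S ∨ x ^ 2 = 1) := by
  obtain ⟨U, rfl⟩ := Multiset.le_iff_exists_add.1 hS
  have hU : U.card = 2 := by
    rw [Multiset.card_add, Finset.card_val] at hcard
    omega
  obtain ⟨μ, ν, rfl⟩ := Multiset.card_eq_two.1 hU
  have hSS : S.val.map (· ^ q) = S.val := by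
    rw [← Finset.image_val_of_injOn hinj.injOn]
    congr 1
    refine Finset.eq_of_subset_of_card_le (Finset.image_subset_iff.2 hSq) ?_
    rw [Finset.card_image_of_injective _ hinj]
  have hpair : ({μ ^ q, ν ^ q} : Multiset K) = {μ, ν} := by
    rw [Multiset.map_add, hSS] at hfrob
    simpa using add_left_cancel hfrob
  have hpair' : (μ ^ q = μ ∧ ν ^ q = ν) ∨ (μ ^ q = ν ∧ ν ^ q = μ) := by
    have h1 := hpair
    rw [Multiset.insert_eq_cons, Multiset.insert_eq_cons, Multiset.cons_eq_cons] at h1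
    rcases h1 with ⟨h1, h2⟩ | ⟨h1, t, h2, h3⟩
    · exact Or.inl ⟨h1, by simpa using h2⟩
    · have ht : t = 0 := by
        have := congrArg Multiset.card h2
        simpa using this
      subst ht
      exact Or.inr ⟨by simpa using h3.symm, by simpa using h2⟩
  have hfix : ∀ x ∈ ({μ, ν} : Multiset K), x ^ (q * q) = x ∧ x ≠ 0 ∧ x ∉ S ∧ x⁻¹ ∈ ({μ, ν} : Multiset K) := by
    have aux (x : K) (hx : x ∈ ({μ, ν} : Multiset K)) : x ^ (q * q) = x := by
      simp only [Multiset.insert_eq_cons, Multiset.mem_cons, Multiset.mem_singleton] at hx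
      rw [pow_mul]
      rcases hpair' with ⟨h1, h2⟩ | ⟨h1, h2⟩ <;> rcases hx with rfl | rfl <;> simp [h1, h2]
    intro x hx
    have hxR : x ∈ S.val + {μ, ν} := Multiset.mem_add.2 (Or.inr hx)
    have hx2 := aux x hx
    refine ⟨hx2, fun h => h0 (h ▸ hxR), fun h => hSne x h hx2, ?_⟩
    refine (Multiset.mem_add.1 (hinv x hxR)).resolve_left fun h => hSne _ h ?_
    rw [inv_pow, hx2]
  have hμ := hfix μ (by simp)
  have hν := hfix ν (by simp)
  by_cases hμν : μ = ν
  · subst hμν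
    refine Or.inr (Or.inr ⟨fun x => ?_, fun x hx => ?_⟩)
    · rw [Multiset.count_add]
      by_cases hx : x ∈ S
      · have h1 : ({μ, μ} : Multiset K).count x = 0 := by
          rw [Multiset.count_eq_zero]
          intro h
          exact (hfix x h).2.2.1 hx
        have h2 := Multiset.nodup_iff_count_le_one.1 S.nodup x
        omega
      · rw [Multiset.count_eq_zero.2 hx, zero_add]
        exact (Multiset.count_le_card _ _).trans (by simp)
    · refine (Multiset.mem_add.1 hx).imp id fun h => ?_
      have h1 := hμ.2.2.2
      simp only [Multiset.insert_eq_cons, Multiset.mem_cons, Multiset.mem_singleton, or_self] at h h1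
      rw [h, sq]
      nth_rewrite 1 [← h1]
      exact inv_mul_cancel₀ hμ.2.1
  · have hnodup : (S.val + {μ, ν}).Nodup := by
      refine Multiset.nodup_add.2 ⟨S.nodup, by simpa using hμν, ?_⟩
      rw [Multiset.disjoint_left]
      exact fun hx h => (hfix _ h).2.2.1 hx
    rcases hpair' with ⟨h1, h2⟩ | ⟨h1, h2⟩
    · refine Or.inl ⟨hnodup, fun x hx => (Multiset.mem_add.1 hx).imp id fun h => ?_⟩
      simp only [Multiset.insert_eq_cons, Multiset.mem_cons, Multiset.mem_singleton] at h
      rcases h with rfl | rfl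
      exacts [pow_sub_one_eq_one hμ.2.1 hq h1, pow_sub_one_eq_one hν.2.1 hq h2]
    · have hμinv : μ⁻¹ = ν := by
        have h3 := hμ.2.2.2
        simp only [Multiset.insert_eq_cons, Multiset.mem_cons, Multiset.mem_singleton] at h3
        refine h3.resolve_left fun h3 => hμν ?_
        rw [← h1]
        rcases inv_eq_self₀.1 h3 with h4 | h4 | h4
        · rcases Nat.even_or_odd q with hq2 | hq2
          · have h5 : (-1 : K) = 1 := hinj (by simp [hq2.neg_one_pow])
            rw [h4, h5, one_pow]
          · rw [h4, hq2.neg_one_pow]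
        · exact absurd h4 hμ.2.1
        · rw [h4, one_pow]
      refine Or.inr (Or.inl ⟨hnodup, fun x hx => (Multiset.mem_add.1 hx).imp id fun h => ?_⟩)
      simp only [Multiset.insert_eq_cons, Multiset.mem_cons, Multiset.mem_singleton] at h
      rcases h with rfl | rfl
      · rw [pow_succ, h1, ← hμinv, inv_mul_cancel₀ hμ.2.1]
      · rw [pow_succ, h2, ← hμinv, mul_inv_cancel₀ hμ.2.1]

end EigenvalueMultisets

section ElementOrderBounds

variable {F K : Type*} [Field F] [Field K] [Algebra F K] {p q n : ℕ}

theorem pow_card_injective [Fintype F] (hF : Fintype.card F = q) :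
    Function.Injective fun x : K => x ^ q := by
  subst hF
  exact (FiniteField.frobeniusAlgHom F K).injective

open Polynomial in
theorem Matrix.SymplecticGroup.roots_charpoly_map [Fintype F] (hF : Fintype.card F = q)
    {A : Matrix (Fin n ⊕ Fin n) (Fin n ⊕ Fin n) F} (hA : A ∈ symplecticGroup (Fin n) F)
    {R : Multiset K} (hR : (A.charpoly.map (algebraMap F K)).roots = R)
    (hsplit : (A.charpoly.map (algebraMap F K)).Splits) :
    R.card = 2 * n ∧ 0 ∉ R ∧ R.map (· ^ q) = R ∧ ∀ x ∈ R, x⁻¹ ∈ R := by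
  subst hR hF
  have hmem (x : K) : x ∈ (A.charpoly.map (algebraMap F K)).roots ↔
      (A.map (algebraMap F K)).charpoly.IsRoot x := by
    rw [mem_roots (A.charpoly_monic.map _).ne_zero, Matrix.charpoly_map]
  have hinv {x : K} (hx : x ∈ (A.charpoly.map (algebraMap F K)).roots) :=
    SymplecticGroup.isRoot_charpoly_inv (SymplecticGroup.map_mem hA (algebraMap F K)) ((hmem x).1 hx)
  refine ⟨?_, fun h => (hinv h).1 rfl, ?_, fun x hx => (hmem _).2 (hinv hx).2⟩
  · rw [← hsplit.natDegree_eq_card_roots, natDegree_map, charpoly_natDegree_eq_dim,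
      Fintype.card_sum, Fintype.card_fin, two_mul]
  · have h := hsplit.roots_map_of_injective
      (i := (FiniteField.frobeniusAlgHom F K).toRingHom) (RingHom.injective _)
    rw [Polynomial.map_map, AlgHom.toRingHom_eq_coe, AlgHom.comp_algebraMap] at h
    exact h.symm

open Polynomial in
theorem Matrix.SymplecticGroup.coe_pow_eq_algebraMap {A : symplecticGroup (Fin n) F} [DecidableEq K]
    (hsplit : (A.val.charpoly.map (algebraMap F K)).Splits)
    (hnodup : (A.val.charpoly.map (algebraMap F K)).roots.Nodup) {N : ℕ} {δ : F}
    (h : ∀ x ∈ (A.val.charpoly.map (algebraMap F K)).roots, x ^ N = algebraMap F K δ) :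
    (A ^ N).val = algebraMap F _ δ := by
  have h1 := aeval_eq_zero_of_roots hsplit (f := X ^ N - C δ) (m := 1) (fun x hx => by
    rw [map_sub, map_pow, aeval_X, aeval_C, h x hx, sub_self])
    (Multiset.nodup_iff_count_le_one.1 hnodup)
  rw [pow_one, map_sub, map_pow, aeval_X, aeval_C, sub_eq_zero] at h1
  exact h1

theorem dvd_orderOf_coe_of_dvd_orderOf_mk {A : symplecticGroup (Fin n) F} {s : ℕ}
    (h : s ∣ orderOf (QuotientGroup.mk A : PSp n F)) : s ∣ orderOf A.val := by
  refine h.trans (orderOf_mk_dvd (Or.inl ?_))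
  exact pow_orderOf_eq_one A.val

theorem ne_char_of_two_le_orderOf [CharP F p] [Fintype F] (hF : Fintype.card F = q) {s : ℕ}
    (hs : s.Prime) (ho : 2 ≤ orderOf (q : ZMod s)) : s ≠ p := by
  rintro rfl
  refine (one_ne_neg_one_of_two_le_orderOf hs rfl ho).2 ?_
  rw [ZMod.natCast_eq_zero_iff, ← hF, ← CharP.cast_eq_zero_iff F, Nat.cast_card_eq_zero]

theorem orderOf_mk_dvd_of_orderOf_eq_two_mul [Fintype F] (hp : p.Prime) [CharP F p]
    (hF : Fintype.card F = q) (hn : 0 < n) {s : ℕ} (hs : s.Prime)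
    (ho : orderOf (q : ZMod s) = 2 * n) {A : symplecticGroup (Fin n) F}
    (hA : s ∣ orderOf (QuotientGroup.mk A : PSp n F)) :
    orderOf (QuotientGroup.mk A : PSp n F) ∣ (q ^ n + 1) / Nat.gcd 2 (q - 1) := by
  classical
  let K := A.val.charpoly.SplittingField
  have hsplit := Polynomial.SplittingField.splits A.val.charpoly
  have hq : 0 < q := hF ▸ Fintype.card_pos
  have hsp := ne_char_of_two_le_orderOf (p := p) hF hs (by omega)
  obtain ⟨θ, hθ, hsθ⟩ := exists_mem_roots_charpoly_dvd_orderOf hp hs hsp hsplit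
    (dvd_orderOf_coe_of_dvd_orderOf_mk hA)
  obtain ⟨hcard, h0, hfrob, hinv⟩ := SymplecticGroup.roots_charpoly_map hF A.2 rfl hsplit
  obtain ⟨hnodup, hθn, horb⟩ := eigenvalues_of_orderOf_eq_two_mul
    (pow_card_injective (K := K) hF) hq hn hcard h0 hθ hfrob hinv hs hsθ ho
  apply orderOf_mk_dvd
  rcases Nat.even_or_odd q with hq2 | hq2
  · have hg : Nat.gcd 2 (q - 1) = 1 :=
      Nat.coprime_two_left.2 (Nat.Even.sub_odd hq hq2 odd_one)
    rw [hg, Nat.div_one]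
    left
    rw [SymplecticGroup.coe_pow_eq_algebraMap hsplit hnodup (δ := 1), map_one]
    intro x hx
    obtain ⟨i, rfl⟩ := horb x hx
    rw [pow_right_comm, hθn, one_pow, map_one]
  · have hg : Nat.gcd 2 (q - 1) = 2 :=
      Nat.gcd_eq_left (Nat.Odd.sub_odd hq2 odd_one).two_dvd
    have h2 : 2 ∣ q ^ n + 1 := (hq2.pow.add_odd odd_one).two_dvd
    rw [hg]
    have h3 : θ ^ ((q ^ n + 1) / 2) * θ ^ ((q ^ n + 1) / 2) = 1 := by
      rw [← pow_add, ← two_mul, Nat.mul_div_cancel' h2, hθn]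
    rcases mul_self_eq_one_iff.1 h3 with h3 | h3
    · left
      rw [SymplecticGroup.coe_pow_eq_algebraMap hsplit hnodup (δ := 1), map_one]
      intro x hx
      obtain ⟨i, rfl⟩ := horb x hx
      rw [pow_right_comm, h3, one_pow, map_one]
    · right
      rw [SymplecticGroup.coe_pow_eq_algebraMap hsplit hnodup (δ := -1), map_neg, map_one]
      intro x hx
      obtain ⟨i, rfl⟩ := horb x hx
      rw [pow_right_comm, h3, hq2.pow.neg_one_pow, map_neg, map_one]

open Polynomial in
theorem orderOf_mk_dvd_of_subset_roots [Fintype F] (hp : p.Prime) [CharP F p]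
    (hF : Fintype.card F = q) {m a N : ℕ} [DecidableEq K]
    {A : symplecticGroup (Fin (m + 1)) F}
    (hsplit : (A.val.charpoly.map (algebraMap F K)).Splits) {S : Finset K} (hcard : S.card = 2 * m)
    (hS : S.val ≤ (A.val.charpoly.map (algebraMap F K)).roots) (hSq : ∀ x ∈ S, x ^ q ∈ S)
    (hSne : ∀ x ∈ S, x ^ (q * q) ≠ x) (hSa : ∀ x ∈ S, x ^ a = 1) (haN : a ∣ N)
    (hN1 : q - 1 ∣ N) (hN2 : q + 1 ∣ N) (ha : Odd q → Even a) :
    orderOf (QuotientGroup.mk A : PSp (m + 1) F) ∣ N ∨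
      orderOf (QuotientGroup.mk A : PSp (m + 1) F) ∣ p * a := by
  have hq : 0 < q := hF ▸ Fintype.card_pos
  have : Fact p.Prime := ⟨hp⟩
  have hinj := pow_card_injective (K := K) hF
  obtain ⟨hR, h0, hfrob, hinv⟩ := SymplecticGroup.roots_charpoly_map hF A.2 rfl hsplit
  have hNd (hnodup : (A.val.charpoly.map (algebraMap F K)).roots.Nodup)
      (h : ∀ x ∈ (A.val.charpoly.map (algebraMap F K)).roots, x ^ N = 1) :
      orderOf (QuotientGroup.mk A : PSp (m + 1) F) ∣ N := by
    refine orderOf_mk_dvd (Or.inl ?_)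
    rw [SymplecticGroup.coe_pow_eq_algebraMap hsplit hnodup (δ := 1), map_one]
    simpa using h
  have hpow {x : K} {d : ℕ} (hd : d ∣ N) (hx : x ^ d = 1) : x ^ N = 1 :=
    orderOf_dvd_iff_pow_eq_one.1 ((orderOf_dvd_of_pow_eq_one hx).trans hd)
  rcases residual_eigenvalues hinj (by omega) hS hfrob hinv h0 hSq hSne hq with
    ⟨hnodup, h⟩ | ⟨hnodup, h⟩ | ⟨hcount, h⟩
  · exact Or.inl (hNd hnodup fun x hx => (h x hx).elim (fun hx => hpow haN (hSa x hx)) (hpow hN1))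
  · exact Or.inl (hNd hnodup fun x hx => (h x hx).elim (fun hx => hpow haN (hSa x hx)) (hpow hN2))
  · refine Or.inr (orderOf_mk_dvd (Or.inl ?_))
    have h1 : aeval A.val (X ^ a - 1 : F[X]) ^ p = 0 := by
      refine aeval_eq_zero_of_roots hsplit (fun x hx => ?_) fun x => (hcount x).trans hp.two_le
      rw [map_sub, map_pow, aeval_X, map_one, sub_eq_zero]
      rcases h x hx with hx | hx
      · exact hSa x hx
      · rcases mul_self_eq_one_iff.1 ((sq x).symm.trans hx) with rfl | rfl
        · exact one_pow a
        · rcases Nat.even_or_odd q with hq2 | hq2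
          · have h5 : (-1 : K) = 1 := hinj (by simp [hq2.neg_one_pow])
            rw [h5, one_pow]
          · exact (ha hq2).neg_one_pow
    rw [← map_pow, sub_pow_char, one_pow, ← pow_mul, map_sub, map_pow, aeval_X, map_one,
      sub_eq_zero, mul_comm] at h1
    exact h1

/-- Orders of elements divisible by a primitive prime divisor of `q ^ m - 1`. -/
theorem orderOf_mk_dvd_of_orderOf_eq_odd [Fintype F] (hp : p.Prime) [CharP F p]
    (hF : Fintype.card F = q) {m N : ℕ} (hm : 2 < m) (hmodd : Odd m) {s : ℕ} (hs : s.Prime)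
    (ho : orderOf (q : ZMod s) = m) (haN : q ^ m - 1 ∣ N)
    (hN1 : q - 1 ∣ N) (hN2 : q + 1 ∣ N) {A : symplecticGroup (Fin (m + 1)) F}
    (hA : s ∣ orderOf (QuotientGroup.mk A : PSp (m + 1) F)) :
    orderOf (QuotientGroup.mk A : PSp (m + 1) F) ∣ N ∨
      orderOf (QuotientGroup.mk A : PSp (m + 1) F) ∣ p * (q ^ m - 1) := by
  classical
  let K := A.val.charpoly.SplittingField
  have hsplit := Polynomial.SplittingField.splits A.val.charpoly
  have hq : 0 < q := hF ▸ Fintype.card_pos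
  have hsp := ne_char_of_two_le_orderOf (p := p) hF hs (by omega)
  obtain ⟨θ, hθ, hsθ⟩ := exists_mem_roots_charpoly_dvd_orderOf hp hs hsp hsplit
    (dvd_orderOf_coe_of_dvd_orderOf_mk hA)
  obtain ⟨hcard, h0, hfrob, hinv⟩ := SymplecticGroup.roots_charpoly_map hF A.2 rfl hsplit
  obtain ⟨S, hScard, hS, hSq, hSne, hSa⟩ := exists_eigenvalues_of_orderOf_eq_odd
    (pow_card_injective (K := K) hF) hq hm hmodd hcard h0 hθ hfrob hinv hs hsθ ho
  exact orderOf_mk_dvd_of_subset_roots hp hF hsplit hScard hS hSq hSne hSa haN hN1 hN2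
    fun hq2 => Nat.Odd.sub_odd hq2.pow odd_one

/-- Orders of elements divisible by a primitive prime divisor of `q ^ (2 * m) - 1`. -/
theorem orderOf_mk_dvd_of_orderOf_eq_two_mul_sub_one [Fintype F] (hp : p.Prime) [CharP F p]
    (hF : Fintype.card F = q) {m N : ℕ} (hm : 2 < m) {s : ℕ} (hs : s.Prime)
    (ho : orderOf (q : ZMod s) = 2 * m) (haN : q ^ m + 1 ∣ N)
    (hN1 : q - 1 ∣ N) (hN2 : q + 1 ∣ N) {A : symplecticGroup (Fin (m + 1)) F}
    (hA : s ∣ orderOf (QuotientGroup.mk A : PSp (m + 1) F)) :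
    orderOf (QuotientGroup.mk A : PSp (m + 1) F) ∣ N ∨
      orderOf (QuotientGroup.mk A : PSp (m + 1) F) ∣ p * (q ^ m + 1) := by
  classical
  let K := A.val.charpoly.SplittingField
  have hsplit := Polynomial.SplittingField.splits A.val.charpoly
  have hq : 0 < q := hF ▸ Fintype.card_pos
  have hsp := ne_char_of_two_le_orderOf (p := p) hF hs (by omega)
  obtain ⟨θ, hθ, hsθ⟩ := exists_mem_roots_charpoly_dvd_orderOf hp hs hsp hsplit
    (dvd_orderOf_coe_of_dvd_orderOf_mk hA)
  obtain ⟨hcard, h0, hfrob, hinv⟩ := SymplecticGroup.roots_charpoly_map hF A.2 rfl hsplit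
  obtain ⟨S, hScard, hS, hSq, hSne, hSa⟩ := exists_eigenvalues_of_orderOf_eq_two_mul_odd
    (pow_card_injective (K := K) hF) hq hm hcard h0 hθ hfrob hinv hs hsθ ho
  exact orderOf_mk_dvd_of_subset_roots hp hF hsplit hScard hS hSq hSne hSa haN hN1 hN2
    fun hq2 => hq2.pow.add_odd odd_one

end ElementOrderBounds

section Neg

variable {K : Type*} [Field K]

theorem neg_one_eq_one_of_even_card [Finite K] (h : Even (Nat.card K)) : (-1 : K) = 1 := by
  have := Fintype.ofFinite K
  rw [← FiniteField.pow_card (-1 : K), Fintype.card_eq_nat_card, h.neg_one_pow]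

theorem Matrix.SpecialLinearGroup.orderOf_dvd_two_mul {x : SpecialLinearGroup (Fin 2) K} {k : ℕ}
    (h : (x ^ k).val = -1) : orderOf x ∣ 2 * k := by
  have h2 : (x ^ k) ^ 2 = 1 := Subtype.ext ((congrArg (· ^ 2) h).trans neg_one_sq)
  rw [← pow_mul, mul_comm] at h2
  exact orderOf_dvd_of_pow_eq_one h2

theorem Matrix.SpecialLinearGroup.eq_one_of_neg_one_eq_one (h1 : (-1 : K) = 1)
    {x : SpecialLinearGroup (Fin 2) K} (h : x.val = -1) : x = 1 := by
  refine Subtype.ext (h.trans ?_)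
  ext i j
  fin_cases i <;> fin_cases j <;> simp [h1]

end Neg

section Existence

variable {F K : Type*} [Field F] [Finite F] [Field K] [Algebra F K] [Module.Finite F K] {n : ℕ}

theorem lcm_orderOf_mem_elementOrders [NeZero n] (hn : Module.finrank F K + 1 = n)
    (x : SpecialLinearGroup (Fin 2) K) (y : SpecialLinearGroup (Fin 2) F)
    (h : ∀ k, (x ^ k).val = -1 → (y ^ k).val = -1 → x ^ k = 1 ∧ y ^ k = 1) :
    (orderOf x).lcm (orderOf y) ∈ elementOrders (PSp n F) := by
  obtain ⟨φ, hφ⟩ := exists_hom_prod_specialLinearGroup_symplecticGroup hn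
  have hpow (k : ℕ) : φ (x, y) ^ k = φ (x ^ k, y ^ k) := by rw [← map_pow, Prod.pow_mk]
  refine ⟨QuotientGroup.mk (φ (x, y)), Nat.dvd_antisymm (orderOf_mk_dvd (Or.inl ?_))
    (dvd_orderOf_mk fun k hk => ?_)⟩
  · rw [hpow, orderOf_dvd_iff_pow_eq_one.1 (Nat.dvd_lcm_left _ _),
      orderOf_dvd_iff_pow_eq_one.1 (Nat.dvd_lcm_right _ _), Prod.mk_one_one, map_one]
    rfl
  · rw [hpow] at hk
    have hxy : x ^ k = 1 ∧ y ^ k = 1 := by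
      rcases hk with hk | hk
      · exact Prod.mk_eq_one.1 ((hφ _).1 hk)
      · exact h k ((hφ _).2 hk).1 ((hφ _).2 hk).2
    exact Nat.lcm_dvd (orderOf_dvd_of_pow_eq_one hxy.1) (orderOf_dvd_of_pow_eq_one hxy.2)

theorem exists_dvd_orderOf_mk [NeZero n] {q : ℕ} (hq : Nat.card F = q)
    (hn : Module.finrank F K = n) :
    ∃ A : symplecticGroup (Fin n) F,
      (q ^ n + 1) / Nat.gcd 2 (q - 1) ∣ orderOf (QuotientGroup.mk A : PSp n F) := by
  have : Finite K := Module.finite_of_finite F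
  have hK : Nat.card K = q ^ n := by rw [← hq, ← hn, Module.natCard_eq_pow_finrank (K := F)]
  obtain ⟨f, hf⟩ := exists_linearMap_nondegenerate F K
  obtain ⟨φ, hφ⟩ := exists_hom_specialLinearGroup_symplecticGroup hn f hf
  obtain ⟨g, hg⟩ := exists_specialLinearGroup_orderOf_eq_card_add_one K
  rw [hK] at hg
  have hq0 : 0 < q := hq ▸ Nat.card_pos
  refine ⟨φ g, dvd_orderOf_mk fun k hk => ?_⟩
  rw [← map_pow] at hk
  rcases hk with hk | hk
  · refine (Nat.div_dvd_of_dvd ?_).trans (hg ▸ orderOf_dvd_of_pow_eq_one ((hφ _).1 hk))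
    rcases Nat.even_or_odd q with hq2 | hq2
    · rw [Nat.coprime_two_left.2 (Nat.Even.sub_odd hq0 hq2 odd_one)]
      exact one_dvd _
    · exact (Nat.gcd_dvd_left _ _).trans (hq2.pow.add_odd odd_one).two_dvd
  · have h1 := (hφ _).2 hk
    rcases Nat.even_or_odd q with hq2 | hq2
    · rw [Nat.coprime_two_left.2 (Nat.Even.sub_odd hq0 hq2 odd_one), Nat.div_one, ← hg]
      refine orderOf_dvd_of_pow_eq_one (SpecialLinearGroup.eq_one_of_neg_one_eq_one ?_ h1)
      have hF1 : (-1 : F) = 1 := neg_one_eq_one_of_even_card (hq ▸ hq2)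
      simpa using congrArg (algebraMap F K) hF1
    · rw [Nat.gcd_eq_left (Nat.Odd.sub_odd hq2 odd_one).two_dvd]
      exact (Nat.div_dvd_iff_dvd_mul (hq2.pow.add_odd odd_one).two_dvd two_pos).2
        (hg ▸ SpecialLinearGroup.orderOf_dvd_two_mul h1)

end Existence

theorem dvd_of_dvd_two_mul {b k : ℕ} (hb : ¬ 4 ∣ b) (hbk : b ∣ 2 * k) (hk : Even k) : b ∣ k := by
  rcases Nat.even_or_odd b with h | h
  · obtain ⟨c, rfl⟩ := h.two_dvd
    obtain ⟨j, rfl⟩ := hk.two_dvd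
    have hc : Odd c := by
      rw [← Nat.not_even_iff_odd]
      exact fun h => hb (mul_dvd_mul_left 2 h.two_dvd)
    exact mul_dvd_mul_left 2 (hc.coprime_two_right.dvd_of_dvd_mul_left
      (Nat.dvd_of_mul_dvd_mul_left two_pos hbk))
  · exact h.coprime_two_right.dvd_of_dvd_mul_left hbk

theorem dvd_or_dvd_of_dvd_two_mul {a b k : ℕ} (h : 4 ∣ a ∧ ¬ 4 ∣ b ∨ ¬ 4 ∣ a ∧ 4 ∣ b)
    (ha : a ∣ 2 * k) (hb : b ∣ 2 * k) : a ∣ k ∨ b ∣ k := by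
  have heven {c : ℕ} (hc : 4 ∣ c) (hck : c ∣ 2 * k) : Even k :=
    even_iff_two_dvd.2 (Nat.dvd_of_mul_dvd_mul_left two_pos (hc.trans hck))
  rcases h with ⟨h1, h2⟩ | ⟨h1, h2⟩
  · exact Or.inr (dvd_of_dvd_two_mul h2 hb (heven h1 ha))
  · exact Or.inl (dvd_of_dvd_two_mul h1 ha (heven h2 hb))

theorem Odd.pow_mod_four {q m : ℕ} (hq : Odd q) (hm : Odd m) : q ^ m % 4 = q % 4 := by
  obtain ⟨j, rfl⟩ := hm
  obtain ⟨i, rfl⟩ := hq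
  have h : (2 * i + 1) ^ 2 % 4 = 1 := by
    rw [show (2 * i + 1) ^ 2 = 4 * (i * i + i) + 1 by ring]
    omega
  rw [pow_succ, pow_mul, Nat.mul_mod, Nat.pow_mod, h]
  simp

/-- `q ^ m - 1` and `q + 1`, or `q ^ m + 1` and `q - 1`. -/
theorem gcd_eq_gcd_two_sub_one {q m a b : ℕ} (hq : 0 < q) (hm : Odd m)
    (hab : a = q ^ m - 1 ∧ b = q + 1 ∨ a = q ^ m + 1 ∧ b = q - 1) :
    a.gcd b = Nat.gcd 2 (q - 1) := by
  have hqm : 0 < q ^ m := Nat.pow_pos hq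
  rcases hab with ⟨rfl, rfl⟩ | ⟨rfl, rfl⟩
  · obtain ⟨c, hc⟩ : q + 1 ∣ q ^ m + 1 := by simpa using hm.nat_add_dvd_pow_add_pow q 1
    have h1 : Nat.gcd (q ^ m - 1) (q + 1) = Nat.gcd 2 (q + 1) := by
      refine Nat.dvd_antisymm (Nat.dvd_gcd ?_ (Nat.gcd_dvd_right _ _))
        (Nat.dvd_gcd ?_ (Nat.gcd_dvd_right _ _))
      · have h2 : q ^ m + 1 = (q ^ m - 1) + 2 := by omega
        have h3 : Nat.gcd (q ^ m - 1) (q + 1) ∣ q ^ m + 1 :=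
          (Nat.gcd_dvd_right _ _).trans ⟨c, hc⟩
        rw [h2] at h3
        exact (Nat.dvd_add_right (Nat.gcd_dvd_left _ _)).1 h3
      · have h3 : Nat.gcd 2 (q + 1) ∣ q ^ m + 1 := (Nat.gcd_dvd_right _ _).trans ⟨c, hc⟩
        rw [show q ^ m + 1 = (q ^ m - 1) + 2 by omega] at h3
        exact (Nat.dvd_add_left (Nat.gcd_dvd_left _ _)).1 h3
    rw [h1, show q + 1 = q - 1 + 2 by omega, Nat.gcd_add_self_right]
  · have hd : q - 1 ∣ q ^ m - 1 := by simpa using Nat.sub_dvd_pow_sub_pow q 1 m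
    obtain ⟨c, hc⟩ := hd
    rw [show q ^ m + 1 = 2 + (q - 1) * c by omega, Nat.gcd_add_mul_left_left]

theorem four_dvd_xor {q m a b : ℕ} (hq : Odd q) (hm : Odd m)
    (hab : a = q ^ m - 1 ∧ b = q + 1 ∨ a = q ^ m + 1 ∧ b = q - 1) :
    4 ∣ a ∧ ¬ 4 ∣ b ∨ ¬ 4 ∣ a ∧ 4 ∣ b := by
  have h := hq.pow_mod_four hm
  have := Nat.odd_iff.1 hq
  rcases hab with ⟨rfl, rfl⟩ | ⟨rfl, rfl⟩ <;> omega

section TorusOrders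

variable {F : Type*} [Field F] [Fintype F] {p q m a b : ℕ}

theorem exists_specialLinearGroup_orderOf_eq_of_card {K : Type*} [Field K] [Finite K] {c d : ℕ}
    (hc : Nat.card K = c) (hd : d = c - 1 ∨ d = c + 1) :
    ∃ x : SpecialLinearGroup (Fin 2) K, orderOf x = d := by
  subst hc
  rcases hd with rfl | rfl
  · exact exists_specialLinearGroup_orderOf_eq_card_sub_one K
  · exact exists_specialLinearGroup_orderOf_eq_card_add_one K

theorem lcm_mem_elementOrders (hp : p.Prime) [CharP F p] (hF : Fintype.card F = q) (hm : Odd m)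
    (hab : a = q ^ m - 1 ∧ b = q + 1 ∨ a = q ^ m + 1 ∧ b = q - 1) :
    a.lcm b ∈ elementOrders (PSp (m + 1) F) := by
  have : Fact p.Prime := ⟨hp⟩
  have : NeZero m := ⟨hm.pos.ne'⟩
  rw [Fintype.card_eq_nat_card] at hF
  have hq : 0 < q := hF ▸ Nat.card_pos
  let K := FiniteField.Extension F p m
  have hK : Nat.card K = q ^ m := hF ▸ FiniteField.natCard_extension F p m
  obtain ⟨x, hx⟩ := exists_specialLinearGroup_orderOf_eq_of_card hK (hab.imp And.left And.left)
  obtain ⟨y, hy⟩ := exists_specialLinearGroup_orderOf_eq_of_card hF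
    (hab.symm.imp And.right And.right)
  rw [← hx, ← hy]
  refine lcm_orderOf_mem_elementOrders (by rw [FiniteField.finrank_extension]) x y fun k hxk hyk => ?_
  have hF1 : (-1 : F) = 1 := by
    rcases Nat.even_or_odd q with hq2 | hq2
    · exact neg_one_eq_one_of_even_card (hF ▸ hq2)
    · rcases dvd_or_dvd_of_dvd_two_mul (four_dvd_xor hq2 hm hab)
        (hx ▸ SpecialLinearGroup.orderOf_dvd_two_mul hxk)
        (hy ▸ SpecialLinearGroup.orderOf_dvd_two_mul hyk) with h | h
      · rw [← hx, orderOf_dvd_iff_pow_eq_one] at h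
        rw [h] at hxk
        have := congrFun (congrFun hxk 0) 0
        apply (algebraMap F K).injective
        simpa using this.symm
      · rw [← hy, orderOf_dvd_iff_pow_eq_one] at h
        rw [h] at hyk
        simpa using (congrFun (congrFun hyk 0) 0).symm
  have hK1 : (-1 : K) = 1 := by simpa using congrArg (algebraMap F K) hF1
  exact ⟨SpecialLinearGroup.eq_one_of_neg_one_eq_one hK1 hxk,
    SpecialLinearGroup.eq_one_of_neg_one_eq_one hF1 hyk⟩

theorem mul_mem_elementOrders (hp : p.Prime) [CharP F p] (hF : Fintype.card F = q) (hm : Odd m)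
    (ha : a = q ^ m - 1 ∨ a = q ^ m + 1) :
    p * a ∈ elementOrders (PSp (m + 1) F) := by
  have : Fact p.Prime := ⟨hp⟩
  have : NeZero m := ⟨hm.pos.ne'⟩
  have hpq : p ∣ q := by
    rw [← CharP.cast_eq_zero_iff F, ← hF, Nat.cast_card_eq_zero]
  rw [Fintype.card_eq_nat_card] at hF
  have hq : 0 < q := hF ▸ Nat.card_pos
  let K := FiniteField.Extension F p m
  have hK : Nat.card K = q ^ m := hF ▸ FiniteField.natCard_extension F p m
  obtain ⟨x, hx⟩ := exists_specialLinearGroup_orderOf_eq_of_card hK ha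
  obtain ⟨y, hy, hy'⟩ := exists_specialLinearGroup_orderOf_eq_char F p
  have hcop : a.Coprime p := by
    rw [Nat.coprime_comm, hp.coprime_iff_not_dvd]
    intro h
    have hqm : p ∣ q ^ m := dvd_pow hpq hm.pos.ne'
    have hpos : 0 < q ^ m := Nat.pow_pos hq
    apply hp.one_lt.ne'
    rcases ha with rfl | rfl
    · exact Nat.dvd_one.1 ((Nat.dvd_sub_iff_right hpos hqm).1 h)
    · exact Nat.dvd_one.1 ((Nat.dvd_add_right hqm).1 h)
  have hlcm : p * a = (orderOf x).lcm (orderOf y) := by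
    rw [hx, hy, hcop.lcm_eq_mul, mul_comm]
  rw [hlcm]
  refine lcm_orderOf_mem_elementOrders (by rw [FiniteField.finrank_extension]) x y fun k hxk hyk => ?_
  have hF1 := hy' k hyk
  have hK1 : (-1 : K) = 1 := by simpa using congrArg (algebraMap F K) hF1
  exact ⟨SpecialLinearGroup.eq_one_of_neg_one_eq_one hK1 hxk,
    SpecialLinearGroup.eq_one_of_neg_one_eq_one hF1 hyk⟩

theorem dvd_pow_add_one_of_orderOf_eq_two_mul {q n s : ℕ} (hs : s.Prime) (hn : 0 < n)
    (ho : orderOf (q : ZMod s) = 2 * n) : s ∣ q ^ n + 1 := by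
  have : Fact s.Prime := ⟨hs⟩
  rw [← ZMod.natCast_eq_zero_iff]
  push_cast
  have h := pow_orderOf_eq_one (q : ZMod s)
  rw [ho, mul_comm, pow_mul, sq, mul_self_eq_one_iff] at h
  refine eq_neg_iff_add_eq_zero.1 (h.resolve_left fun h => ?_)
  have := Nat.le_of_dvd hn (orderOf_dvd_of_pow_eq_one h)
  omega

theorem div_mem_elementOrders {n s : ℕ} (hp : p.Prime) [CharP F p] (hF : Fintype.card F = q)
    (hn : 0 < n) (hs : s.Prime) (ho : orderOf (q : ZMod s) = 2 * n) :
    (q ^ n + 1) / Nat.gcd 2 (q - 1) ∈ elementOrders (PSp n F) := by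
  have : Fact p.Prime := ⟨hp⟩
  have : NeZero n := ⟨hn.ne'⟩
  let K := FiniteField.Extension F p n
  obtain ⟨A, hA⟩ := exists_dvd_orderOf_mk (K := K) (Fintype.card_eq_nat_card.symm.trans hF)
    (FiniteField.finrank_extension F p n)
  refine ⟨_, Nat.dvd_antisymm
    (orderOf_mk_dvd_of_orderOf_eq_two_mul hp hF hn hs ho (dvd_trans ?_ hA)) hA⟩
  have hs2 : s ≠ 2 := by
    rintro rfl
    have h := (one_ne_neg_one_of_two_le_orderOf hs ho (by omega)).1
    exact h (by decide)
  rcases (Nat.dvd_prime Nat.prime_two).1 (Nat.gcd_dvd_left 2 (q - 1)) with hg | hg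
  · rw [hg, Nat.div_one]
    exact dvd_pow_add_one_of_orderOf_eq_two_mul hs hn ho
  · have h2 : 2 ∣ q ^ n + 1 := by
      have h := hg ▸ Nat.gcd_dvd_right 2 (q - 1)
      have hq : 0 < q := hF ▸ Fintype.card_pos
      have hq2 : Odd q := Nat.odd_iff.2 (by omega)
      exact (hq2.pow.add_odd odd_one).two_dvd
    rw [hg]
    have h := dvd_pow_add_one_of_orderOf_eq_two_mul hs hn ho
    rw [← Nat.mul_div_cancel' h2] at h
    exact (hs.dvd_mul.1 h).resolve_left fun h =>
      hs2 ((Nat.prime_dvd_prime_iff_eq hs Nat.prime_two).1 h)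

end TorusOrders

section Arithmetic

variable {q m a b : ℕ}

theorem dvd_pow_sub_one_of_dvd_mul
    (hab : a = q ^ m - 1 ∧ b = q + 1 ∨ a = q ^ m + 1 ∧ b = q - 1) {r : ℕ} (hr : r.Prime)
    (h : r ∣ a * b) : r ∣ q ^ (2 * m) - 1 := by
  have key (c d : ℕ) (hd : d ∣ m) (hc : c = q ^ d - 1 ∨ c = q ^ d + 1) : c ∣ q ^ (2 * m) - 1 := by
    have h1 : c ∣ q ^ (2 * d) - 1 := by
      rw [mul_comm, pow_mul, ← one_pow 2, Nat.sq_sub_sq]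
      rcases hc with rfl | rfl
      exacts [dvd_mul_left _ _, dvd_mul_right _ _]
    exact h1.trans (Nat.pow_sub_one_dvd_pow_sub_one q (mul_dvd_mul_left 2 hd))
  rcases hr.dvd_mul.1 h with h | h
  · exact h.trans (key a m dvd_rfl (hab.imp And.left And.left))
  · exact h.trans (key b 1 (one_dvd m) (by simpa using hab.symm.imp And.right And.right))

theorem not_prime_dvd_mul_of_dvd_div {p r : ℕ} (hpq : p ∣ q) (hq : 0 < q)
    (hm : Odd m) (hab : a = q ^ m - 1 ∧ b = q + 1 ∨ a = q ^ m + 1 ∧ b = q - 1) (hr : r.Prime)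
    (h : r ∣ (q ^ (m + 1) + 1) / Nat.gcd 2 (q - 1)) : ¬ r ∣ p * (a * b) := by
  have hr' : r ∣ q ^ (m + 1) + 1 := by
    refine h.trans (Nat.div_dvd_of_dvd ?_)
    rcases Nat.even_or_odd q with hq2 | hq2
    · rw [Nat.coprime_two_left.2 (Nat.Even.sub_odd hq hq2 odd_one)]
      exact one_dvd _
    · exact (Nat.gcd_dvd_left _ _).trans (hq2.pow.add_odd odd_one).two_dvd
  intro hcon
  rcases hr.dvd_mul.1 hcon with hrp | hrab
  · have h1 : r ∣ q ^ (m + 1) := dvd_pow (hrp.trans hpq) m.succ_ne_zero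
    exact hr.one_lt.ne' (Nat.dvd_one.1 ((Nat.dvd_add_right h1).1 hr'))
  · have hfact : Fact r.Prime := ⟨hr⟩
    have h1 : (q : ZMod r) ^ (2 * m) = 1 := by
      have h2 := (ZMod.natCast_eq_zero_iff _ _).2 (dvd_pow_sub_one_of_dvd_mul hab hr hrab)
      rw [Nat.cast_sub (Nat.pow_pos hq), sub_eq_zero] at h2
      exact_mod_cast h2
    have h3 : (q : ZMod r) ^ (m + 1) = -1 := by
      have h2 := (ZMod.natCast_eq_zero_iff _ _).2 hr'
      push_cast at h2
      exact eq_neg_of_add_eq_zero_left h2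
    have h4 : (q : ZMod r) ^ 2 = 1 := by
      have h5 : (q : ZMod r) ^ (2 * m) * (q : ZMod r) ^ 2 = (q ^ (m + 1)) ^ 2 := by ring
      rwa [h1, h3, neg_one_sq, one_mul] at h5
    obtain ⟨c, hc⟩ := hm.add_odd odd_one
    have h5 : (1 : ZMod r) = -1 := by
      rw [← h3, hc, ← two_mul, pow_mul, h4, one_pow]
    have hr2 : r = 2 := by
      refine (Nat.prime_dvd_prime_iff_eq hr Nat.prime_two).1 ((ZMod.natCast_eq_zero_iff _ _).1 ?_)
      push_cast
      linear_combination h5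
    subst hr2
    rcases Nat.even_or_odd q with hq2 | hq2
    · have := (hq2.pow_of_ne_zero m.succ_ne_zero).add_odd odd_one
      exact (Nat.not_even_iff_odd.2 this) (even_iff_two_dvd.2 hr')
    · rw [Nat.gcd_eq_left (Nat.Odd.sub_odd hq2 odd_one).two_dvd, hc, ← two_mul, mul_comm, pow_mul] at h
      obtain ⟨i, hi⟩ := hq2.pow (n := c)
      rw [hi, show (2 * i + 1) ^ 2 + 1 = 2 * (2 * (i * i + i) + 1) by ring] at h
      omega

theorem sub_one_dvd_lcm_and_add_one_dvd_lcm (hm : Odd m)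
    (hab : a = q ^ m - 1 ∧ b = q + 1 ∨ a = q ^ m + 1 ∧ b = q - 1) :
    q - 1 ∣ a.lcm b ∧ q + 1 ∣ a.lcm b := by
  rcases hab with ⟨rfl, rfl⟩ | ⟨rfl, rfl⟩
  · refine ⟨dvd_trans ?_ (Nat.dvd_lcm_left _ _), Nat.dvd_lcm_right _ _⟩
    simpa using Nat.sub_dvd_pow_sub_pow q 1 m
  · refine ⟨Nat.dvd_lcm_right _ _, dvd_trans ?_ (Nat.dvd_lcm_left _ _)⟩
    simpa using hm.nat_add_dvd_pow_add_pow q 1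

theorem int_mul_div_gcd_eq_lcm (hq : 0 < q) (hm : Odd m) {ε : ℤ} (ha : (a : ℤ) = q ^ m - ε)
    (hb : (b : ℤ) = q + ε)
    (hab : a = q ^ m - 1 ∧ b = q + 1 ∨ a = q ^ m + 1 ∧ b = q - 1) :
    ((q : ℤ) ^ m - ε) * ((q : ℤ) + ε) / (Nat.gcd 2 (q - 1) : ℤ) = (a.lcm b : ℕ) := by
  rw [← ha, ← hb, ← gcd_eq_gcd_two_sub_one hq hm hab, Nat.lcm]
  norm_cast

end Arithmetic

theorem disjoint_neighborhoods_of_odd {p q m a b : ℕ} (hp : p.Prime) {F : Type*} [Field F]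
    [Fintype F] [CharP F p] (hF : Fintype.card F = q) (hm : 2 < m) (hmodd : Odd m) {s1 s2 : ℕ}
    (hs1 : s1.Prime) (hs2 : s2.Prime) (ho1 : orderOf (q : ZMod s1) = 2 * (m + 1))
    (h : a = q ^ m - 1 ∧ b = q + 1 ∧ orderOf (q : ZMod s2) = m ∨
      a = q ^ m + 1 ∧ b = q - 1 ∧ orderOf (q : ZMod s2) = 2 * m) :
    (s1 * s2 ∉ elementOrders (PSp (m + 1) F) ∧
      ¬ ∃ r : ℕ, r.Prime ∧ r * s1 ∈ elementOrders (PSp (m + 1) F) ∧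
        r * s2 ∈ elementOrders (PSp (m + 1) F)) ∧
    (∀ c ∈ elementOrders (PSp (m + 1) F), s1 ∣ c →
      c ∣ (q ^ (m + 1) + 1) / Nat.gcd 2 (q - 1)) ∧
    ∀ c ∈ elementOrders (PSp (m + 1) F), s2 ∣ c → c ∣ a.lcm b ∨ c ∣ p * a := by
  have hab : a = q ^ m - 1 ∧ b = q + 1 ∨ a = q ^ m + 1 ∧ b = q - 1 :=
    h.imp (fun h => ⟨h.1, h.2.1⟩) fun h => ⟨h.1, h.2.1⟩
  have hq : 0 < q := hF ▸ Fintype.card_pos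
  have hpq : p ∣ q := by
    rw [← CharP.cast_eq_zero_iff F, ← hF, Nat.cast_card_eq_zero]
  have hbound1 : ∀ c ∈ elementOrders (PSp (m + 1) F), s1 ∣ c →
      c ∣ (q ^ (m + 1) + 1) / Nat.gcd 2 (q - 1) := by
    rintro _ ⟨g, rfl⟩ hs
    obtain ⟨A, rfl⟩ := QuotientGroup.mk_surjective g
    exact orderOf_mk_dvd_of_orderOf_eq_two_mul hp hF m.succ_pos hs1 ho1 hs
  have hbound2 : ∀ c ∈ elementOrders (PSp (m + 1) F), s2 ∣ c → c ∣ a.lcm b ∨ c ∣ p * a := by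
    rintro _ ⟨g, rfl⟩ hs
    obtain ⟨A, rfl⟩ := QuotientGroup.mk_surjective g
    obtain ⟨hN1, hN2⟩ := sub_one_dvd_lcm_and_add_one_dvd_lcm hmodd hab
    have haN := Nat.dvd_lcm_left a b
    rcases h with ⟨rfl, -, ho⟩ | ⟨rfl, -, ho⟩
    · exact orderOf_mk_dvd_of_orderOf_eq_odd hp hF hm hmodd hs2 ho haN hN1 hN2 hs
    · exact orderOf_mk_dvd_of_orderOf_eq_two_mul_sub_one hp hF hm hs2 ho haN hN1 hN2 hs
  have hbound3 {r c : ℕ} (hc : c ∈ elementOrders (PSp (m + 1) F)) (hs : s2 ∣ c) (hr : r ∣ c) :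
      r ∣ p * (a * b) := by
    refine hr.trans ?_
    rcases hbound2 c hc hs with h | h
    · exact h.trans ((Nat.lcm_dvd_mul a b).trans (dvd_mul_left _ _))
    · exact h.trans ⟨b, by ring⟩
  have hdisj {r : ℕ} (hr : r.Prime) := not_prime_dvd_mul_of_dvd_div hpq hq hmodd hab hr
  refine ⟨⟨fun hmem => ?_, ?_⟩, hbound1, hbound2⟩
  · exact hdisj hs2 ((dvd_mul_left _ _).trans (hbound1 _ hmem (dvd_mul_right _ _)))
      (hbound3 hmem (dvd_mul_left _ _) (dvd_mul_left _ _))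
  · rintro ⟨r, hr, h1, h2⟩
    exact hdisj hr ((dvd_mul_right _ _).trans (hbound1 _ h1 (dvd_mul_left _ _)))
      (hbound3 h2 (dvd_mul_left _ _) (dvd_mul_right _ _))

end ElementOrdersOfPSp

/-- For `L = PSp_{2n}(q)`, `q = p^k`, `n ≥ 6` even, `ε = ±1`, and primes
`s₁, s₂` with `ord_{s₁}(q) = 2n` and `e(s₂, εq) = n - 1` (i.e. `ord_{s₂}(q)` is
`n-1` if `ε = 1` and `2(n-1)` if `ε = -1`): the neighborhoods of `s₁` and `s₂`
in the prime graph of `L` are disjoint; `(qⁿ+1)/(2,q-1) ∈ ω(L)` and every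
element of `ω(L)` divisible by `s₁` divides it; and both
`(q^{n-1}-ε)(q+ε)/(2,q-1)` and `p(q^{n-1}-ε)` lie in `ω(L)` and every element of
`ω(L)` divisible by `s₂` divides one of them. -/
theorem psp_even_disjoint_neighborhoods
    (p k q : ℕ) (hp : p.Prime) (hk : 0 < k) (hq : q = p ^ k)
    (n : ℕ) (hn : 6 ≤ n) (hneven : Even n)
    (F : Type) [Field F] [Fintype F] (hF : Fintype.card F = q)
    (ε : ℤ) (hε : ε = 1 ∨ ε = -1)
    (s1 s2 : ℕ) (hs1 : s1.Prime) (hs2 : s2.Prime)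
    (ho1 : orderOf ((q : ZMod s1)) = 2 * n)
    (ho2 : orderOf ((q : ZMod s2)) = if ε = 1 then n - 1 else 2 * (n - 1)) :
    (s1 * s2 ∉ elementOrders (PSp n F) ∧
      ¬ ∃ r : ℕ, r.Prime ∧ r * s1 ∈ elementOrders (PSp n F) ∧
        r * s2 ∈ elementOrders (PSp n F)) ∧
    ((q ^ n + 1) / Nat.gcd 2 (q - 1) ∈ elementOrders (PSp n F) ∧
      ∀ a ∈ elementOrders (PSp n F), s1 ∣ a →
        a ∣ (q ^ n + 1) / Nat.gcd 2 (q - 1)) ∧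
    ((((q : ℤ) ^ (n - 1) - ε) * ((q : ℤ) + ε) / (Nat.gcd 2 (q - 1) : ℤ)).toNat ∈
        elementOrders (PSp n F) ∧
      ((p : ℤ) * ((q : ℤ) ^ (n - 1) - ε)).toNat ∈ elementOrders (PSp n F) ∧
      ∀ a ∈ elementOrders (PSp n F), s2 ∣ a →
        ((a : ℤ) ∣ ((q : ℤ) ^ (n - 1) - ε) * ((q : ℤ) + ε) / (Nat.gcd 2 (q - 1) : ℤ) ∨
          (a : ℤ) ∣ (p : ℤ) * ((q : ℤ) ^ (n - 1) - ε))) := by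
  have : Fact p.Prime := ⟨hp⟩
  have : CharP F p := charP_of_card_eq_prime_pow (hF.trans hq)
  have hq0 : 0 < q := hF ▸ Fintype.card_pos
  obtain ⟨m, rfl⟩ : ∃ m, n = m + 1 := ⟨n - 1, by omega⟩
  have hm : Odd m := by
    rcases Nat.even_or_odd m with h | h
    · exact absurd hneven (Nat.not_even_iff_odd.2 h.add_one)
    · exact h
  have hqm : 0 < q ^ m := Nat.pow_pos hq0
  rw [Nat.add_sub_cancel] at ho2 ⊢
  obtain ⟨a, b, ha, hb, hab⟩ : ∃ a b : ℕ, (a : ℤ) = q ^ m - ε ∧ (b : ℤ) = q + ε ∧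
      (a = q ^ m - 1 ∧ b = q + 1 ∧ orderOf (q : ZMod s2) = m ∨
        a = q ^ m + 1 ∧ b = q - 1 ∧ orderOf (q : ZMod s2) = 2 * m) := by
    rcases hε with rfl | rfl
    · exact ⟨q ^ m - 1, q + 1, by push_cast [hqm]; ring, by push_cast; ring,
        Or.inl ⟨rfl, rfl, by simpa using ho2⟩⟩
    · exact ⟨q ^ m + 1, q - 1, by push_cast; ring, by push_cast [hq0]; ring,
        Or.inr ⟨rfl, rfl, by simpa using ho2⟩⟩
  have hab' : a = q ^ m - 1 ∧ b = q + 1 ∨ a = q ^ m + 1 ∧ b = q - 1 :=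
    hab.imp (fun h => ⟨h.1, h.2.1⟩) fun h => ⟨h.1, h.2.1⟩
  obtain ⟨h1, h2, h3⟩ := disjoint_neighborhoods_of_odd hp hF (by omega) hm hs1 hs2 ho1 hab
  rw [int_mul_div_gcd_eq_lcm hq0 hm ha hb hab', ← ha, ← Nat.cast_mul, Int.toNat_natCast,
    Int.toNat_natCast]
  refine ⟨h1, ⟨div_mem_elementOrders hp hF m.succ_pos hs1 ho1, h2⟩,
    lcm_mem_elementOrders hp hF hm hab', mul_mem_elementOrders hp hF hm
      (hab'.imp And.left And.left), fun c hc hs => ?_⟩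
  exact (h3 c hc hs).imp Int.natCast_dvd_natCast.2 Int.natCast_dvd_natCast.2
end

section
/- Let u > 3 be a prime power, m ≥ 10 an even integer, and S = PSL_m(u). Suppose s1 and s2 are distinct primes dividing |S| such that s1·s2 ∉ ω(S) and there is no prime r dividing |S| with both r·s1 ∈ ω(S) and r·s2 ∈ ω(S). Then, possibly after swapping s1 and s2, the multiplicative order of u modulo s1 equals m−1; and if moreover (u−1) does not divide m, then the multiplicative order of u modulo s2 equals m. -/
open Matrix

section PrimeGraph

variable {F : Type} [Field F]

theorem mul_mem_elementOrders_PSL {m : ℕ} {x y : SpecialLinearGroup (Fin m) F} {r s : ℕ}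
    (h : Commute x y) (hr : r.Prime) (hs : s.Prime) (hrs : r ≠ s)
    (hx : orderOf (x : PSL m F) = r) (hy : orderOf (y : PSL m F) = s) :
    r * s ∈ elementOrders (PSL m F) := by
  have hc : Commute (x : PSL m F) (y : PSL m F) :=
    h.map (QuotientGroup.mk' (Subgroup.center (SpecialLinearGroup (Fin m) F)))
  refine ⟨(x : PSL m F) * (y : PSL m F), ?_⟩
  rw [hc.orderOf_mul_eq_mul_orderOf_of_coprime, hx, hy]
  rw [hx, hy]
  exact (Nat.coprime_primes hr hs).2 hrs

theorem mk_pow_eq_one {m k : ℕ} {x : SpecialLinearGroup (Fin m) F} (hx : x ^ k = 1) :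
    (x : PSL m F) ^ k = 1 := by
  rw [← QuotientGroup.mk_pow, hx, QuotientGroup.mk_one]

theorem orderOf_mk_eq_prime {m r : ℕ} {x : SpecialLinearGroup (Fin m) F} (hr : r.Prime)
    (hx : x ^ r = 1) (hc : x ∉ Subgroup.center (SpecialLinearGroup (Fin m) F)) :
    orderOf (x : PSL m F) = r := by
  have := Fact.mk hr
  exact orderOf_eq_prime (mk_pow_eq_one hx) fun h => hc ((QuotientGroup.eq_one_iff x).1 h)

/-- A noncentral element of `SL_m(F)` killed by `k > 0` has a power whose image in
`PSL_m(F)` has prime order dividing `k`. -/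
theorem exists_orderOf_mk_pow_prime {m k : ℕ} {y : SpecialLinearGroup (Fin m) F} (hk : 0 < k)
    (hy : y ^ k = 1) (hc : y ∉ Subgroup.center (SpecialLinearGroup (Fin m) F)) :
    ∃ r j : ℕ, r.Prime ∧ r ∣ k ∧
      orderOf ((y ^ j : SpecialLinearGroup (Fin m) F) : PSL m F) = r := by
  have hdvd : orderOf (y : PSL m F) ∣ k := orderOf_dvd_of_pow_eq_one (mk_pow_eq_one hy)
  have hne : orderOf (y : PSL m F) ≠ 1 := fun h =>
    hc ((QuotientGroup.eq_one_iff y).1 (orderOf_eq_one_iff.1 h))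
  have hmf := Nat.minFac_dvd (orderOf (y : PSL m F))
  refine ⟨(orderOf (y : PSL m F)).minFac,
    orderOf (y : PSL m F) / (orderOf (y : PSL m F)).minFac, Nat.minFac_prime hne,
    hmf.trans hdvd, ?_⟩
  rw [QuotientGroup.mk_pow]
  exact orderOf_pow_orderOf_div (Nat.pos_of_dvd_of_pos hdvd hk).ne' hmf

variable {ι κ τ : Type} [Fintype ι] [Fintype κ] [Fintype τ]
  [DecidableEq ι] [DecidableEq κ] [DecidableEq τ]

/-- Block diagonal matrices, with the index set relabelled along `e`. -/
def blockDiagHom (e : ι ⊕ κ ≃ τ) : Matrix ι ι F × Matrix κ κ F →* Matrix τ τ F where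
  toFun A := (fromBlocks A.1 0 0 A.2).submatrix e.symm e.symm
  map_one' := by simp
  map_mul' A B := by
    rw [submatrix_mul_equiv, fromBlocks_multiply]
    simp

theorem det_blockDiag (e : ι ⊕ κ ≃ τ) (A : Matrix ι ι F × Matrix κ κ F) :
    (blockDiagHom e A).det = A.1.det * A.2.det := by
  simp [blockDiagHom, det_submatrix_equiv_self, det_fromBlocks_zero₂₁]

/-- The block diagonal matrix of determinant one with the given blocks. -/
def blockSL (e : ι ⊕ κ ≃ τ) (A : Matrix ι ι F × Matrix κ κ F) (h : A.1.det * A.2.det = 1) :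
    SpecialLinearGroup τ F :=
  ⟨blockDiagHom e A, by rw [det_blockDiag, h]⟩

theorem blockSL_commute (e : ι ⊕ κ ≃ τ) {A B : Matrix ι ι F × Matrix κ κ F}
    (hA : A.1.det * A.2.det = 1) (hB : B.1.det * B.2.det = 1) (h : Commute A B) :
    Commute (blockSL e A hA) (blockSL e B hB) :=
  Subtype.ext (h.map (blockDiagHom e))

theorem blockSL_pow_eq_one (e : ι ⊕ κ ≃ τ) {A : Matrix ι ι F × Matrix κ κ F}
    (hA : A.1.det * A.2.det = 1) {k : ℕ} (h : A ^ k = 1) : blockSL e A hA ^ k = 1 := by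
  apply Subtype.ext
  change blockDiagHom e A ^ k = 1
  rw [← map_pow, h, map_one]

theorem eq_scalar_of_blockSL_mem_center (e : ι ⊕ κ ≃ τ) {A : Matrix ι ι F × Matrix κ κ F}
    (hA : A.1.det * A.2.det = 1)
    (hc : blockSL e A hA ∈ Subgroup.center (SpecialLinearGroup τ F)) :
    ∃ c : F, c ^ Fintype.card τ = 1 ∧ A.1 = scalar ι c ∧ A.2 = scalar κ c := by
  obtain ⟨c, hc1, hc2⟩ := Matrix.SpecialLinearGroup.mem_center_iff.1 hc
  have h : ∀ i j, scalar τ c (e i) (e j) = fromBlocks A.1 0 0 A.2 i j := fun i j => by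
    rw [hc2]; simp [blockSL, blockDiagHom]
  refine ⟨c, hc1, ?_, ?_⟩
  · ext i j
    have := h (.inl i) (.inl j)
    simp [diagonal_apply] at this
    simp [diagonal_apply, this]
  · ext i j
    have := h (.inr i) (.inr j)
    simp [diagonal_apply] at this
    simp [diagonal_apply, this]

theorem blockSL_left_notMem_center [Nonempty κ] (e : ι ⊕ κ ≃ τ) {x : SpecialLinearGroup ι F}
    (hx : x ≠ 1) : blockSL e (x.1, 1) (by simp) ∉ Subgroup.center (SpecialLinearGroup τ F) := by
  intro hc
  obtain ⟨c, -, h1, h2⟩ := eq_scalar_of_blockSL_mem_center e _ hc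
  obtain ⟨k⟩ := ‹Nonempty κ›
  have hc1 : c = 1 := by simpa using (congrFun (congrFun h2 k) k).symm
  exact hx (Subtype.ext (by simpa [hc1] using h1))

theorem blockSL_right_notMem_center [Nonempty ι] (e : ι ⊕ κ ≃ τ) {y : SpecialLinearGroup κ F}
    (hy : y ≠ 1) : blockSL e (1, y.1) (by simp) ∉ Subgroup.center (SpecialLinearGroup τ F) := by
  intro hc
  obtain ⟨c, -, h1, h2⟩ := eq_scalar_of_blockSL_mem_center e _ hc
  obtain ⟨k⟩ := ‹Nonempty ι›
  have hc1 : c = 1 := by simpa using (congrFun (congrFun h1 k) k).symm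
  exact hy (Subtype.ext (by simpa [hc1] using h2))

variable [Fintype F]

theorem mul_mem_elementOrders_of_dvd_card {m a b r s : ℕ} (hab : a + b = m) (ha : 0 < a)
    (hb : 0 < b) (hr : r.Prime) (hs : s.Prime) (hrs : r ≠ s)
    (hra : r ∣ Nat.card (SpecialLinearGroup (Fin a) F))
    (hsb : s ∣ Nat.card (SpecialLinearGroup (Fin b) F)) :
    r * s ∈ elementOrders (PSL m F) := by
  have := Fact.mk hr
  have := Fact.mk hs
  have : Nonempty (Fin a) := ⟨⟨0, ha⟩⟩
  have : Nonempty (Fin b) := ⟨⟨0, hb⟩⟩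
  obtain ⟨x, hx⟩ := exists_prime_orderOf_dvd_card' r hra
  obtain ⟨y, hy⟩ := exists_prime_orderOf_dvd_card' s hsb
  have hx' := pow_orderOf_eq_one x
  have hy' := pow_orderOf_eq_one y
  rw [hx] at hx'
  rw [hy] at hy'
  let e : Fin a ⊕ Fin b ≃ Fin m := finSumFinEquiv.trans (finCongr hab)
  refine mul_mem_elementOrders_PSL (x := blockSL e (x.1, 1) (by simp))
    (y := blockSL e (1, y.1) (by simp))
    (blockSL_commute e _ _ (Prod.ext (by simp) (by simp))) hr hs hrs
    (orderOf_mk_eq_prime hr (blockSL_pow_eq_one e _ (Prod.ext ?_ (by simp)))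
      (blockSL_left_notMem_center e ?_))
    (orderOf_mk_eq_prime hs (blockSL_pow_eq_one e _ (Prod.ext (by simp) ?_))
      (blockSL_right_notMem_center e ?_))
  · exact congrArg Subtype.val hx'
  · rintro rfl
    exact hr.one_lt.ne (by simpa using hx)
  · exact congrArg Subtype.val hy'
  · rintro rfl
    exact hs.one_lt.ne (by simpa using hy)

/-- Commuting elements of `SL_n(F)` in a norm-one torus of the degree `n` extension of `F`. -/
theorem exists_commute_of_dvd_geom {n N d₁ d₂ : ℕ} (hn : 0 < n)
    (hN : Fintype.card F ^ n - 1 = (Fintype.card F - 1) * N) (hd₁ : d₁ ∣ N) (hd₂ : d₂ ∣ N) :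
    ∃ x₁ x₂ : SpecialLinearGroup (Fin n) F, Commute x₁ x₂ ∧ x₁ ^ d₁ = 1 ∧ x₂ ^ d₂ = 1 ∧
      (x₁ ∈ Subgroup.center (SpecialLinearGroup (Fin n) F) → d₁ ∣ Fintype.card F - 1) ∧
      (x₂ ∈ Subgroup.center (SpecialLinearGroup (Fin n) F) → d₂ ∣ Fintype.card F - 1) := by
  obtain ⟨p, hp⟩ := CharP.exists F
  have : Fact p.Prime := ⟨CharP.char_is_prime F p⟩
  have : NeZero n := ⟨hn.ne'⟩
  let L := FiniteField.Extension F p n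
  have hfr : Module.finrank F L = n := FiniteField.finrank_extension F p n
  have hcard : Nat.card L = Fintype.card F ^ n := by
    rw [← Nat.card_eq_fintype_card]; exact FiniteField.natCard_extension F p n
  have hcu : Nat.card Lˣ = (Fintype.card F - 1) * N := by
    rw [Nat.card_units, hcard, hN]
  have hF1 : 0 < Fintype.card F - 1 := Nat.sub_pos_of_lt Fintype.one_lt_card
  let b := Module.finBasisOfFinrankEq F L hfr
  have hcyc : ∀ d, d ∣ N → ∃ z : Lˣ, orderOf z = d := fun d hd => by
    obtain ⟨g, hg⟩ := IsCyclic.exists_ofOrder_eq_natCard (α := Lˣ)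
    have hdo : d ∣ orderOf g := by rw [hg, hcu]; exact hd.mul_left _
    exact ⟨g ^ (orderOf g / d), orderOf_pow_orderOf_div (orderOf_pos g).ne' hdo⟩
  have hnorm : ∀ z : Lˣ, orderOf z ∣ N → Algebra.norm F (z : L) = 1 := fun z hz => by
    apply (algebraMap F L).injective
    rw [FiniteField.algebraMap_norm_eq_pow, hcard, Nat.card_eq_fintype_card, hN,
      Nat.mul_div_cancel_left _ hF1, map_one, ← Units.val_pow_eq_pow_val,
      orderOf_dvd_iff_pow_eq_one.1 hz, Units.val_one]
  let A : ∀ z : Lˣ, orderOf z ∣ N → SpecialLinearGroup (Fin n) F := fun z hz =>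
    ⟨Algebra.leftMulMatrix b (z : L), by rw [← Algebra.norm_eq_matrix_det, hnorm z hz]⟩
  have hpow : ∀ z hz, A z hz ^ orderOf z = 1 := fun z hz => by
    apply Subtype.ext
    change Algebra.leftMulMatrix b (z : L) ^ orderOf z = 1
    rw [← map_pow, ← Units.val_pow_eq_pow_val, pow_orderOf_eq_one, Units.val_one, map_one]
  have hcen : ∀ z hz, A z hz ∈ Subgroup.center (SpecialLinearGroup (Fin n) F) →
      orderOf z ∣ Fintype.card F - 1 := fun z hz hc => by
    obtain ⟨c, -, hc⟩ := Matrix.SpecialLinearGroup.mem_center_iff.1 hc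
    have hzc : (z : L) = algebraMap F L c := by
      apply Algebra.leftMulMatrix_injective b
      rw [AlgHom.commutes]
      exact hc.symm
    have hc0 : c ≠ 0 := by
      rintro rfl
      exact z.ne_zero (by rw [hzc, map_zero])
    apply orderOf_dvd_of_pow_eq_one
    apply Units.ext
    rw [Units.val_pow_eq_pow_val, hzc, ← map_pow, FiniteField.pow_card_sub_one_eq_one c hc0,
      map_one, Units.val_one]
  obtain ⟨z₁, rfl⟩ := hcyc d₁ hd₁
  obtain ⟨z₂, rfl⟩ := hcyc d₂ hd₂
  exact ⟨A z₁ hd₁, A z₂ hd₂,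
    Subtype.ext ((Commute.all (z₁ : L) z₂).map (Algebra.leftMulMatrix b)),
    hpow _ hd₁, hpow _ hd₂, hcen _ hd₁, hcen _ hd₂⟩

theorem card_GL_eq_mul_card_SL {n : ℕ} (hn : 0 < n) :
    Nat.card (GL (Fin n) F) =
      (Fintype.card F - 1) * Nat.card (SpecialLinearGroup (Fin n) F) := by
  have : Nonempty (Fin n) := ⟨⟨0, hn⟩⟩
  let f : GL (Fin n) F →* Fˣ := GeneralLinearGroup.det
  have hker : f.ker = (SpecialLinearGroup.toGL (n := Fin n) (R := F)).range := by
    ext g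
    constructor
    · intro hg
      exact ⟨⟨g.1, congrArg Units.val (MonoidHom.mem_ker.1 hg)⟩, Units.ext rfl⟩
    · rintro ⟨x, rfl⟩
      exact MonoidHom.mem_ker.2 (Units.ext x.2)
  have h1 : Nat.card f.ker = Nat.card (SpecialLinearGroup (Fin n) F) := by
    rw [hker]
    exact (Nat.card_congr
      (MonoidHom.ofInjective SpecialLinearGroup.toGL_injective).toEquiv).symm
  have h2 : f.ker.index = Fintype.card F - 1 := by
    rw [Subgroup.index_ker, MonoidHom.range_eq_top.2 GeneralLinearGroup.det_surjective,
      Subgroup.card_top, Nat.card_units, Nat.card_eq_fintype_card]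
  rw [← h1, ← h2, Subgroup.index_mul_card]

theorem card_SL_mul {n : ℕ} (hn : 0 < n) :
    (Fintype.card F - 1) * Nat.card (SpecialLinearGroup (Fin n) F) =
      ∏ i ∈ Finset.range n, (Fintype.card F ^ n - Fintype.card F ^ i) := by
  rw [← card_GL_eq_mul_card_SL hn, card_GL_field,
    Fin.prod_univ_eq_prod_range fun i => Fintype.card F ^ n - Fintype.card F ^ i]

theorem pow_sub_pow_eq_mul (u : ℕ) {n i : ℕ} (hi : i ≤ n) :
    u ^ n - u ^ i = u ^ i * (u ^ (n - i) - 1) := by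
  rw [Nat.mul_sub, ← pow_add, Nat.add_sub_cancel' hi, mul_one]

theorem dvd_card_SL_of_dvd {n i d : ℕ} (hi : i + 1 < n)
    (hd : d ∣ Fintype.card F ^ n - Fintype.card F ^ i) :
    d ∣ Nat.card (SpecialLinearGroup (Fin n) F) := by
  have hF1 : 0 < Fintype.card F - 1 := Nat.sub_pos_of_lt Fintype.one_lt_card
  obtain ⟨k, rfl⟩ : ∃ k, n = k + 1 := ⟨n - 1, by omega⟩
  refine Nat.dvd_of_mul_dvd_mul_left hF1 ?_
  rw [card_SL_mul (by omega), Finset.prod_range_succ, mul_comm]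
  refine mul_dvd_mul (hd.trans (Finset.dvd_prod_of_mem
    (fun i => Fintype.card F ^ (k + 1) - Fintype.card F ^ i) (Finset.mem_range.2 (by omega)))) ?_
  rw [pow_sub_pow_eq_mul _ (Nat.le_succ k)]
  simp

theorem card_dvd_card_SL {n : ℕ} (hn : 2 ≤ n) :
    Fintype.card F ∣ Nat.card (SpecialLinearGroup (Fin n) F) := by
  have hF1 : 0 < Fintype.card F - 1 := Nat.sub_pos_of_lt Fintype.one_lt_card
  refine Nat.dvd_of_mul_dvd_mul_left hF1 ?_
  rw [card_SL_mul (by omega), mul_comm]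
  refine dvd_trans ?_ (Finset.dvd_prod_of_mem _ (Finset.mem_range.2 (Nat.sub_lt (by omega)
    (Nat.one_pos))))
  rw [pow_sub_pow_eq_mul _ (Nat.sub_le n 1), Nat.sub_sub_self (by omega), pow_one]
  exact mul_dvd_mul_right (dvd_pow_self _ (by omega)) _

theorem pow_sub_one_dvd_card_SL {n j : ℕ} (hj : 0 < j) (hjn : j ≤ n) (hn : 2 ≤ n) :
    Fintype.card F ^ j - 1 ∣ Nat.card (SpecialLinearGroup (Fin n) F) := by
  have key : ∀ j, 2 ≤ j → j ≤ n →
      Fintype.card F ^ j - 1 ∣ Nat.card (SpecialLinearGroup (Fin n) F) := fun j h2 hjn => by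
    refine dvd_card_SL_of_dvd (i := n - j) (by omega) ?_
    rw [pow_sub_pow_eq_mul _ (Nat.sub_le n j), Nat.sub_sub_self hjn]
    exact dvd_mul_left _ _
  obtain rfl | h2 := Nat.eq_or_lt_of_le hj
  · exact (Nat.pow_sub_one_dvd_pow_sub_one _ ⟨2, rfl⟩).trans (key 2 le_rfl hn)
  · exact key j h2 hjn

theorem dvd_or_of_prime_dvd_card_SL {n s : ℕ} (hn : 0 < n) (hs : s.Prime)
    (hd : s ∣ Nat.card (SpecialLinearGroup (Fin n) F)) :
    s ∣ Fintype.card F ∨ ∃ j, 0 < j ∧ j ≤ n ∧ s ∣ Fintype.card F ^ j - 1 := by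
  have h := hd.mul_left (Fintype.card F - 1)
  rw [card_SL_mul hn, hs.prime.dvd_finsetProd_iff] at h
  obtain ⟨i, hi, h⟩ := h
  rw [Finset.mem_range] at hi
  rw [pow_sub_pow_eq_mul _ hi.le, hs.dvd_mul] at h
  exact h.imp hs.dvd_of_dvd_pow fun h => ⟨n - i, by omega, by omega, h⟩

theorem dvd_pow_sub_one_iff_orderOf_dvd {u s k : ℕ} (hu : 0 < u) :
    s ∣ u ^ k - 1 ↔ orderOf (u : ZMod s) ∣ k := by
  rw [orderOf_dvd_iff_pow_eq_one, ← CharP.cast_eq_zero_iff (ZMod s) s,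
    Nat.cast_sub (Nat.one_le_pow _ _ hu), sub_eq_zero]
  simp

/-- A prime divisor of `|PSL_m(u)|` either divides `|SL_{m-2}(u)|` or is a primitive prime
divisor of `u ^ (m - 1) - 1` or `u ^ m - 1`. -/
theorem dvd_card_SL_or_orderOf {m s : ℕ} (hm : 4 ≤ m) (hs : s.Prime)
    (hd : s ∣ Nat.card (PSL m F)) :
    s ∣ Nat.card (SpecialLinearGroup (Fin (m - 2)) F) ∨
      orderOf (Fintype.card F : ZMod s) = m - 1 ∨ orderOf (Fintype.card F : ZMod s) = m := by
  by_cases hsm : s ∣ Nat.card (SpecialLinearGroup (Fin (m - 2)) F)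
  · exact .inl hsm
  right
  have hu0 : 0 < Fintype.card F := Fintype.card_pos
  obtain h | ⟨j, hj0, hjm, h⟩ := dvd_or_of_prime_dvd_card_SL (by omega) hs
    (hd.trans (Subgroup.card_quotient_dvd_card _))
  · exact absurd (h.trans (card_dvd_card_SL (by omega))) hsm
  rw [dvd_pow_sub_one_iff_orderOf_dvd hu0] at h
  have hpos : 0 < orderOf (Fintype.card F : ZMod s) := Nat.pos_of_dvd_of_pos h hj0
  have hle := Nat.le_of_dvd hj0 h
  have hgt : m - 2 < orderOf (Fintype.card F : ZMod s) := by
    by_contra! hcon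
    exact hsm (((dvd_pow_sub_one_iff_orderOf_dvd hu0).2 dvd_rfl).trans
      (pow_sub_one_dvd_card_SL hpos hcon (by omega)))
  omega

theorem not_dvd_card_sub_one_of_orderOf {s n : ℕ} (hn : 2 ≤ n)
    (h : orderOf (Fintype.card F : ZMod s) = n) : ¬ s ∣ Fintype.card F - 1 := by
  intro hd
  rw [← pow_one (Fintype.card F), dvd_pow_sub_one_iff_orderOf_dvd Fintype.card_pos, h] at hd
  have := Nat.le_of_dvd Nat.one_pos hd
  omega

theorem exists_geom_factor (F : Type) [Field F] [Fintype F] {n : ℕ} (hn : 2 ≤ n) :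
    ∃ N, Fintype.card F ^ n - 1 = (Fintype.card F - 1) * N ∧
      ∀ t : ℕ, t.Prime → orderOf (Fintype.card F : ZMod t) = n → t ∣ N := by
  obtain ⟨N, hN⟩ := Nat.sub_one_dvd_pow_sub_one (Fintype.card F) n
  refine ⟨N, hN, fun t ht hto => ?_⟩
  have hd : t ∣ Fintype.card F ^ n - 1 :=
    (dvd_pow_sub_one_iff_orderOf_dvd Fintype.card_pos).2 hto.dvd
  rw [hN, ht.dvd_mul] at hd
  exact hd.resolve_left (not_dvd_card_sub_one_of_orderOf hn hto)

/-- Two primitive prime divisors of `u ^ n - 1` are realised by commuting noncentral elements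
of `SL_n(u)`. -/
theorem exists_commute_of_orderOf {s₁ s₂ n : ℕ} (hs₁ : s₁.Prime) (hs₂ : s₂.Prime) (hn : 2 ≤ n)
    (h₁ : orderOf (Fintype.card F : ZMod s₁) = n) (h₂ : orderOf (Fintype.card F : ZMod s₂) = n) :
    ∃ x₁ x₂ : SpecialLinearGroup (Fin n) F, Commute x₁ x₂ ∧ x₁ ^ s₁ = 1 ∧ x₂ ^ s₂ = 1 ∧
      x₁ ∉ Subgroup.center (SpecialLinearGroup (Fin n) F) ∧
      x₂ ∉ Subgroup.center (SpecialLinearGroup (Fin n) F) := by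
  obtain ⟨N, hN, hdvd⟩ := exists_geom_factor F hn
  obtain ⟨x₁, x₂, hc, hp₁, hp₂, hz₁, hz₂⟩ :=
    exists_commute_of_dvd_geom (by omega) hN (hdvd s₁ hs₁ h₁) (hdvd s₂ hs₂ h₂)
  exact ⟨x₁, x₂, hc, hp₁, hp₂, mt hz₁ (not_dvd_card_sub_one_of_orderOf hn h₁),
    mt hz₂ (not_dvd_card_sub_one_of_orderOf hn h₂)⟩

theorem mul_mem_of_orderOf_eq {s₁ s₂ m : ℕ} (hs₁ : s₁.Prime) (hs₂ : s₂.Prime) (hne : s₁ ≠ s₂)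
    (hm : 2 ≤ m) (h₁ : orderOf (Fintype.card F : ZMod s₁) = m)
    (h₂ : orderOf (Fintype.card F : ZMod s₂) = m) :
    s₁ * s₂ ∈ elementOrders (PSL m F) := by
  obtain ⟨x₁, x₂, hc, hp₁, hp₂, hz₁, hz₂⟩ := exists_commute_of_orderOf hs₁ hs₂ hm h₁ h₂
  exact mul_mem_elementOrders_PSL hc hs₁ hs₂ hne (orderOf_mk_eq_prime hs₁ hp₁ hz₁)
    (orderOf_mk_eq_prime hs₂ hp₂ hz₂)

theorem mul_mem_of_orderOf_eq_sub_one {s₁ s₂ m : ℕ} (hs₁ : s₁.Prime) (hs₂ : s₂.Prime)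
    (hne : s₁ ≠ s₂) (hm : 3 ≤ m) (h₁ : orderOf (Fintype.card F : ZMod s₁) = m - 1)
    (h₂ : orderOf (Fintype.card F : ZMod s₂) = m - 1) :
    s₁ * s₂ ∈ elementOrders (PSL m F) := by
  obtain ⟨x₁, x₂, hc, hp₁, hp₂, hz₁, hz₂⟩ :=
    exists_commute_of_orderOf hs₁ hs₂ (by omega) h₁ h₂
  let e : Fin (m - 1) ⊕ Fin 1 ≃ Fin m := finSumFinEquiv.trans (finCongr (by omega))
  have key : ∀ {x : SpecialLinearGroup (Fin (m - 1)) F} {s : ℕ}, s.Prime → x ^ s = 1 →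
      x ∉ Subgroup.center (SpecialLinearGroup (Fin (m - 1)) F) →
      orderOf ((blockSL e (x.1, 1) (by simp) : SpecialLinearGroup (Fin m) F) : PSL m F) = s := by
    intro x s hs hx hz
    refine orderOf_mk_eq_prime hs
      (blockSL_pow_eq_one e _ (Prod.ext (congrArg Subtype.val hx) (by simp)))
      (blockSL_left_notMem_center e ?_)
    rintro rfl
    exact hz (one_mem _)
  exact mul_mem_elementOrders_PSL
    (blockSL_commute e _ _ (Prod.ext (congrArg Subtype.val hc) (by simp)))
    hs₁ hs₂ hne (key hs₁ hp₁ hz₁) (key hs₂ hp₂ hz₂)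

theorem exists_prime_mul_mem_of_orderOf_eq_sub_one {s m : ℕ} (hs : s.Prime) (hm : 3 ≤ m)
    (h : orderOf (Fintype.card F : ZMod s) = m - 1) (hdvd : ¬ Fintype.card F - 1 ∣ m) :
    ∃ r : ℕ, r.Prime ∧ r ∣ Fintype.card F - 1 ∧ r * s ∈ elementOrders (PSL m F) := by
  have hF1 : 0 < Fintype.card F - 1 := Nat.sub_pos_of_lt Fintype.one_lt_card
  obtain ⟨x, -, -, hp, -, hz, -⟩ := exists_commute_of_orderOf hs hs (by omega) h h
  obtain ⟨c, hc⟩ := IsCyclic.exists_ofOrder_eq_natCard (α := Fˣ)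
  rw [Nat.card_units, Nat.card_eq_fintype_card] at hc
  let e : Fin (m - 1) ⊕ Fin 1 ≃ Fin m := finSumFinEquiv.trans (finCongr (by omega))
  let A : Matrix (Fin (m - 1)) (Fin (m - 1)) F × Matrix (Fin 1) (Fin 1) F :=
    (scalar _ (c : F), scalar _ ((c⁻¹ ^ (m - 1) : Fˣ) : F))
  have hA : A.1.det * A.2.det = 1 := by simp [A]
  have hc1 : c ^ (Fintype.card F - 1) = 1 := by rw [← hc, pow_orderOf_eq_one]
  have hA1 : A ^ (Fintype.card F - 1) = 1 := by
    refine Prod.ext ?_ ?_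
    · change (scalar (Fin (m - 1)) (c : F)) ^ _ = 1
      rw [← map_pow, ← Units.val_pow_eq_pow_val, hc1, Units.val_one, map_one]
    · change (scalar (Fin 1) ((c⁻¹ ^ (m - 1) : Fˣ) : F)) ^ _ = 1
      rw [← map_pow, ← Units.val_pow_eq_pow_val, pow_right_comm, inv_pow, hc1, inv_one, one_pow,
        Units.val_one, map_one]
  have hcen : blockSL e A hA ∉ Subgroup.center (SpecialLinearGroup (Fin m) F) := by
    intro hcon
    obtain ⟨d, hd, hd1, -⟩ := eq_scalar_of_blockSL_mem_center e hA hcon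
    have hdc : (c : F) = d := by
      have : Nonempty (Fin (m - 1)) := ⟨⟨0, by omega⟩⟩
      exact scalar_inj.1 hd1
    apply hdvd
    rw [← hc]
    apply orderOf_dvd_of_pow_eq_one
    apply Units.ext
    rw [Units.val_pow_eq_pow_val, hdc, Units.val_one]
    simpa using hd
  obtain ⟨r, j, hr, hrd, hro⟩ :=
    exists_orderOf_mk_pow_prime hF1 (blockSL_pow_eq_one e hA hA1) hcen
  refine ⟨r, hr, hrd, mul_mem_elementOrders_PSL (y := blockSL e (x.1, 1) (by simp))
    (Commute.pow_left (blockSL_commute e hA _ (Prod.ext ?_ (by simp))) j) hr hs ?_ hro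
    (orderOf_mk_eq_prime hs
      (blockSL_pow_eq_one e _ (Prod.ext (congrArg Subtype.val hp) (by simp)))
      (blockSL_left_notMem_center e ?_))⟩
  · exact scalar_commute _ (Commute.all _) _
  · rintro rfl
    exact not_dvd_card_sub_one_of_orderOf (by omega) h hrd
  · rintro rfl
    exact hz (one_mem _)

theorem exists_prime_mul_mem_of_orderOf_eq {s m : ℕ} (hu : 3 < Fintype.card F) (hs : s.Prime)
    (hm : 3 ≤ m) (heven : Even m) (h : orderOf (Fintype.card F : ZMod s) = m) :
    ∃ r : ℕ, r.Prime ∧ r ∣ Fintype.card F ^ 2 - 1 ∧ r * s ∈ elementOrders (PSL m F) := by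
  have hF1 : 0 < Fintype.card F - 1 := Nat.sub_pos_of_lt Fintype.one_lt_card
  have hsq : Fintype.card F ^ 2 - 1 = (Fintype.card F - 1) * (Fintype.card F + 1) := by
    rw [mul_comm, ← Nat.sq_sub_sq, one_pow]
  obtain ⟨N, hN, hdvd⟩ := exists_geom_factor F (n := m) (by omega)
  have hN2 : Fintype.card F + 1 ∣ N := by
    refine Nat.dvd_of_mul_dvd_mul_left hF1 ?_
    rw [← hN, ← hsq]
    exact Nat.pow_sub_one_dvd_pow_sub_one _ heven.two_dvd
  obtain ⟨y, x, hc, hpy, hpx, hzy, hzx⟩ :=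
    exists_commute_of_dvd_geom (by omega) hN hN2 (hdvd s hs h)
  have hy : y ∉ Subgroup.center (SpecialLinearGroup (Fin m) F) := fun hcon => by
    have := Nat.le_of_dvd hF1 (hzy hcon)
    omega
  obtain ⟨r, j, hr, hrd, hro⟩ := exists_orderOf_mk_pow_prime (Nat.succ_pos _) hpy hy
  have hr2 : r ∣ Fintype.card F ^ 2 - 1 := by
    rw [hsq]
    exact hrd.mul_left _
  refine ⟨r, hr, hr2, mul_mem_elementOrders_PSL (hc.pow_left j) hr hs ?_ hro
    (orderOf_mk_eq_prime hs hpx (mt hzx (not_dvd_card_sub_one_of_orderOf (by omega) h)))⟩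
  rintro rfl
  rw [dvd_pow_sub_one_iff_orderOf_dvd Fintype.card_pos, h] at hr2
  have := Nat.le_of_dvd (by omega) hr2
  omega

/-- A prime divisor of `|SL_2(u)|` adjacent to `s₁` is equal or adjacent to any prime divisor
`s₂` of `|SL_{m-2}(u)|`, so that `s₁` and `s₂` do not have disjoint neighborhoods. -/
theorem false_of_common_neighbor {m r s₁ s₂ : ℕ} (hm : 4 ≤ m) (hs₂ : s₂.Prime)
    (hnadj : s₁ * s₂ ∉ elementOrders (PSL m F))
    (hdisj : ¬ ∃ r : ℕ, r.Prime ∧ r ∣ Nat.card (PSL m F) ∧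
      r * s₁ ∈ elementOrders (PSL m F) ∧ r * s₂ ∈ elementOrders (PSL m F))
    (hr : r.Prime) (hr2 : r ∣ Nat.card (SpecialLinearGroup (Fin 2) F))
    (hrs : r * s₁ ∈ elementOrders (PSL m F))
    (hd : s₂ ∣ Nat.card (SpecialLinearGroup (Fin (m - 2)) F)) : False := by
  obtain rfl | hne := eq_or_ne r s₂
  · exact hnadj (mul_comm s₁ r ▸ hrs)
  · refine hdisj ⟨r, hr, ?_, hrs, mul_mem_elementOrders_of_dvd_card (by omega) two_pos
      (by omega) hr hs₂ hne hr2 hd⟩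
    obtain ⟨g, hg⟩ := hrs
    exact (hg ▸ dvd_mul_right r s₁).trans (orderOf_dvd_natCard g)

theorem orderOf_eq_of_orderOf_eq_sub_one {m s₁ s₂ : ℕ} (hm : 4 ≤ m) (hs₁ : s₁.Prime)
    (hs₂ : s₂.Prime) (hne : s₁ ≠ s₂) (hd₂ : s₂ ∣ Nat.card (PSL m F))
    (hnadj : s₁ * s₂ ∉ elementOrders (PSL m F))
    (hdisj : ¬ ∃ r : ℕ, r.Prime ∧ r ∣ Nat.card (PSL m F) ∧
      r * s₁ ∈ elementOrders (PSL m F) ∧ r * s₂ ∈ elementOrders (PSL m F))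
    (h : orderOf (Fintype.card F : ZMod s₁) = m - 1) (hdvd : ¬ Fintype.card F - 1 ∣ m) :
    orderOf (Fintype.card F : ZMod s₂) = m := by
  obtain hd | h₂ | h₂ := dvd_card_SL_or_orderOf hm hs₂ hd₂
  · obtain ⟨r, hr, hrd, hrs⟩ :=
      exists_prime_mul_mem_of_orderOf_eq_sub_one hs₁ (by omega) h hdvd
    refine (false_of_common_neighbor hm hs₂ hnadj hdisj hr (hrd.trans ?_) hrs hd).elim
    simpa using pow_sub_one_dvd_card_SL (F := F) one_pos one_le_two le_rfl
  · exact absurd (mul_mem_of_orderOf_eq_sub_one hs₁ hs₂ hne (by omega) h h₂) hnadj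
  · exact h₂

theorem orderOf_eq_sub_one_of_orderOf_eq {m s₁ s₂ : ℕ} (hu : 3 < Fintype.card F) (hm : 4 ≤ m)
    (heven : Even m) (hs₁ : s₁.Prime)
    (hs₂ : s₂.Prime) (hne : s₁ ≠ s₂) (hd₂ : s₂ ∣ Nat.card (PSL m F))
    (hnadj : s₁ * s₂ ∉ elementOrders (PSL m F))
    (hdisj : ¬ ∃ r : ℕ, r.Prime ∧ r ∣ Nat.card (PSL m F) ∧
      r * s₁ ∈ elementOrders (PSL m F) ∧ r * s₂ ∈ elementOrders (PSL m F))
    (h : orderOf (Fintype.card F : ZMod s₁) = m) :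
    orderOf (Fintype.card F : ZMod s₂) = m - 1 := by
  obtain hd | h₂ | h₂ := dvd_card_SL_or_orderOf hm hs₂ hd₂
  · obtain ⟨r, hr, hrd, hrs⟩ := exists_prime_mul_mem_of_orderOf_eq hu hs₁ (by omega) heven h
    exact (false_of_common_neighbor hm hs₂ hnadj hdisj hr
      (hrd.trans (pow_sub_one_dvd_card_SL two_pos le_rfl le_rfl)) hrs hd).elim
  · exact h₂
  · exact absurd (mul_mem_of_orderOf_eq hs₁ hs₂ hne (by omega) h h₂) hnadj

theorem not_dvd_card_SL_of_dvd_card_SL {m s₁ s₂ : ℕ} (hm : 4 ≤ m) (hs₁ : s₁.Prime)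
    (hs₂ : s₂.Prime) (hne : s₁ ≠ s₂) (hnadj : s₁ * s₂ ∉ elementOrders (PSL m F))
    (hdisj : ¬ ∃ r : ℕ, r.Prime ∧ r ∣ Nat.card (PSL m F) ∧
      r * s₁ ∈ elementOrders (PSL m F) ∧ r * s₂ ∈ elementOrders (PSL m F))
    (hd₁ : s₁ ∣ Nat.card (SpecialLinearGroup (Fin (m - 2)) F)) :
    ¬ s₂ ∣ Nat.card (SpecialLinearGroup (Fin (m - 2)) F) := by
  intro hd₂
  have hp : (Fintype.card F).minFac.Prime := Nat.minFac_prime Fintype.one_lt_card.ne'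
  have hp2 : (Fintype.card F).minFac ∣ Nat.card (SpecialLinearGroup (Fin 2) F) :=
    (Nat.minFac_dvd _).trans (card_dvd_card_SL le_rfl)
  obtain heq | hps := eq_or_ne (Fintype.card F).minFac s₁
  · exact hnadj (mul_mem_elementOrders_of_dvd_card (by omega) two_pos (by omega) hs₁ hs₂ hne
      (heq ▸ hp2) hd₂)
  · exact false_of_common_neighbor hm hs₂ hnadj hdisj hp hp2
      (mul_mem_elementOrders_of_dvd_card (by omega) two_pos (by omega) hp hs₁ hps hp2 hd₁) hd₂

end PrimeGraph

/-- If `S = PSL_m(u)` with `u > 3` and `m ≥ 10` even, and `s₁ ≠ s₂` are primes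
dividing `|S|` with disjoint neighborhoods in the prime graph of `S`, then (up
to swapping) `ord_{s₁}(u) = m - 1`, and if moreover `u - 1` does not divide `m`
then `ord_{s₂}(u) = m`. -/
theorem psl_even_unique_disjoint
    (u : ℕ) (hu : IsPrimePow u) (hu3 : 3 < u)
    (m : ℕ) (hm : 10 ≤ m) (hmeven : Even m)
    (F : Type) [Field F] [Fintype F] (hF : Fintype.card F = u)
    (s1 s2 : ℕ) (hs1 : s1.Prime) (hs2 : s2.Prime) (hne : s1 ≠ s2)
    (hd1 : s1 ∣ Nat.card (PSL m F)) (hd2 : s2 ∣ Nat.card (PSL m F))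
    (hnadj : s1 * s2 ∉ elementOrders (PSL m F))
    (hdisj : ¬ ∃ r : ℕ, r.Prime ∧ r ∣ Nat.card (PSL m F) ∧
      r * s1 ∈ elementOrders (PSL m F) ∧ r * s2 ∈ elementOrders (PSL m F)) :
    (orderOf ((u : ZMod s1)) = m - 1 ∧
      (¬ (u - 1) ∣ m → orderOf ((u : ZMod s2)) = m)) ∨
    (orderOf ((u : ZMod s2)) = m - 1 ∧
      (¬ (u - 1) ∣ m → orderOf ((u : ZMod s1)) = m)) := by
  subst hF
  have hnadj' : s2 * s1 ∉ elementOrders (PSL m F) := by rwa [mul_comm]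
  have hdisj' : ¬ ∃ r : ℕ, r.Prime ∧ r ∣ Nat.card (PSL m F) ∧
      r * s2 ∈ elementOrders (PSL m F) ∧ r * s1 ∈ elementOrders (PSL m F) := by
    rintro ⟨r, hr, hrd, h1, h2⟩
    exact hdisj ⟨r, hr, hrd, h2, h1⟩
  have hm4 : 4 ≤ m := by omega
  obtain h1 | h1 | h1 := dvd_card_SL_or_orderOf hm4 hs1 hd1
  · obtain h2 | h2 | h2 := dvd_card_SL_or_orderOf hm4 hs2 hd2
    · exact absurd h2 (not_dvd_card_SL_of_dvd_card_SL hm4 hs1 hs2 hne hnadj hdisj h1)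
    · exact .inr ⟨h2, orderOf_eq_of_orderOf_eq_sub_one hm4 hs2 hs1 hne.symm hd1 hnadj' hdisj' h2⟩
    · exact .inl ⟨orderOf_eq_sub_one_of_orderOf_eq hu3 hm4 hmeven hs2 hs1 hne.symm hd1 hnadj'
        hdisj' h2, fun _ => h2⟩
  · exact .inl ⟨h1, orderOf_eq_of_orderOf_eq_sub_one hm4 hs1 hs2 hne hd2 hnadj hdisj h1⟩
  · exact .inr ⟨orderOf_eq_sub_one_of_orderOf_eq hu3 hm4 hmeven hs1 hs2 hne hd2 hnadj
      hdisj h1, fun _ => h1⟩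
end

section
/- Let u > 3 be a prime power, m ≥ 9 an odd integer, and S = PSL_m(u). Suppose s1 and s2 are distinct primes dividing |S| such that s1·s2 ∉ ω(S) and there is no prime r dividing |S| with both r·s1 ∈ ω(S) and r·s2 ∈ ω(S). Then, possibly after swapping s1 and s2, the multiplicative order of u modulo s1 equals m; and if moreover 3 divides m, then the multiplicative order of u modulo s2 equals m−1 or m−2. -/
namespace PSLPrimeGraph

open Matrix

section Blocks

variable {ι κ n R : Type*} [Fintype ι] [DecidableEq ι] [Fintype κ] [DecidableEq κ]
  [Fintype n] [DecidableEq n] [CommRing R]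

/-- The block diagonal embedding `SL_ι × SL_κ → SL_n`, where `n ≃ ι ⊕ κ`. -/
def blockSL (e : ι ⊕ κ ≃ n) :
    SpecialLinearGroup ι R × SpecialLinearGroup κ R →* SpecialLinearGroup n R where
  toFun x := ⟨(fromBlocks x.1.1 0 0 x.2.1).submatrix e.symm e.symm, by
    rw [det_submatrix_equiv_self, det_fromBlocks_zero₂₁, x.1.2, x.2.2, one_mul]⟩
  map_one' := Subtype.ext <| by simp
  map_mul' x y := Subtype.ext <| by
    change _ = (fromBlocks x.1.1 0 0 x.2.1).submatrix e.symm e.symm *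
      (fromBlocks y.1.1 0 0 y.2.1).submatrix e.symm e.symm
    rw [submatrix_mul_equiv, fromBlocks_multiply]
    simp

lemma eq_scalar_of_blockSL_mem_center {e : ι ⊕ κ ≃ n}
    {x : SpecialLinearGroup ι R × SpecialLinearGroup κ R}
    (h : blockSL e x ∈ Subgroup.center (SpecialLinearGroup n R)) :
    ∃ r : R, x.1.1 = scalar ι r ∧ x.2.1 = scalar κ r := by
  obtain ⟨r, -, hr⟩ := Matrix.SpecialLinearGroup.mem_center_iff.1 h
  replace hr : scalar n r = (fromBlocks x.1.1 0 0 x.2.1).submatrix e.symm e.symm := hr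
  refine ⟨r, ?_, ?_⟩
  · ext i j
    have := congrFun₂ hr (e (.inl i)) (e (.inl j))
    simpa [diagonal_apply, eq_comm] using this
  · ext i j
    have := congrFun₂ hr (e (.inr i)) (e (.inr j))
    simpa [diagonal_apply, eq_comm] using this

lemma eq_one_of_scalar_eq_one [Nonempty ι] {r : R} (h : 1 = scalar ι r) : r = 1 := by
  obtain ⟨i⟩ := ‹Nonempty ι›
  simpa using (congrFun₂ h i i).symm

end Blocks

section Embeddings

variable {F : Type*} [Field F] {m a b : ℕ}

/-- The homomorphism `SL_a × SL_b → PSL_m` given by block diagonal matrices. -/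
def blockPSL (e : Fin a ⊕ Fin b ≃ Fin m) :
    SpecialLinearGroup (Fin a) F × SpecialLinearGroup (Fin b) F →* PSL m F :=
  (QuotientGroup.mk' _).comp (blockSL e)

lemma blockPSL_inl_injective [NeZero b] (e : Fin a ⊕ Fin b ≃ Fin m) :
    Function.Injective ((blockPSL (F := F) e).comp (MonoidHom.inl _ _)) := by
  refine (injective_iff_map_eq_one _).2 fun A hA => ?_
  obtain ⟨r, h1, h2⟩ := eq_scalar_of_blockSL_mem_center ((QuotientGroup.eq_one_iff _).1 hA)
  obtain rfl := eq_one_of_scalar_eq_one h2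
  exact Subtype.ext (by simpa using h1)

lemma blockPSL_inr_injective [NeZero a] (e : Fin a ⊕ Fin b ≃ Fin m) :
    Function.Injective ((blockPSL (F := F) e).comp (MonoidHom.inr _ _)) := by
  refine (injective_iff_map_eq_one _).2 fun A hA => ?_
  obtain ⟨r, h1, h2⟩ := eq_scalar_of_blockSL_mem_center ((QuotientGroup.eq_one_iff _).1 hA)
  obtain rfl := eq_one_of_scalar_eq_one h1
  exact Subtype.ext (by simpa using h2)

lemma orderOf_mem_elementOrders_PSL [NeZero b] (h : a + b = m)
    (A : SpecialLinearGroup (Fin a) F) : orderOf A ∈ elementOrders (PSL m F) :=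
  ⟨_, orderOf_injective _ (blockPSL_inl_injective (finSumFinEquiv.trans (finCongr h))) A⟩

lemma mul_orderOf_mem_elementOrders_PSL [NeZero a] [NeZero b] (h : a + b = m)
    (A : SpecialLinearGroup (Fin a) F) (B : SpecialLinearGroup (Fin b) F)
    (hAB : (orderOf A).Coprime (orderOf B)) :
    orderOf A * orderOf B ∈ elementOrders (PSL m F) := by
  let e : Fin a ⊕ Fin b ≃ Fin m := finSumFinEquiv.trans (finCongr h)
  have hA := orderOf_injective _ (blockPSL_inl_injective (F := F) e) A
  have hB := orderOf_injective _ (blockPSL_inr_injective (F := F) e) B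
  rw [← hA, ← hB] at hAB
  refine ⟨_, Eq.trans (Commute.orderOf_mul_eq_mul_orderOf_of_coprime ?_ hAB) (by rw [hA, hB])⟩
  exact (MonoidHom.commute_inl_inr A B).map (blockPSL e)

lemma orderOf_mem_elementOrders_PSL_of_coprime [Fintype F] (A : SpecialLinearGroup (Fin m) F)
    (hA : (orderOf A).Coprime (Fintype.card F - 1)) (hm : m ≠ 0) :
    orderOf A ∈ elementOrders (PSL m F) := by
  refine ⟨QuotientGroup.mk' _ A, Nat.dvd_antisymm (orderOf_map_dvd _ A) ?_⟩
  have hk := pow_orderOf_eq_one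
    (QuotientGroup.mk' (Subgroup.center (SpecialLinearGroup (Fin m) F)) A)
  rw [← map_pow] at hk
  obtain ⟨r, hr, hs⟩ :=
    Matrix.SpecialLinearGroup.mem_center_iff.1 ((QuotientGroup.eq_one_iff (A ^ _)).1 hk)
  have hr0 : r ≠ 0 := by
    rintro rfl
    simp [hm] at hr
  refine hA.dvd_of_dvd_mul_right (orderOf_dvd_of_pow_eq_one ?_)
  rw [pow_mul]
  refine Subtype.ext ?_
  rw [Matrix.SpecialLinearGroup.coe_pow, ← hs, ← map_pow, FiniteField.pow_card_sub_one_eq_one r hr0,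
    map_one]
  rfl

end Embeddings

section Elements

lemma exists_SL_orderOf_eq {n R : Type*} [Fintype n] [DecidableEq n] [CommRing R]
    {A : Matrix n n R} (hA : A.det = 1) :
    ∃ B : Matrix.SpecialLinearGroup n R, orderOf B = orderOf A :=
  ⟨⟨A, hA⟩, (orderOf_injective
    ({ toFun := Subtype.val, map_one' := rfl, map_mul' := fun _ _ => rfl } :
      Matrix.SpecialLinearGroup n R →* Matrix n n R) Subtype.val_injective ⟨A, hA⟩).symm⟩

variable {F : Type*} [Field F] [Fintype F]

lemma exists_SL_orderOf_eq_of_dvd {n N : ℕ} (hn : n ≠ 0) (hN : N ∣ Fintype.card F ^ n - 1)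
    (hco : N.Coprime (Fintype.card F - 1)) :
    ∃ A : SpecialLinearGroup (Fin n) F, orderOf A = N := by
  obtain ⟨p, hp⟩ := CharP.exists F
  have : Fact p.Prime := ⟨CharP.char_is_prime F p⟩
  have : NeZero n := ⟨hn⟩
  let K := FiniteField.Extension F p n
  have hKF : Module.finrank F K = n := FiniteField.finrank_extension F p n
  have : Finite K := Module.finite_of_finite F
  have := Fintype.ofFinite K
  have hcard : Nat.card Kˣ = Fintype.card F ^ n - 1 := by
    rw [Nat.card_units, FiniteField.natCard_extension, Nat.card_eq_fintype_card]
  obtain ⟨x, hx⟩ := IsCyclic.exists_ofOrder_eq_natCard (α := Kˣ)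
  rw [hcard] at hx
  obtain ⟨c, hc⟩ := hN
  have hpos : Fintype.card F ^ n - 1 ≠ 0 := by
    have := Nat.one_lt_pow hn (Fintype.one_lt_card (α := F))
    omega
  have hc0 : c ≠ 0 := by rintro rfl; simp_all
  have hy : orderOf ((x ^ c : Kˣ) : K) = N := by
    rw [orderOf_units, orderOf_pow_of_dvd hc0 (by rw [hx, hc]; exact dvd_mul_left _ _), hx, hc,
      Nat.mul_div_cancel _ (Nat.pos_of_ne_zero hc0)]
  let b := Module.finBasisOfFinrankEq F K hKF
  let A := Algebra.leftMulMatrix b ((x ^ c : Kˣ) : K)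
  have hA : orderOf A = N := by
    rw [← hy]
    refine orderOf_eq_orderOf_iff.2 fun k => ?_
    rw [← map_pow, map_eq_one_iff _ (Algebra.leftMulMatrix_injective b)]
  have hAN : A ^ N = 1 := by rw [← hA, pow_orderOf_eq_one]
  have hdet : A.det = 1 := by
    have h1 : A.det ^ N = 1 := by rw [← det_pow, hAN, det_one]
    have h0 : A.det ≠ 0 := by
      intro h
      rw [h, zero_pow] at h1
      · exact zero_ne_one h1
      · rintro rfl
        simp_all
    have h2 := FiniteField.pow_card_sub_one_eq_one _ h0
    have := Nat.dvd_gcd (orderOf_dvd_of_pow_eq_one h1) (orderOf_dvd_of_pow_eq_one h2)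
    rw [hco] at this
    exact orderOf_eq_one_iff.1 (Nat.dvd_one.1 this)
  exact hA ▸ exists_SL_orderOf_eq hdet


lemma dvd_pow_sub_one_iff_orderOf_dvd {q s k : ℕ} (hq : 0 < q) :
    s ∣ q ^ k - 1 ↔ orderOf (q : ZMod s) ∣ k := by
  rw [orderOf_dvd_iff_pow_eq_one, ← ZMod.natCast_eq_zero_iff,
    Nat.cast_sub (Nat.one_le_pow _ _ hq), sub_eq_zero]
  simp

lemma dvd_of_orderOf_eq_zero {q s : ℕ} (hs : s.Prime) (h : orderOf (q : ZMod s) = 0) : s ∣ q := by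
  have : Fact s.Prime := ⟨hs⟩
  by_contra hsq
  rw [← ZMod.natCast_eq_zero_iff] at hsq
  exact (isOfFinOrder_iff_pow_eq_one.2
    ⟨s - 1, Nat.sub_pos_of_lt hs.one_lt, ZMod.pow_card_sub_one_eq_one hsq⟩).orderOf_pos.ne' h

lemma orderOf_eq_zero_of_dvd {q s : ℕ} (hs : s.Prime) (h : s ∣ q) : orderOf (q : ZMod s) = 0 := by
  have : Fact s.Prime := ⟨hs⟩
  rw [(ZMod.natCast_eq_zero_iff q s).2 h, orderOf_zero]

lemma card_GL_succ_succ (n : ℕ) : Nat.card (GL (Fin (n + 2)) F) =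
    Fintype.card F ^ (n + 1) *
      (∏ i ∈ Finset.range (n + 1), (Fintype.card F ^ (n + 2) - Fintype.card F ^ i)) *
      (Fintype.card F - 1) := by
  rw [card_GL_field, Fin.prod_univ_eq_prod_range
    (fun i => Fintype.card F ^ (n + 2) - Fintype.card F ^ i), Finset.prod_range_succ,
    pow_succ _ (n + 1)]
  conv_lhs => rw [← Nat.mul_sub_one]
  ring

lemma exists_SL_orderOf_eq_prime {n s : ℕ} (hn : 2 ≤ n) (hs : s.Prime)
    (he : orderOf (Fintype.card F : ZMod s) ≤ n) :
    ∃ A : SpecialLinearGroup (Fin n) F, orderOf A = s := by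
  have : Fact s.Prime := ⟨hs⟩
  have hq : 1 < Fintype.card F := Fintype.one_lt_card
  let d : GL (Fin n) F →* Fˣ := GeneralLinearGroup.det
  obtain ⟨c, hc⟩ : Nat.card d.range ∣ Fintype.card F - 1 := by
    rw [← Nat.card_eq_fintype_card, ← Nat.card_units]
    exact Subgroup.card_subgroup_dvd_card _
  have hker : Nat.card d.ker * Nat.card d.range = Nat.card (GL (Fin n) F) := by
    rw [← Subgroup.index_ker, Subgroup.card_mul_index]
  have hs' : s ∣ Nat.card d.ker := by
    obtain ⟨n, rfl⟩ := Nat.exists_eq_add_of_le' hn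
    have hr : 0 < Nat.card d.range := Nat.card_pos
    rw [card_GL_succ_succ, hc, mul_comm (Nat.card d.range) c, ← mul_assoc] at hker
    rw [Nat.eq_of_mul_eq_mul_right hr hker]
    refine dvd_mul_of_dvd_left ?_ _
    rcases Nat.eq_zero_or_pos (orderOf (Fintype.card F : ZMod s)) with h0 | h0
    · exact dvd_mul_of_dvd_left ((dvd_of_orderOf_eq_zero hs h0).trans (dvd_pow_self _ (by omega))) _
    · refine dvd_mul_of_dvd_right ?_ _
      have key (e : ℕ) (h2 : 2 ≤ e) (hen : e ≤ n + 2)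
          (hd : orderOf (Fintype.card F : ZMod s) ∣ e) :
          s ∣ ∏ i ∈ Finset.range (n + 1), (Fintype.card F ^ (n + 2) - Fintype.card F ^ i) := by
        refine Dvd.dvd.trans ?_
          (Finset.dvd_prod_of_mem _ (Finset.mem_range.2 (show n + 2 - e < n + 1 by omega)))
        obtain ⟨i, hi⟩ := Nat.exists_eq_add_of_le' hen
        rw [hi, Nat.add_sub_cancel, pow_add, ← Nat.mul_sub_one]
        exact dvd_mul_of_dvd_right ((dvd_pow_sub_one_iff_orderOf_dvd (by omega)).2 hd) _
      by_cases h1 : orderOf (Fintype.card F : ZMod s) = 1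
      · exact key 2 le_rfl (by omega) (by rw [h1]; exact one_dvd _)
      · exact key _ (by omega) he dvd_rfl
  obtain ⟨g, hg⟩ := exists_prime_orderOf_dvd_card' s hs'
  have hdet : (g : GL (Fin n) F).1.det = 1 := congrArg Units.val (MonoidHom.mem_ker.1 g.2)
  rw [← hg, ← Subgroup.orderOf_coe, ← orderOf_units]
  exact exists_SL_orderOf_eq hdet

lemma orderOf_le_of_dvd_card_PSL {m s : ℕ} (hs : s.Prime) (h : s ∣ Nat.card (PSL m F)) :
    orderOf (Fintype.card F : ZMod s) ≤ m := by
  have hq : 0 < Fintype.card F := Fintype.card_pos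
  have h1 : s ∣ Nat.card (GL (Fin m) F) :=
    (h.trans (Subgroup.card_quotient_dvd_card _)).trans
      (Subgroup.card_dvd_of_injective SpecialLinearGroup.toGL fun A B hAB =>
        Subtype.ext (congrArg Units.val hAB))
  rw [card_GL_field, (Nat.prime_iff.1 hs).dvd_finsetProd_iff] at h1
  obtain ⟨i, -, hi⟩ := h1
  obtain ⟨k, hk⟩ := Nat.exists_eq_add_of_lt i.2
  have : Fintype.card F ^ m = Fintype.card F ^ (i : ℕ) * Fintype.card F ^ (k + 1) := by
    rw [← pow_add, ← add_assoc, ← hk]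
  rw [this, ← Nat.mul_sub_one, hs.dvd_mul] at hi
  rcases hi with hi | hi
  · rw [orderOf_eq_zero_of_dvd hs (hs.dvd_of_dvd_pow hi)]
    exact Nat.zero_le _
  · exact (Nat.le_of_dvd k.succ_pos ((dvd_pow_sub_one_iff_orderOf_dvd hq).1 hi)).trans (by omega)

end Elements

section Adjacency

variable {F : Type*} [Field F] [Fintype F] {m r s : ℕ}

lemma coprime_card_sub_one (hs : s.Prime) (he : orderOf (Fintype.card F : ZMod s) ≠ 1) :
    s.Coprime (Fintype.card F - 1) := by
  refine (Nat.Prime.coprime_iff_not_dvd hs).2 fun h => he ?_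
  rw [← pow_one (Fintype.card F), dvd_pow_sub_one_iff_orderOf_dvd Fintype.card_pos] at h
  exact Nat.dvd_one.1 h

lemma mul_mem_of_orderOf_le {a b : ℕ} (ha : 2 ≤ a) (hb : 2 ≤ b) (hab : a + b = m)
    (hr : r.Prime) (hs : s.Prime) (hrs : r ≠ s)
    (her : orderOf (Fintype.card F : ZMod r) ≤ a) (hes : orderOf (Fintype.card F : ZMod s) ≤ b) :
    r * s ∈ elementOrders (PSL m F) := by
  have : NeZero a := ⟨by omega⟩
  have : NeZero b := ⟨by omega⟩
  obtain ⟨A, rfl⟩ := exists_SL_orderOf_eq_prime ha hr her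
  obtain ⟨B, rfl⟩ := exists_SL_orderOf_eq_prime hb hs hes
  exact mul_orderOf_mem_elementOrders_PSL hab A B ((Nat.coprime_primes hr hs).2 hrs)

lemma exists_SL_orderOf_eq_mul {n : ℕ} (hn : n ≠ 0) (hr : r.Prime) (hs : s.Prime) (hrs : r ≠ s)
    (hrn : orderOf (Fintype.card F : ZMod r) ∣ n) (hsn : orderOf (Fintype.card F : ZMod s) ∣ n)
    (hr1 : orderOf (Fintype.card F : ZMod r) ≠ 1) (hs1 : orderOf (Fintype.card F : ZMod s) ≠ 1) :
    ∃ A : SpecialLinearGroup (Fin n) F, orderOf A = r * s :=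
  exists_SL_orderOf_eq_of_dvd hn
    (((Nat.coprime_primes hr hs).2 hrs).mul_dvd_of_dvd_of_dvd
      ((dvd_pow_sub_one_iff_orderOf_dvd Fintype.card_pos).2 hrn)
      ((dvd_pow_sub_one_iff_orderOf_dvd Fintype.card_pos).2 hsn))
    ((coprime_card_sub_one hr hr1).mul_left (coprime_card_sub_one hs hs1))

lemma mul_mem_of_orderOf_dvd (hm : m ≠ 0) (hr : r.Prime) (hs : s.Prime) (hrs : r ≠ s)
    (hrn : orderOf (Fintype.card F : ZMod r) ∣ m) (hsn : orderOf (Fintype.card F : ZMod s) ∣ m)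
    (hr1 : orderOf (Fintype.card F : ZMod r) ≠ 1) (hs1 : orderOf (Fintype.card F : ZMod s) ≠ 1) :
    r * s ∈ elementOrders (PSL m F) := by
  obtain ⟨A, hA⟩ := exists_SL_orderOf_eq_mul hm hr hs hrs hrn hsn hr1 hs1
  rw [← hA]
  refine orderOf_mem_elementOrders_PSL_of_coprime A ?_ hm
  rw [hA]
  exact (coprime_card_sub_one hr hr1).mul_left (coprime_card_sub_one hs hs1)

lemma mul_mem_of_orderOf_dvd_sub_one {n : ℕ} (hn : n ≠ 0) (hnm : n + 1 = m)
    (hr : r.Prime) (hs : s.Prime) (hrs : r ≠ s)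
    (hrn : orderOf (Fintype.card F : ZMod r) ∣ n) (hsn : orderOf (Fintype.card F : ZMod s) ∣ n)
    (hr1 : orderOf (Fintype.card F : ZMod r) ≠ 1) (hs1 : orderOf (Fintype.card F : ZMod s) ≠ 1) :
    r * s ∈ elementOrders (PSL m F) := by
  obtain ⟨A, hA⟩ := exists_SL_orderOf_eq_mul hn hr hs hrs hrn hsn hr1 hs1
  rw [← hA]
  exact orderOf_mem_elementOrders_PSL hnm A

/-- If `q` has order `m - 1` modulo `s` with `m` odd, then `s` is adjacent in the prime graph to
some prime dividing `q + 1`. -/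
lemma exists_prime_orderOf_le_two_mul_mem {n : ℕ} (hn : 2 < n) (hnm : n + 1 = m) (hev : Even n)
    (hs : s.Prime) (hes : orderOf (Fintype.card F : ZMod s) = n) :
    ∃ r, r.Prime ∧ orderOf (Fintype.card F : ZMod r) ≤ 2 ∧
      r * s ∈ elementOrders (PSL m F) := by
  have hq1 : 1 < Fintype.card F := Fintype.one_lt_card
  obtain ⟨r, hr, hrq⟩ := Nat.exists_prime_and_dvd (n := Fintype.card F + 1) (by omega)
  have hr2 : orderOf (Fintype.card F : ZMod r) ∣ 2 := by
    rw [← dvd_pow_sub_one_iff_orderOf_dvd (by omega)]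
    refine hrq.trans ⟨Fintype.card F - 1, ?_⟩
    simpa using Nat.sq_sub_sq (Fintype.card F) 1
  have hrle := Nat.le_of_dvd two_pos hr2
  have hrs : r ≠ s := by rintro rfl; omega
  refine ⟨r, hr, hrle, ?_⟩
  by_cases hr1 : orderOf (Fintype.card F : ZMod r) = 1
  · have hr' : r = 2 := by
      have h1 : r ∣ Fintype.card F ^ 1 - 1 :=
        (dvd_pow_sub_one_iff_orderOf_dvd (by omega)).2 (by rw [hr1])
      have h2 : r ∣ Fintype.card F + 1 - (Fintype.card F ^ 1 - 1) := Nat.dvd_sub hrq h1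
      rw [pow_one, show Fintype.card F + 1 - (Fintype.card F - 1) = 2 by omega] at h2
      exact (Nat.prime_dvd_prime_iff_eq hr Nat.prime_two).1 h2
    subst hr'
    obtain ⟨A, hA⟩ := exists_SL_orderOf_eq_of_dvd (F := F) (n := n) (N := s) (by omega)
      ((dvd_pow_sub_one_iff_orderOf_dvd (by omega)).2 (by rw [hes]))
      (coprime_card_sub_one hs (by omega))
    have : Fact (Even (Fintype.card (Fin n))) := ⟨by simpa using hev⟩
    have hF : (2 : F) ≠ 0 := by
      intro h
      have h1 : ringChar F ∣ 2 := ringChar.dvd (by exact_mod_cast h)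
      have h2 : ringChar F = 2 :=
        ((Nat.dvd_prime Nat.prime_two).1 h1).resolve_left CharP.ringChar_ne_one
      have h3 := FiniteField.even_card_of_char_two h2
      omega
    have hneg : orderOf (-1 : SpecialLinearGroup (Fin n) F) = 2 := by
      refine orderOf_eq_prime (by simp) fun h => hF ?_
      have := congrArg (fun B : SpecialLinearGroup (Fin n) F => B.1 ⟨0, by omega⟩ ⟨0, by omega⟩) h
      change -(1 : Matrix (Fin n) (Fin n) F) _ _ = (1 : Matrix (Fin n) (Fin n) F) _ _ at this
      rw [one_apply_eq] at this
      linear_combination -this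
    have hco : (orderOf (-1 : SpecialLinearGroup (Fin n) F)).Coprime (orderOf A) := by
      rw [hneg, hA]
      exact (Nat.coprime_primes Nat.prime_two hs).2 hrs
    have hAB := (Commute.neg_one_left A).orderOf_mul_eq_mul_orderOf_of_coprime hco
    rw [hneg, hA] at hAB
    rw [← hAB]
    exact orderOf_mem_elementOrders_PSL hnm _
  · exact mul_mem_of_orderOf_dvd_sub_one (by omega) hnm hr hs hrs
      (hr2.trans hev.two_dvd) (by rw [hes]) hr1 (by omega)

lemma exists_prime_orderOf_eq_three {q : ℕ} (hq : 1 < q) :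
    ∃ r, r.Prime ∧ orderOf (q : ZMod r) = 3 := by
  obtain ⟨r, hr, hrq, hr3⟩ : ∃ r, r.Prime ∧ r ∣ q ^ 2 + q + 1 ∧ r ≠ 3 := by
    by_contra! h
    have h3 := Nat.eq_prime_pow_of_unique_prime_dvd (p := 3) (Nat.succ_ne_zero (q ^ 2 + q))
      fun {d} => h d
    generalize (q ^ 2 + q).succ.primeFactorsList.length = k at h3
    match k with
    | 0 => simp_all
    | 1 => nlinarith
    | k + 2 =>
      have h9 : (q ^ 2 + q + 1) % 9 = 0 := by
        rw [← Nat.succ_eq_add_one, h3, pow_add]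
        exact Nat.mul_mod_left _ _
      have : q % 9 < 9 := Nat.mod_lt _ (by norm_num)
      rw [Nat.add_mod, Nat.add_mod (q ^ 2), Nat.pow_mod] at h9
      interval_cases q % 9 <;> simp at h9
  have : Fact r.Prime := ⟨hr⟩
  have hq0 : ((q : ZMod r) ^ 2 + q + 1) = 0 := by
    exact_mod_cast (ZMod.natCast_eq_zero_iff _ _).2 hrq
  refine ⟨r, hr, orderOf_eq_prime ?_ fun h1 => hr3 ?_⟩
  · linear_combination ((q : ZMod r) - 1) * hq0
  · rw [h1] at hq0
    have : ((3 : ℕ) : ZMod r) = 0 := by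
      push_cast
      linear_combination hq0
    exact (Nat.prime_dvd_prime_iff_eq hr Nat.prime_three).1 ((ZMod.natCast_eq_zero_iff _ _).1 this)

lemma exists_common_neighbor_of_orderOf_eq_sub_one {s t n : ℕ} (hn : 3 < n) (hnm : n + 1 = m)
    (hev : Even n) (hs : s.Prime) (ht : t.Prime) (hne : s ≠ t)
    (hes : orderOf (Fintype.card F : ZMod s) = n) (het : orderOf (Fintype.card F : ZMod t) ≤ n)
    (hnadj : s * t ∉ elementOrders (PSL m F)) :
    ∃ r, r.Prime ∧ r * s ∈ elementOrders (PSL m F) ∧ r * t ∈ elementOrders (PSL m F) := by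
  obtain ⟨r, hr, her, hrs⟩ := exists_prime_orderOf_le_two_mul_mem (by omega) hnm hev hs hes
  by_cases hrt : r = t
  · rw [hrt, mul_comm] at hrs
    exact absurd hrs hnadj
  by_cases het' : orderOf (Fintype.card F : ZMod t) = n
  · exact absurd (mul_mem_of_orderOf_dvd_sub_one (by omega) hnm hs ht hne hes.dvd het'.dvd
      (by omega) (by omega)) hnadj
  · exact ⟨r, hr, hrs, mul_mem_of_orderOf_le le_rfl (show 2 ≤ n - 1 by omega) (by omega) hr ht hrt
      her (by omega)⟩

lemma exists_common_neighbor_of_orderOf_le {s t : ℕ} (hm : 4 ≤ m) (hs : s.Prime) (ht : t.Prime)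
    (hne : s ≠ t) (hes : orderOf (Fintype.card F : ZMod s) ≤ m - 2)
    (het : orderOf (Fintype.card F : ZMod t) ≤ m - 2)
    (hnadj : s * t ∉ elementOrders (PSL m F)) :
    ∃ r, r.Prime ∧ r * s ∈ elementOrders (PSL m F) ∧ r * t ∈ elementOrders (PSL m F) := by
  obtain ⟨p, hp, hpq⟩ := Nat.exists_prime_and_dvd (Fintype.one_lt_card (α := F)).ne'
  have hep := orderOf_eq_zero_of_dvd hp hpq
  have adj {x : ℕ} (hx : x.Prime) (hpx : p ≠ x) (hex : orderOf (Fintype.card F : ZMod x) ≤ m - 2) :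
      p * x ∈ elementOrders (PSL m F) :=
    mul_mem_of_orderOf_le le_rfl (show 2 ≤ m - 2 by omega) (by omega) hp hx hpx (by omega) hex
  by_cases hps : p = s
  · exact absurd (hps ▸ adj ht (hps ▸ hne) het) hnadj
  by_cases hpt : p = t
  · exact absurd (mul_comm s t ▸ hpt ▸ adj hs hps hes) hnadj
  · exact ⟨p, hp, adj hs hps hes, adj ht hpt het⟩

lemma exists_common_neighbor_of_orderOf_eq {s t : ℕ} (hm : 5 ≤ m) (h3 : 3 ∣ m)
    (hs : s.Prime) (ht : t.Prime) (hes : orderOf (Fintype.card F : ZMod s) = m)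
    (het : orderOf (Fintype.card F : ZMod t) ≤ m - 3)
    (hnadj : s * t ∉ elementOrders (PSL m F)) :
    ∃ r, r.Prime ∧ r * s ∈ elementOrders (PSL m F) ∧ r * t ∈ elementOrders (PSL m F) := by
  obtain ⟨r, hr, her⟩ := exists_prime_orderOf_eq_three (Fintype.one_lt_card (α := F))
  have hrs : r * s ∈ elementOrders (PSL m F) :=
    mul_mem_of_orderOf_dvd (by omega) hr hs (by rintro rfl; omega) (her ▸ h3) hes.dvd
      (by omega) (by omega)
  by_cases hrt : r = t
  · rw [hrt, mul_comm] at hrs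
    exact absurd hrs hnadj
  · exact ⟨r, hr, hrs, mul_mem_of_orderOf_le (by omega) (show 2 ≤ m - 3 by omega) (by omega)
      hr ht hrt her.le het⟩

end Adjacency

end PSLPrimeGraph

/-- If `S = PSL_m(u)` with `u > 3` and `m ≥ 9` odd, and `s₁ ≠ s₂` are primes
dividing `|S|` with disjoint neighborhoods in the prime graph of `S`, then (up
to swapping) `ord_{s₁}(u) = m`, and if moreover `3 ∣ m` then
`ord_{s₂}(u) ∈ {m - 1, m - 2}`. -/
theorem psl_odd_unique_disjoint
    (u : ℕ) (hu : IsPrimePow u) (hu3 : 3 < u)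
    (m : ℕ) (hm : 9 ≤ m) (hmodd : Odd m)
    (F : Type) [Field F] [Fintype F] (hF : Fintype.card F = u)
    (s1 s2 : ℕ) (hs1 : s1.Prime) (hs2 : s2.Prime) (hne : s1 ≠ s2)
    (hd1 : s1 ∣ Nat.card (PSL m F)) (hd2 : s2 ∣ Nat.card (PSL m F))
    (hnadj : s1 * s2 ∉ elementOrders (PSL m F))
    (hdisj : ¬ ∃ r : ℕ, r.Prime ∧ r ∣ Nat.card (PSL m F) ∧
      r * s1 ∈ elementOrders (PSL m F) ∧ r * s2 ∈ elementOrders (PSL m F)) :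
    (orderOf ((u : ZMod s1)) = m ∧
      (3 ∣ m → orderOf ((u : ZMod s2)) = m - 1 ∨ orderOf ((u : ZMod s2)) = m - 2)) ∨
    (orderOf ((u : ZMod s2)) = m ∧
      (3 ∣ m → orderOf ((u : ZMod s1)) = m - 1 ∨ orderOf ((u : ZMod s1)) = m - 2)) := by
  subst hF
  have hdisj' : ¬ ∃ r, r.Prime ∧ r * s1 ∈ elementOrders (PSL m F) ∧
      r * s2 ∈ elementOrders (PSL m F) := by
    rintro ⟨r, hr, h1, h2⟩
    refine hdisj ⟨r, hr, ?_, h1, h2⟩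
    obtain ⟨g, hg⟩ := h1
    exact (Dvd.intro _ hg.symm).trans (orderOf_dvd_natCard g)
  have hdisj'' : ¬ ∃ r, r.Prime ∧ r * s2 ∈ elementOrders (PSL m F) ∧
      r * s1 ∈ elementOrders (PSL m F) :=
    fun ⟨r, hr, h2, h1⟩ => hdisj' ⟨r, hr, h1, h2⟩
  have hnadj' : s2 * s1 ∉ elementOrders (PSL m F) := mul_comm s1 s2 ▸ hnadj
  have he1 := PSLPrimeGraph.orderOf_le_of_dvd_card_PSL hs1 hd1
  have he2 := PSLPrimeGraph.orderOf_le_of_dvd_card_PSL hs2 hd2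
  have hev : Even (m - 1) := Nat.Odd.sub_odd hmodd odd_one
  have hboth : ¬ (orderOf (Fintype.card F : ZMod s1) = m ∧
      orderOf (Fintype.card F : ZMod s2) = m) := fun ⟨h1, h2⟩ =>
    hnadj (PSLPrimeGraph.mul_mem_of_orderOf_dvd (by omega) hs1 hs2 hne h1.dvd h2.dvd
      (by omega) (by omega))
  by_cases h1 : orderOf (Fintype.card F : ZMod s1) = m
  · refine .inl ⟨h1, fun h3 => ?_⟩
    by_contra hcon
    exact hdisj' (PSLPrimeGraph.exists_common_neighbor_of_orderOf_eq (by omega) h3 hs1 hs2 h1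
      (by omega) hnadj)
  by_cases h2 : orderOf (Fintype.card F : ZMod s2) = m
  · refine .inr ⟨h2, fun h3 => ?_⟩
    by_contra hcon
    exact hdisj'' (PSLPrimeGraph.exists_common_neighbor_of_orderOf_eq (by omega) h3 hs2 hs1 h2
      (by omega) hnadj')
  exfalso
  by_cases h1' : orderOf (Fintype.card F : ZMod s1) = m - 1
  · exact hdisj' (PSLPrimeGraph.exists_common_neighbor_of_orderOf_eq_sub_one (by omega) (by omega)
      hev hs1 hs2 hne h1' (by omega) hnadj)
  by_cases h2' : orderOf (Fintype.card F : ZMod s2) = m - 1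
  · exact hdisj'' (PSLPrimeGraph.exists_common_neighbor_of_orderOf_eq_sub_one (by omega) (by omega)
      hev hs2 hs1 hne.symm h2' (by omega) hnadj')
  exact hdisj' (PSLPrimeGraph.exists_common_neighbor_of_orderOf_le (by omega) hs1 hs2 hne
    (by omega) (by omega) hnadj)
end

section
/- Let u > 3 be a prime power, m ≥ 5 an odd integer, and S = PSp_{2m}(u). Suppose s1 and s2 are distinct primes dividing |S| such that s1·s2 ∉ ω(S) and there is no prime r dividing |S| with both r·s1 ∈ ω(S) and r·s2 ∈ ω(S). Then, possibly after swapping s1 and s2, the multiplicative order of u modulo s1 equals 2m and the multiplicative order of u modulo s2 equals m. -/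
section SymplecticPrimeGraph

open Matrix

namespace SymplecticGroup

section Embeddings

variable {ι κ F : Type*} [Fintype ι] [DecidableEq ι] [Fintype κ] [DecidableEq κ] [Field F]

theorem fromBlocks_diag_mem {P Q : Matrix ι ι F} (h : Pᵀ * Q = 1) :
    fromBlocks P 0 0 Q ∈ symplecticGroup ι F := by
  rw [fromBlocks_mem_iff]; simp [h]

theorem fromBlocks_upper_mem {S : Matrix ι ι F} (h : Sᵀ = S) :
    fromBlocks 1 S 0 1 ∈ symplecticGroup ι F := by
  rw [fromBlocks_mem_iff]; simp [h]

/-- Central elements of the symplectic group are scalar. -/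
theorem exists_eq_smul_one_of_mem_center {z : symplecticGroup ι F}
    (hz : z ∈ Subgroup.center (symplecticGroup ι F)) :
    ∃ c : F, (z : Matrix (ι ⊕ ι) (ι ⊕ ι) F) = c • 1 := by
  have hcomm : ∀ M ∈ symplecticGroup ι F, M * (z : Matrix _ _ F) = (z : Matrix _ _ F) * M :=
    fun M hM => congrArg Subtype.val (Subgroup.mem_center_iff.mp hz ⟨M, hM⟩)
  obtain ⟨A, B, C, D, hABCD⟩ : ∃ A B C D, (z : Matrix (ι ⊕ ι) (ι ⊕ ι) F) = fromBlocks A B C D :=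
    ⟨_, _, _, _, (fromBlocks_toBlocks _).symm⟩
  rw [hABCD] at hcomm ⊢
  have h1 := hcomm _ (fromBlocks_upper_mem (S := 1) transpose_one)
  have h2 := hcomm _ (J_mem ι F)
  simp only [J, fromBlocks_multiply, fromBlocks_inj, Matrix.one_mul, Matrix.mul_one,
    Matrix.zero_mul, Matrix.mul_zero, add_zero, zero_add, Matrix.neg_mul, Matrix.mul_neg,
    add_eq_left] at h1 h2
  obtain ⟨rfl, hAD, -⟩ := h1
  obtain ⟨hB, -, hD, -⟩ := h2
  have hB : B = 0 := by rw [← hB, neg_zero]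
  subst hB hD
  obtain ⟨c, hc⟩ := mem_range_scalar_of_commute_single (M := A) (by
    intro i j hij
    have := hcomm _ (fromBlocks_diag_mem (P := 1 + single i j 1) (Q := 1 - single j i 1) (by
      simp [transpose_add, add_mul, mul_sub, hij]))
    simp only [fromBlocks_multiply, fromBlocks_inj, Matrix.zero_mul, Matrix.mul_zero, add_zero,
      add_mul, mul_add, Matrix.one_mul, Matrix.mul_one, add_right_inj] at this
    exact this.1)
  refine ⟨c, ?_⟩
  rw [← hc, ← fromBlocks_one, fromBlocks_smul, smul_zero, scalar_apply, smul_one_eq_diagonal]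

theorem sq_eq_one_of_mem_center {z : symplecticGroup ι F}
    (hz : z ∈ Subgroup.center (symplecticGroup ι F)) : z ^ 2 = 1 := by
  obtain ⟨c, hc⟩ := exists_eq_smul_one_of_mem_center hz
  have h := mem_iff.mp z.2
  apply Subtype.ext
  rw [SubmonoidClass.coe_pow, pow_two, hc]
  rw [hc] at h
  have h' : c • c • J ι F = J ι F := by simpa [smul_smul] using h
  calc (c • 1 : Matrix (ι ⊕ ι) (ι ⊕ ι) F) * c • 1 = -((c • c • J ι F) * J ι F) := by
        simp [J_squared, smul_smul]
    _ = 1 := by rw [h', J_squared, neg_neg]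

/-- The orthogonal sum of two symplectic matrices. -/
def orthogonalSum : symplecticGroup ι F × symplecticGroup κ F →* symplecticGroup (ι ⊕ κ) F where
  toFun x := ⟨(fromBlocks x.1.1 0 0 x.2.1).submatrix (Equiv.sumSumSumComm ι κ ι κ)
    (Equiv.sumSumSumComm ι κ ι κ), by
      have hJ : J (ι ⊕ κ) F = (fromBlocks (J ι F) 0 0 (J κ F)).submatrix
          (Equiv.sumSumSumComm ι κ ι κ) (Equiv.sumSumSumComm ι κ ι κ) := by
        ext (i | i) (j | j) <;> rcases i with i | i <;> rcases j with j | j <;>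
          simp [J, Matrix.one_apply]
      rw [mem_iff, hJ, transpose_submatrix, submatrix_mul_equiv, submatrix_mul_equiv,
        fromBlocks_transpose, fromBlocks_multiply, fromBlocks_multiply]
      simp [mem_iff.mp x.1.2, mem_iff.mp x.2.2]⟩
  map_one' := by
    apply Subtype.ext
    simp
  map_mul' x y := by
    apply Subtype.ext
    simp [submatrix_mul_equiv, fromBlocks_multiply]

theorem coe_orthogonalSum (x : symplecticGroup ι F × symplecticGroup κ F) :
    (orthogonalSum x : Matrix ((ι ⊕ κ) ⊕ ι ⊕ κ) ((ι ⊕ κ) ⊕ ι ⊕ κ) F) =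
      (fromBlocks x.1.1 0 0 x.2.1).submatrix
      (Equiv.sumSumSumComm ι κ ι κ) (Equiv.sumSumSumComm ι κ ι κ) := rfl

theorem eq_smul_one_of_orthogonalSum {x : symplecticGroup ι F × symplecticGroup κ F} {c : F}
    (h : (orthogonalSum x : Matrix ((ι ⊕ κ) ⊕ ι ⊕ κ) ((ι ⊕ κ) ⊕ ι ⊕ κ) F) = c • 1) :
    (x.1 : Matrix (ι ⊕ ι) (ι ⊕ ι) F) = c • 1 ∧ (x.2 : Matrix (κ ⊕ κ) (κ ⊕ κ) F) = c • 1 := by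
  rw [coe_orthogonalSum] at h
  have h2 := congrArg (fun M => M.submatrix (Equiv.sumSumSumComm ι κ ι κ).symm
    (Equiv.sumSumSumComm ι κ ι κ).symm) h
  simp only [submatrix_submatrix, Equiv.self_comp_symm, submatrix_id_id, submatrix_smul,
    Pi.smul_apply, submatrix_one_equiv] at h2
  rw [← fromBlocks_one, fromBlocks_smul, fromBlocks_inj] at h2
  exact ⟨h2.1, h2.2.2.2⟩

theorem orthogonalSum_injective :
    Function.Injective (orthogonalSum : symplecticGroup ι F × symplecticGroup κ F →* _) := by
  rw [injective_iff_map_eq_one]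
  intro x hx
  obtain ⟨h1, h2⟩ := eq_smul_one_of_orthogonalSum (x := x) (c := 1) (by rw [hx]; simp)
  rw [one_smul] at h1 h2
  exact Prod.ext (Subtype.ext h1) (Subtype.ext h2)

/-- Reindexing symplectic matrices along an equivalence. -/
def reindexEquiv (e : ι ≃ κ) : symplecticGroup ι F ≃* symplecticGroup κ F where
  toFun x := ⟨(x : Matrix _ _ F).submatrix (e.symm.sumCongr e.symm) (e.symm.sumCongr e.symm), by
    have hJ : J κ F = (J ι F).submatrix (e.symm.sumCongr e.symm) (e.symm.sumCongr e.symm) := by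
      ext (i | i) (j | j) <;> simp [J, Matrix.one_apply]
    rw [mem_iff, hJ, transpose_submatrix, submatrix_mul_equiv, submatrix_mul_equiv, mem_iff.mp x.2]⟩
  invFun x := ⟨(x : Matrix _ _ F).submatrix (e.sumCongr e) (e.sumCongr e), by
    have hJ : J ι F = (J κ F).submatrix (e.sumCongr e) (e.sumCongr e) := by
      ext (i | i) (j | j) <;> simp [J, Matrix.one_apply]
    rw [mem_iff, hJ, transpose_submatrix, submatrix_mul_equiv, submatrix_mul_equiv, mem_iff.mp x.2]⟩
  left_inv x := by
    apply Subtype.ext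
    ext (i | i) (j | j) <;> simp
  right_inv x := by
    apply Subtype.ext
    ext (i | i) (j | j) <;> simp
  map_mul' x y := by
    apply Subtype.ext
    simp [submatrix_mul_equiv]

variable {L : Type*} [Field L] [Algebra F L]

open Algebra in
theorem transpose_leftMulMatrix_mul_traceMatrix (b : Module.Basis ι F L) (a : L) :
    (leftMulMatrix b a)ᵀ * traceMatrix F b = traceMatrix F b * leftMulMatrix b a := by
  have key : ∀ i j, (traceMatrix F b * leftMulMatrix b a) i j = trace F L (b i * (a * b j)) := by
    intro i j
    rw [Matrix.mul_apply]
    simp only [leftMulMatrix_eq_repr_mul, traceMatrix_apply, traceForm_apply]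
    conv_rhs => rw [← b.sum_repr (a * b j), Finset.mul_sum, map_sum]
    refine Finset.sum_congr rfl fun k _ => ?_
    rw [mul_smul_comm, map_smul, smul_eq_mul, mul_comm]
  have hT : (traceMatrix F b)ᵀ = traceMatrix F b := by
    ext i j; simp [traceMatrix_apply, traceForm_apply, mul_comm]
  ext i j
  rw [key]
  calc _ = ((traceMatrix F b * leftMulMatrix b a)ᵀ) i j := by rw [transpose_mul, hT]
    _ = _ := by rw [transpose_apply, key]; congr 1; ring

open Algebra in
/-- Restriction of scalars: `SL₂(L) = Sp₂(L)` embeds in `Sp₂ₖ(F)` when `[L : F] = k`. -/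
theorem exists_injective_hom_of_basis [Algebra.IsSeparable F L] (b : Module.Basis ι F L) :
    ∃ f : SpecialLinearGroup (Fin 2) L →* symplecticGroup ι F, Function.Injective f := by
  set T := traceMatrix F b with hTdef
  have hT : Tᵀ = T := by
    ext i j; simp [T, traceMatrix_apply, traceForm_apply, mul_comm]
  have hdet : IsUnit T.det := by
    rw [hTdef, traceMatrix_of_basis, isUnit_iff_ne_zero]
    exact det_traceForm_ne_zero b
  have h1 : T * T⁻¹ = 1 := mul_nonsing_inv T hdet
  have h2 : T⁻¹ * T = 1 := nonsing_inv_mul T hdet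
  have hTi : (T⁻¹)ᵀ = T⁻¹ := by rw [transpose_nonsing_inv, hT]
  have hρ (a : L) : (leftMulMatrix b a)ᵀ = T * leftMulMatrix b a * T⁻¹ := by
    rw [← transpose_leftMulMatrix_mul_traceMatrix, Matrix.mul_assoc, h1, Matrix.mul_one]
  have c2 (X : Matrix ι ι F) : T⁻¹ * (T * X) = X := by rw [← Matrix.mul_assoc, h2, Matrix.one_mul]
  let f : SpecialLinearGroup (Fin 2) L →* symplecticGroup ι F :=
    { toFun := fun g => ⟨fromBlocks (leftMulMatrix b (g 0 0)) (leftMulMatrix b (g 0 1) * T⁻¹)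
        (T * leftMulMatrix b (g 1 0)) (T * leftMulMatrix b (g 1 1) * T⁻¹), by
        have hg := g.2
        rw [det_fin_two] at hg
        rw [fromBlocks_mem_iff]
        simp only [transpose_mul, hρ, hT, hTi, Matrix.mul_assoc, c2, h2, Matrix.mul_one]
        simp only [← Matrix.mul_assoc _ _ (T⁻¹), ← map_mul, ← mul_sub, ← sub_mul, ← map_sub]
        refine ⟨by rw [mul_comm], by rw [mul_comm], ?_⟩
        rw [mul_comm (g 1 0), hg, map_one, Matrix.mul_one, h1]⟩
      map_one' := by
        apply Subtype.ext
        simp [h1]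
      map_mul' := fun g h => by
        apply Subtype.ext
        simp [fromBlocks_multiply, Matrix.mul_apply, Fin.sum_univ_two, Matrix.mul_assoc, c2,
          mul_add, add_mul] }
  refine ⟨f, fun g h hgh => ?_⟩
  have := congrArg Subtype.val hgh
  simp only [f, MonoidHom.coe_mk, OneHom.coe_mk, fromBlocks_inj] at this
  obtain ⟨e1, e2, e3, e4⟩ := this
  have i1 := leftMulMatrix_injective b e1
  have i2 := leftMulMatrix_injective b (by simpa [Matrix.mul_assoc, h2] using congrArg (· * T) e2)
  have i3 := leftMulMatrix_injective b (by simpa [c2] using congrArg (T⁻¹ * ·) e3)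
  have i4 := leftMulMatrix_injective b (by
    simpa [Matrix.mul_assoc, h2, c2] using congrArg (T⁻¹ * · * T) e4)
  ext i j
  fin_cases i <;> fin_cases j <;> assumption

end Embeddings
end SymplecticGroup

section SpecialLinearTwo

variable {L : Type*} [Field L]

theorem exists_orderOf_eq_of_dvd_card_sub_one [Finite L] {n : ℕ} (hn : n ∣ Nat.card L - 1) :
    ∃ ζ : L, ζ ≠ 0 ∧ orderOf ζ = n := by
  obtain ⟨x, hx⟩ := IsCyclic.exists_ofOrder_eq_natCard (α := Lˣ)
  have : Finite Lˣ := inferInstance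
  rw [Nat.card_units] at hx
  obtain ⟨d, hd⟩ := hn
  have h0 : Nat.card L - 1 ≠ 0 := by have := Finite.one_lt_card (α := L); omega
  refine ⟨(x ^ d : Lˣ), Units.ne_zero _, ?_⟩
  rw [orderOf_units, orderOf_pow_of_dvd (by rintro rfl; simp_all) (hx ▸ hd ▸ dvd_mul_left _ _), hx,
    hd]
  exact Nat.mul_div_cancel _ (Nat.pos_of_ne_zero (by rintro rfl; simp_all))

namespace Matrix.SpecialLinearGroup

theorem exists_orderOf_eq_of_dvd_card_sub_one [Finite L] {n : ℕ} (hn : n ∣ Nat.card L - 1) :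
    ∃ g : SpecialLinearGroup (Fin 2) L, orderOf g = n := by
  obtain ⟨ζ, h0, rfl⟩ := _root_.exists_orderOf_eq_of_dvd_card_sub_one hn
  let g : SpecialLinearGroup (Fin 2) L := ⟨diagonal ![ζ, ζ⁻¹], by simp [h0]⟩
  refine ⟨g, ?_⟩
  have hpow (k : ℕ) : g ^ k = 1 ↔ ζ ^ k = 1 := by
    have : ((g ^ k : SpecialLinearGroup (Fin 2) L) : Matrix _ _ L) =
        diagonal ![ζ ^ k, (ζ ^ k)⁻¹] := by
      rw [coe_pow, diagonal_pow]
      congr 1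
      ext i
      fin_cases i <;> simp
    constructor
    · intro h
      rw [h] at this
      simpa using (congrFun (congrFun this 0) 0).symm
    · intro h
      apply Subtype.ext
      rw [this, h]
      ext i j
      fin_cases i <;> fin_cases j <;> simp
  exact orderOf_eq_orderOf_iff.mpr hpow

theorem exists_orderOf_eq_of_dvd_card_add_one [Finite L] {n : ℕ} (hn : n ∣ Nat.card L + 1) :
    ∃ g : SpecialLinearGroup (Fin 2) L, orderOf g = n := by
  obtain ⟨p, hp⟩ := CharP.exists L
  have := Fact.mk (CharP.char_is_prime L p)
  have hlt := Finite.one_lt_card (α := L)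
  have hsq : Nat.card L ^ 2 - 1 = (Nat.card L + 1) * (Nat.card L - 1) := by
    simpa using Nat.sq_sub_sq (Nat.card L) 1
  let K := FiniteField.Extension L p 2
  obtain ⟨ζ, h0, rfl⟩ := _root_.exists_orderOf_eq_of_dvd_card_sub_one (L := K) (n := n) (by
    rw [FiniteField.natCard_extension, hsq]
    exact hn.mul_right _)
  let b : Module.Basis (Fin 2) L K :=
    Module.finBasisOfFinrankEq L K (FiniteField.finrank_extension L p 2)
  have hnorm : Algebra.norm L ζ = 1 := by
    apply (algebraMap L K).injective
    rw [FiniteField.algebraMap_norm_eq_pow, map_one, FiniteField.natCard_extension, hsq,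
      Nat.mul_div_cancel _ (by omega)]
    exact orderOf_dvd_iff_pow_eq_one.mp hn
  let g : SpecialLinearGroup (Fin 2) L :=
    ⟨Algebra.leftMulMatrix b ζ, by rw [← Algebra.norm_eq_matrix_det, hnorm]⟩
  refine ⟨g, orderOf_eq_orderOf_iff.mpr fun k => ?_⟩
  rw [← (Algebra.leftMulMatrix_injective b).eq_iff, map_pow, map_one]
  exact Subtype.ext_iff.trans (by rw [coe_pow, coe_one])

theorem exists_orderOf_eq_of_charP (p : ℕ) [hp : Fact p.Prime] [CharP L p] :
    ∃ g : SpecialLinearGroup (Fin 2) L, orderOf g = p := by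
  let g : SpecialLinearGroup (Fin 2) L := ⟨!![1, 1; 0, 1], by simp [det_fin_two]⟩
  have hpow (k : ℕ) : ((g ^ k : SpecialLinearGroup (Fin 2) L) : Matrix _ _ L) =
      !![1, (k : L); 0, 1] := by
    induction k with
    | zero => rw [pow_zero, coe_one, Nat.cast_zero, one_fin_two]
    | succ k ih =>
      rw [pow_succ, coe_mul, ih]
      simp [g, add_comm]
  refine ⟨g, orderOf_eq_prime ?_ fun h => ?_⟩
  · apply Subtype.ext
    rw [hpow, CharP.cast_eq_zero, ← one_fin_two, coe_one]
  · simpa [g] using congrFun (congrFun (congrArg Subtype.val h) 0) 1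

end Matrix.SpecialLinearGroup
end SpecialLinearTwo

section Eigenvalues

variable {n ι F : Type*} [Fintype n] [DecidableEq n] [Fintype ι] [DecidableEq ι] [Field F]

open Polynomial in
theorem Matrix.exists_aeval_charpoly_eq_zero_of_pow_eq_one {M : Matrix n n F} {s : ℕ}
    (hs : s.Prime) (hsF : (s : F) ≠ 0) (hM : M ^ s = 1) (hM1 : M ≠ 1) :
    ∃ ζ : AlgebraicClosure F, orderOf ζ = s ∧ aeval ζ M.charpoly = 0 := by
  have := Fact.mk hs
  let P : F[X] := ∑ i ∈ Finset.range s, X ^ i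
  have hP : P * (X - 1) = X ^ s - 1 := geom_sum_mul X s
  by_contra! hno
  have hcop : IsCoprime M.charpoly P := by
    rw [isCoprime_iff_aeval_ne_zero_of_isAlgClosed _ (AlgebraicClosure F)]
    intro ζ
    by_contra! h
    have h1 : ζ ^ s = 1 := by
      have := congrArg (aeval ζ) hP
      rw [map_mul, h.2, zero_mul] at this
      simpa [sub_eq_zero] using this.symm
    refine hno ζ (orderOf_eq_prime h1 ?_) h.1
    rintro rfl
    apply hsF
    apply (algebraMap F (AlgebraicClosure F)).injective
    simpa [P] using h.2
  obtain ⟨a, b, hab⟩ := hcop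
  apply hM1
  rw [← sub_eq_zero]
  calc M - 1 = aeval M ((a * M.charpoly + b * P) * (X - 1)) := by rw [hab]; simp
    _ = aeval M a * aeval M M.charpoly * (M - 1) + aeval M b * aeval M (P * (X - 1)) := by
      simp [add_mul, mul_assoc]
    _ = 0 := by rw [aeval_self_charpoly, hP]; simp [hM]

theorem SymplecticGroup.det_inv_smul_one_sub {M : Matrix (ι ⊕ ι) (ι ⊕ ι) F}
    (hM : M ∈ symplecticGroup ι F) {ζ : F} (hζ : ζ ≠ 0) (h : (ζ • 1 - M).det = 0) :
    (ζ⁻¹ • 1 - M).det = 0 := by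
  have key : (ζ⁻¹ • 1 - M) * (J ι F * Mᵀ) = -(ζ⁻¹ • (J ι F * (ζ • 1 - M)ᵀ)) := by
    rw [sub_mul, ← Matrix.mul_assoc M, mem_iff.mp hM]
    simp [mul_sub, smul_sub, smul_smul, hζ]
  have hdet := congrArg Matrix.det key
  rw [det_mul, det_neg, det_smul, det_mul, det_mul, det_transpose, det_transpose, h] at hdet
  simpa [(isUnit_det_J ι F).ne_zero, (symplectic_det hM).ne_zero] using hdet

theorem Matrix.aeval_charpoly_eq_det {K : Type*} [Field K] [Algebra F K] (M : Matrix n n F)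
    (ζ : K) : Polynomial.aeval ζ M.charpoly = (ζ • 1 - M.map (algebraMap F K)).det := by
  rw [Polynomial.aeval_def, Polynomial.eval₂_eq_eval_map, ← charpoly_map, eval_charpoly,
    scalar_apply, smul_one_eq_diagonal]

theorem SymplecticGroup.aeval_inv_charpoly {K : Type*} [Field K] [Algebra F K]
    {M : Matrix (ι ⊕ ι) (ι ⊕ ι) F} (hM : M ∈ symplecticGroup ι F) {ζ : K} (hζ : ζ ≠ 0)
    (h : Polynomial.aeval ζ M.charpoly = 0) : Polynomial.aeval ζ⁻¹ M.charpoly = 0 := by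
  rw [aeval_charpoly_eq_det] at h ⊢
  exact det_inv_smul_one_sub (map_mem hM _) hζ h

/-- If the roots of `P` are stable under `ζ ↦ ζ ^ a` and some root has order `s`, then the
multiplicative order of `a` modulo `s` is at most the degree of `P`. -/
theorem Polynomial.orderOf_intCast_le_natDegree {K : Type*} [Field K] [Algebra F K]
    {P : Polynomial F} (hP : P ≠ 0) {a : ℤ}
    (ha : ∀ ζ : K, ζ ≠ 0 → aeval ζ P = 0 → aeval (ζ ^ a) P = 0) {ζ : K} (hζ0 : ζ ≠ 0)
    (hζ : aeval ζ P = 0) : orderOf (a : ZMod (orderOf ζ)) ≤ P.natDegree := by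
  have hroot (i : ℕ) : aeval (ζ ^ (a ^ i)) P = 0 := by
    induction i with
    | zero => simpa using hζ
    | succ i ih =>
      rw [pow_succ, _root_.zpow_mul]
      exact ha _ (zpow_ne_zero _ hζ0) ih
  classical
  have hcard : (Finset.range (orderOf (a : ZMod (orderOf ζ)))).card ≤
      (P.aroots K).toFinset.card := by
    refine Finset.card_le_card_of_injOn (fun i => ζ ^ (a ^ i)) (fun i _ => ?_) ?_
    · simpa [mem_aroots, hP] using hroot i
    · intro i hi j hj hij
      refine pow_injOn_Iio_orderOf (by simpa using hi) (by simpa using hj) ?_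
      have hu : (Units.mk0 ζ hζ0) ^ (a ^ i) = (Units.mk0 ζ hζ0) ^ (a ^ j) := by
        apply Units.ext
        simpa using hij
      rw [zpow_eq_zpow_iff_modEq, ← orderOf_units, Units.val_mk0,
        ← ZMod.intCast_eq_intCast_iff] at hu
      simpa using hu
  rw [Finset.card_range] at hcard
  refine hcard.trans ((Multiset.toFinset_card_le _).trans ?_)
  exact (P.map (algebraMap F K)).card_roots'.trans natDegree_map_le

theorem SymplecticGroup.orderOf_card_le [Fintype F] {s : ℕ} (hs : s.Prime) (hs2 : s ≠ 2)
    (hsF : (s : F) ≠ 0) {g : symplecticGroup ι F} (hg : orderOf g = s) :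
    orderOf (Fintype.card F : ZMod s) ≤ 2 * Fintype.card ι ∧
      (Odd (orderOf (Fintype.card F : ZMod s)) →
        orderOf (Fintype.card F : ZMod s) ≤ Fintype.card ι) := by
  have := Fact.mk hs
  obtain ⟨M, hM⟩ : ∃ M : Matrix (ι ⊕ ι) (ι ⊕ ι) F, M = g.1 := ⟨_, rfl⟩
  obtain ⟨ζ, rfl, hζ⟩ := Matrix.exists_aeval_charpoly_eq_zero_of_pow_eq_one (M := M) hs hsF
    (by rw [hM, ← SubmonoidClass.coe_pow, ← hg, pow_orderOf_eq_one]; rfl) (by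
      intro h
      have : g = 1 := Subtype.ext (hM.symm.trans h)
      rw [this, orderOf_one] at hg
      exact hs.one_lt.ne hg)
  have hζ0 : ζ ≠ 0 := by
    rintro rfl
    exact hs.ne_zero (orderOf_eq_zero_iff'.mpr fun k hk => by simp [hk.ne'])
  have hfrob (x : AlgebraicClosure F) (hx : Polynomial.aeval x M.charpoly = 0) :
      Polynomial.aeval (x ^ Fintype.card F) M.charpoly = 0 := by
    have := Polynomial.aeval_algHom_apply (FiniteField.frobeniusAlgHom F (AlgebraicClosure F)) x
      M.charpoly
    rw [hx, map_zero] at this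
    simpa using this
  have hdeg : M.charpoly.natDegree = 2 * Fintype.card ι := by
    rw [charpoly_natDegree_eq_dim, Fintype.card_sum, two_mul]
  constructor
  · have := Polynomial.orderOf_intCast_le_natDegree (K := AlgebraicClosure F)
      (charpoly_monic M).ne_zero
      (a := (Fintype.card F : ℤ)) (fun x _ hx => by simpa using hfrob x hx) hζ0 hζ
    rwa [hdeg, Int.cast_natCast] at this
  · intro hodd
    have := Polynomial.orderOf_intCast_le_natDegree (K := AlgebraicClosure F)
      (charpoly_monic M).ne_zero
      (a := -(Fintype.card F : ℤ)) (fun x hx0 hx => by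
        rw [_root_.zpow_neg, _root_.zpow_natCast]
        exact aeval_inv_charpoly (hM ▸ g.2) (pow_ne_zero _ hx0) (hfrob x hx)) hζ0 hζ
    have h2 : orderOf (-1 : ZMod (orderOf ζ)) = 2 := by
      rw [orderOf_neg_one, ZMod.ringChar_zmod_n, if_neg hs2]
    rw [hdeg, Int.cast_neg, Int.cast_natCast, neg_eq_neg_one_mul,
      (Commute.all _ _).orderOf_mul_eq_mul_orderOf_of_coprime
        (by rw [h2]; exact (Nat.coprime_two_left.mpr hodd)), h2] at this
    omega

end Eigenvalues

section PrimeGraph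

theorem mem_elementOrders_of_dvd {G : Type*} [Group G] [Finite G] {g : G} {n : ℕ}
    (h : n ∣ orderOf g) : n ∈ elementOrders G :=
  ⟨g ^ (orderOf g / n), orderOf_pow_orderOf_div (orderOf_pos g).ne' h⟩

theorem dvd_card_of_mul_mem_elementOrders {G : Type*} [Group G] {r s : ℕ}
    (h : r * s ∈ elementOrders G) : r ∣ Nat.card G := by
  obtain ⟨g, hg⟩ := h
  exact (Dvd.intro s rfl).trans (hg ▸ orderOf_dvd_natCard g)

theorem MulEquiv.mem_center_of_map_mem {A B : Type*} [Group A] [Group B] (f : A ≃* B) {a : A}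
    (h : f a ∈ Subgroup.center B) : a ∈ Subgroup.center A := by
  rw [Subgroup.mem_center_iff] at h ⊢
  intro b
  apply f.injective
  simpa using h (f b)

variable {F : Type} [Field F] {m : ℕ}

namespace SymplecticGroup

theorem mul_mem_elementOrders_of_orthogonalSum {ι κ : Type*} [Fintype ι] [DecidableEq ι]
    [Fintype κ] [DecidableEq κ] [Nonempty ι] [Nonempty κ] (e : ι ⊕ κ ≃ Fin m)
    {g : symplecticGroup ι F} {h : symplecticGroup κ F} {r s : ℕ} (hr : r.Prime) (hs : s.Prime)
    (hrs : r ≠ s) (hg : orderOf g = s) (hh : orderOf h = r) :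
    r * s ∈ elementOrders (PSp m F) := by
  have hgr : g ^ r ≠ 1 := fun h1 =>
    hrs ((Nat.prime_dvd_prime_iff_eq hs hr).mp (hg ▸ orderOf_dvd_of_pow_eq_one h1)).symm
  have hhs : h ^ s ≠ 1 := fun h1 =>
    hrs ((Nat.prime_dvd_prime_iff_eq hr hs).mp (hh ▸ orderOf_dvd_of_pow_eq_one h1))
  have hg1 : g ^ s = 1 := hg ▸ pow_orderOf_eq_one g
  have hh1 : h ^ r = 1 := hh ▸ pow_orderOf_eq_one h
  let y : PSp m F := QuotientGroup.mk (reindexEquiv e (orthogonalSum (g, h)))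
  have hy (k : ℕ) (hk : y ^ k = 1) : ∃ c : F,
      ((g ^ k : symplecticGroup ι F) : Matrix (ι ⊕ ι) (ι ⊕ ι) F) = c • 1 ∧
      ((h ^ k : symplecticGroup κ F) : Matrix (κ ⊕ κ) (κ ⊕ κ) F) = c • 1 := by
    rw [← QuotientGroup.mk_pow, QuotientGroup.eq_one_iff, ← map_pow, ← map_pow] at hk
    obtain ⟨c, hc⟩ := exists_eq_smul_one_of_mem_center (MulEquiv.mem_center_of_map_mem _ hk)
    exact ⟨c, eq_smul_one_of_orthogonalSum hc⟩
  have hyr : y ^ r ≠ 1 := by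
    intro hk
    obtain ⟨c, h1, h2⟩ := hy r hk
    rw [hh1] at h2
    have hc : c = 1 := by
      have := congrFun (congrFun h2 (Sum.inl (Classical.arbitrary κ)))
        (Sum.inl (Classical.arbitrary κ))
      simpa using this.symm
    exact hgr (Subtype.ext (by rw [h1, hc, one_smul]; rfl))
  have hys : y ^ s ≠ 1 := by
    intro hk
    obtain ⟨c, h1, h2⟩ := hy s hk
    rw [hg1] at h1
    have hc : c = 1 := by
      have := congrFun (congrFun h1 (Sum.inl (Classical.arbitrary ι)))
        (Sum.inl (Classical.arbitrary ι))
      simpa using this.symm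
    exact hhs (Subtype.ext (by rw [h2, hc, one_smul]; rfl))
  have hyrs : orderOf y ∣ r * s := by
    apply orderOf_dvd_of_pow_eq_one
    rw [← QuotientGroup.mk_pow, ← map_pow, ← map_pow, Prod.pow_mk, mul_comm r, pow_mul, hg1,
      mul_comm s, pow_mul, hh1, one_pow, one_pow, ← Prod.one_eq_mk, map_one, map_one]
    rfl
  refine ⟨y, Nat.dvd_antisymm hyrs ?_⟩
  refine Nat.Coprime.mul_dvd_of_dvd_of_dvd ((Nat.coprime_primes hr hs).mpr hrs) ?_ ?_
  · by_contra hnd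
    exact hys (orderOf_dvd_iff_pow_eq_one.mp
      (((Nat.Prime.coprime_iff_not_dvd hr).mpr hnd).symm.dvd_of_dvd_mul_left hyrs))
  · by_contra hnd
    exact hyr (orderOf_dvd_iff_pow_eq_one.mp
      (((Nat.Prime.coprime_iff_not_dvd hs).mpr hnd).symm.dvd_of_dvd_mul_right hyrs))

theorem orderOf_dvd_two_mul_orderOf_mk (x : symplecticGroup (Fin m) F) :
    orderOf x ∣ 2 * orderOf (QuotientGroup.mk x : PSp m F) := by
  apply orderOf_dvd_of_pow_eq_one
  rw [mul_comm, pow_mul]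
  apply sq_eq_one_of_mem_center
  rw [← QuotientGroup.eq_one_iff, QuotientGroup.mk_pow, pow_orderOf_eq_one]

theorem mem_elementOrders_of_odd [Finite F] {x : symplecticGroup (Fin m) F} (hx : Odd (orderOf x)) :
    orderOf x ∈ elementOrders (PSp m F) :=
  mem_elementOrders_of_dvd (g := (QuotientGroup.mk x : PSp m F))
    ((Nat.coprime_two_right.mpr hx).dvd_of_dvd_mul_left (orderOf_dvd_two_mul_orderOf_mk x))

theorem mem_elementOrders_of_two_mul [Finite F] {x : symplecticGroup (Fin m) F} {n : ℕ}
    (hx : orderOf x = 2 * n) : n ∈ elementOrders (PSp m F) :=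
  mem_elementOrders_of_dvd (g := (QuotientGroup.mk x : PSp m F))
    (Nat.dvd_of_mul_dvd_mul_left two_pos (hx ▸ orderOf_dvd_two_mul_orderOf_mk x))

theorem exists_orderOf_eq_of_le {k n : ℕ} (hk : k ≤ m)
    (h : ∃ g : symplecticGroup (Fin k) F, orderOf g = n) :
    ∃ g : symplecticGroup (Fin m) F, orderOf g = n := by
  obtain ⟨g, rfl⟩ := h
  let e : Fin k ⊕ Fin (m - k) ≃ Fin m := finSumFinEquiv.trans (finCongr (by omega))
  refine ⟨reindexEquiv e (orthogonalSum (g, 1)), ?_⟩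
  rw [MulEquiv.orderOf_eq, orderOf_injective _ orthogonalSum_injective, Prod.orderOf_mk,
    orderOf_one, Nat.lcm_one_right]

theorem exists_orderOf_eq_of_dvd [Finite F] {k n : ℕ} (hk : k ≠ 0)
    (hn : n ∣ Nat.card F ^ k - 1 ∨ n ∣ Nat.card F ^ k + 1) :
    ∃ g : symplecticGroup (Fin k) F, orderOf g = n := by
  have := NeZero.mk hk
  obtain ⟨p, hp⟩ := CharP.exists F
  have := Fact.mk (CharP.char_is_prime F p)
  let L := FiniteField.Extension F p k
  have hL : Nat.card L = Nat.card F ^ k := FiniteField.natCard_extension F p k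
  obtain ⟨f, hf⟩ := exists_injective_hom_of_basis
    (Module.finBasisOfFinrankEq F L (FiniteField.finrank_extension F p k))
  rw [← hL] at hn
  obtain ⟨g, rfl⟩ : ∃ g : Matrix.SpecialLinearGroup (Fin 2) L, orderOf g = n :=
    hn.elim Matrix.SpecialLinearGroup.exists_orderOf_eq_of_dvd_card_sub_one
      Matrix.SpecialLinearGroup.exists_orderOf_eq_of_dvd_card_add_one
  exact ⟨f g, orderOf_injective f hf g⟩

theorem exists_orderOf_eq_of_charP (p : ℕ) [Fact p.Prime] [CharP F p] :
    ∃ g : symplecticGroup (Fin 1) F, orderOf g = p := by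
  obtain ⟨f, hf⟩ := exists_injective_hom_of_basis (Module.Basis.singleton (Fin 1) F)
  obtain ⟨g, hg⟩ := Matrix.SpecialLinearGroup.exists_orderOf_eq_of_charP (L := F) p
  exact ⟨f g, (orderOf_injective f hf g).trans hg⟩

theorem exists_orderOf_eq_of_dvd_card_PSp [Finite F] {s : ℕ} (hs : s.Prime) (hs2 : s ≠ 2)
    (hd : s ∣ Nat.card (PSp m F)) : ∃ g : symplecticGroup (Fin m) F, orderOf g = s := by
  have := Fact.mk hs
  obtain ⟨y, hy⟩ := exists_prime_orderOf_dvd_card' s hd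
  obtain ⟨x, rfl⟩ := QuotientGroup.mk_surjective y
  refine ⟨x ^ 2, orderOf_eq_prime ?_ fun h => ?_⟩
  · rw [← pow_mul, ← orderOf_dvd_iff_pow_eq_one, ← hy]
    exact orderOf_dvd_two_mul_orderOf_mk x
  · have : orderOf (QuotientGroup.mk x : PSp m F) ∣ 2 := by
      apply orderOf_dvd_of_pow_eq_one
      rw [← QuotientGroup.mk_pow, h]
      rfl
    rw [hy] at this
    exact hs2 ((Nat.prime_dvd_prime_iff_eq hs Nat.prime_two).mp this)

end SymplecticGroup

theorem ZMod.dvd_pow_sub_one_of_orderOf_eq {s u e : ℕ} (hu : 0 < u)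
    (he : orderOf (u : ZMod s) = e) : s ∣ u ^ e - 1 := by
  rw [← ZMod.natCast_eq_zero_iff, Nat.cast_sub (Nat.one_le_pow _ _ hu), ← he]
  simp [pow_orderOf_eq_one]

theorem ZMod.dvd_pow_add_one_of_orderOf_eq {s u k : ℕ} (hs : s.Prime) (hk : k ≠ 0)
    (he : orderOf (u : ZMod s) = 2 * k) : s ∣ u ^ k + 1 := by
  have := Fact.mk hs
  rw [← ZMod.natCast_eq_zero_iff]
  have h1 : ((u : ZMod s) ^ k) ^ 2 = 1 := by rw [← pow_mul, mul_comm, ← he, pow_orderOf_eq_one]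
  have h2 : (u : ZMod s) ^ k ≠ 1 := pow_ne_one_of_lt_orderOf hk (by omega)
  rw [pow_two] at h1
  rcases mul_self_eq_one_iff.mp h1 with h | h
  · exact absurd h h2
  · push_cast
    rw [h, neg_add_cancel]

theorem exists_orderOf_eq_or_orderOf_card_eq [Fintype F] (hm : 2 ≤ m) {s : ℕ} (hs : s.Prime)
    (hd : s ∣ Nat.card (PSp m F)) :
    (∃ g : Matrix.symplecticGroup (Fin (m - 1)) F, orderOf g = s) ∨
      (s ≠ 2 ∧ (orderOf (Fintype.card F : ZMod s) = m ∨
        orderOf (Fintype.card F : ZMod s) = 2 * m)) := by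
  have := Fact.mk hs
  obtain ⟨p, hp⟩ := CharP.exists F
  have hpp := Fact.mk (CharP.char_is_prime F p)
  have hu := Fintype.card_pos (α := F)
  by_cases hsF : (s : F) = 0
  · left
    obtain rfl := (Nat.prime_dvd_prime_iff_eq hpp.out hs).mp ((CharP.cast_eq_zero_iff F p s).mp hsF)
    exact SymplecticGroup.exists_orderOf_eq_of_le (by omega)
      (SymplecticGroup.exists_orderOf_eq_of_charP p)
  have hsmall (k : ℕ) (hk : k ≠ 0) (hkm : k < m)
      (h : s ∣ Fintype.card F ^ k - 1 ∨ s ∣ Fintype.card F ^ k + 1) :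
      ∃ g : Matrix.symplecticGroup (Fin (m - 1)) F, orderOf g = s := by
    rw [← Nat.card_eq_fintype_card] at h
    exact SymplecticGroup.exists_orderOf_eq_of_le (by omega)
      (SymplecticGroup.exists_orderOf_eq_of_dvd hk h)
  have hus : (Fintype.card F : ZMod s) ≠ 0 := by
    rw [Ne, ZMod.natCast_eq_zero_iff]
    intro h
    obtain ⟨n, -, hn⟩ := FiniteField.card F p
    rw [hn] at h
    have := (Nat.prime_dvd_prime_iff_eq hs hpp.out).mp (hs.dvd_of_dvd_pow h)
    exact hsF (this ▸ CharP.cast_eq_zero F p)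
  by_cases hs2 : s = 2
  · left
    refine hsmall 1 one_ne_zero (by omega) (Or.inl ?_)
    refine ZMod.dvd_pow_sub_one_of_orderOf_eq hu ?_
    have h2 : ∀ x : ZMod 2, x ≠ 0 → x = 1 := by decide
    subst hs2
    exact orderOf_eq_one_iff.mpr (h2 _ hus)
  obtain ⟨g, hg⟩ := SymplecticGroup.exists_orderOf_eq_of_dvd_card_PSp hs hs2 hd
  obtain ⟨h1, h2⟩ := SymplecticGroup.orderOf_card_le hs hs2 hsF hg
  rw [Fintype.card_fin] at h1 h2
  have hpos : 0 < orderOf (Fintype.card F : ZMod s) := by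
    rw [orderOf_pos_iff, isOfFinOrder_iff_pow_eq_one]
    exact ⟨s - 1, by have := hs.two_le; omega, ZMod.pow_card_sub_one_eq_one hus⟩
  rcases Nat.even_or_odd' (orderOf (Fintype.card F : ZMod s)) with ⟨k, hk | hk⟩
  · rcases (show k ≤ m by omega).lt_or_eq with hkm | rfl
    · exact Or.inl (hsmall k (by omega) hkm
        (Or.inr (ZMod.dvd_pow_add_one_of_orderOf_eq hs (by omega) hk)))
    · exact Or.inr ⟨hs2, Or.inr hk⟩
  · rcases (h2 ⟨k, hk⟩).lt_or_eq with hlt | heq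
    · exact Or.inl (hsmall _ hpos.ne' hlt (Or.inl (ZMod.dvd_pow_sub_one_of_orderOf_eq hu rfl)))
    · exact Or.inr ⟨hs2, Or.inl heq⟩

theorem mul_mem_elementOrders_PSp (hm : 2 ≤ m) {r s : ℕ} (hr : r.Prime) (hs : s.Prime)
    (hrs : r ≠ s) (hg : ∃ g : Matrix.symplecticGroup (Fin (m - 1)) F, orderOf g = s)
    (hh : ∃ h : Matrix.symplecticGroup (Fin 1) F, orderOf h = r) :
    r * s ∈ elementOrders (PSp m F) := by
  obtain ⟨g, hg⟩ := hg
  obtain ⟨h, hh⟩ := hh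
  have : NeZero (m - 1) := ⟨by omega⟩
  exact SymplecticGroup.mul_mem_elementOrders_of_orthogonalSum
    (finSumFinEquiv.trans (finCongr (by omega))) hr hs hrs hg hh

theorem exists_prime_mul_mem_elementOrders [Finite F] {s w N : ℕ} (hs : s.Prime) (hs2 : s ≠ 2)
    (hw : 2 < w) (hwN : w ∣ N) (hsN : s ∣ N) (hsw : ¬ s ∣ w)
    (h1 : ∀ n, n ∣ w → ∃ h : Matrix.symplecticGroup (Fin 1) F, orderOf h = n)
    (hN : ∀ n, n ∣ N → ∃ x : Matrix.symplecticGroup (Fin m) F, orderOf x = n) :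
    ∃ r : ℕ, r.Prime ∧ (∃ h : Matrix.symplecticGroup (Fin 1) F, orderOf h = r) ∧
      r * s ∈ elementOrders (PSp m F) := by
  rcases Nat.four_dvd_or_exists_odd_prime_and_dvd_of_two_lt hw with h4 | ⟨r, hr, hrw, hrodd⟩
  · refine ⟨2, Nat.prime_two, h1 2 (dvd_trans (by norm_num) h4), ?_⟩
    have hcop : Nat.Coprime 4 s := by
      rw [show 4 = 2 ^ 2 by norm_num]
      exact Nat.Coprime.pow_left 2 ((Nat.coprime_primes Nat.prime_two hs).mpr hs2.symm)
    obtain ⟨x, hx⟩ := hN (4 * s) (hcop.mul_dvd_of_dvd_of_dvd (h4.trans hwN) hsN)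
    exact SymplecticGroup.mem_elementOrders_of_two_mul (x := x) (by rw [hx]; ring)
  · refine ⟨r, hr, h1 r hrw, ?_⟩
    have hne : r ≠ s := by rintro rfl; exact hsw hrw
    obtain ⟨x, hx⟩ := hN (r * s)
      (((Nat.coprime_primes hr hs).mpr hne).mul_dvd_of_dvd_of_dvd (hrw.trans hwN) hsN)
    rw [← hx]
    exact SymplecticGroup.mem_elementOrders_of_odd
      (by rw [hx]; exact hrodd.mul (hs.odd_of_ne_two hs2))

theorem exists_prime_adjacent_of_orderOf_card_eq [Fintype F] (hF : 3 < Fintype.card F)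
    (hm : 2 ≤ m) (hmodd : Odd m) {s : ℕ} (hs : s.Prime) (hs2 : s ≠ 2)
    (he : orderOf (Fintype.card F : ZMod s) = m ∨ orderOf (Fintype.card F : ZMod s) = 2 * m) :
    ∃ r : ℕ, r.Prime ∧ (∃ h : Matrix.symplecticGroup (Fin 1) F, orderOf h = r) ∧
      r * s ∈ elementOrders (PSp m F) := by
  have := Fact.mk hs
  set u := Fintype.card F with hu
  have hcard : Nat.card F = u := Nat.card_eq_fintype_card
  have hu0 : 0 < u := by omega
  rcases he with he | he
  · refine exists_prime_mul_mem_elementOrders (w := u - 1) (N := u ^ m - 1) hs hs2 (by omega)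
      (by simpa using Nat.sub_dvd_pow_sub_pow u 1 m) (ZMod.dvd_pow_sub_one_of_orderOf_eq hu0 he) ?_
      (fun n hn => SymplecticGroup.exists_orderOf_eq_of_dvd one_ne_zero
        (Or.inl (by rwa [hcard, pow_one])))
      (fun n hn => SymplecticGroup.exists_orderOf_eq_of_dvd (by omega) (Or.inl (by rwa [hcard])))
    intro h
    rw [← ZMod.natCast_eq_zero_iff, Nat.cast_sub hu0, sub_eq_zero, Nat.cast_one] at h
    rw [h, orderOf_one] at he
    omega
  · refine exists_prime_mul_mem_elementOrders (w := u + 1) (N := u ^ m + 1) hs hs2 (by omega)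
      (by simpa using hmodd.nat_add_dvd_pow_add_pow u 1)
      (ZMod.dvd_pow_add_one_of_orderOf_eq hs (by omega) he) ?_
      (fun n hn => SymplecticGroup.exists_orderOf_eq_of_dvd one_ne_zero
        (Or.inr (by rwa [hcard, pow_one])))
      (fun n hn => SymplecticGroup.exists_orderOf_eq_of_dvd (by omega) (Or.inr (by rwa [hcard])))
    intro h
    rw [← ZMod.natCast_eq_zero_iff, Nat.cast_add, Nat.cast_one] at h
    have : orderOf (u : ZMod s) ∣ 2 := by
      apply orderOf_dvd_of_pow_eq_one
      rw [eq_neg_of_add_eq_zero_left h]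
      ring
    have := Nat.le_of_dvd two_pos this
    omega

theorem mul_mem_elementOrders_PSp_of_orderOf_eq [Fintype F] (hm : m ≠ 0) {s t : ℕ}
    (hs : s.Prime) (ht : t.Prime) (hst : s ≠ t) (hs2 : s ≠ 2) (ht2 : t ≠ 2)
    (he : orderOf (Fintype.card F : ZMod s) = m ∨ orderOf (Fintype.card F : ZMod s) = 2 * m)
    (heq : orderOf (Fintype.card F : ZMod s) = orderOf (Fintype.card F : ZMod t)) :
    s * t ∈ elementOrders (PSp m F) := by
  have hu := Fintype.card_pos (α := F)
  have hcop := (Nat.coprime_primes hs ht).mpr hst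
  obtain ⟨x, hx⟩ : ∃ x : Matrix.symplecticGroup (Fin m) F, orderOf x = s * t := by
    refine SymplecticGroup.exists_orderOf_eq_of_dvd hm ?_
    rw [Nat.card_eq_fintype_card]
    rcases he with he | he
    · exact Or.inl (hcop.mul_dvd_of_dvd_of_dvd (ZMod.dvd_pow_sub_one_of_orderOf_eq hu he)
        (ZMod.dvd_pow_sub_one_of_orderOf_eq hu (heq ▸ he)))
    · exact Or.inr (hcop.mul_dvd_of_dvd_of_dvd (ZMod.dvd_pow_add_one_of_orderOf_eq hs hm he)
        (ZMod.dvd_pow_add_one_of_orderOf_eq ht hm (heq ▸ he)))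
  rw [← hx]
  exact SymplecticGroup.mem_elementOrders_of_odd
    (by rw [hx]; exact (hs.odd_of_ne_two hs2).mul (ht.odd_of_ne_two ht2))

/-- Two primes, at least one of which is the order of an element of `Sp₂₍ₘ₋₁₎(F)`, are adjacent or
have a common neighbour. -/
theorem mul_mem_elementOrders_or_exists_common_neighbour [Fintype F] (hF : 3 < Fintype.card F)
    (hm : 2 ≤ m) (hmodd : Odd m) {s t : ℕ} (hs : s.Prime) (ht : t.Prime) (hst : s ≠ t)
    (hds : s ∣ Nat.card (PSp m F))
    (hgt : ∃ g : Matrix.symplecticGroup (Fin (m - 1)) F, orderOf g = t) :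
    s * t ∈ elementOrders (PSp m F) ∨ ∃ r : ℕ, r.Prime ∧ r ∣ Nat.card (PSp m F) ∧
      r * s ∈ elementOrders (PSp m F) ∧ r * t ∈ elementOrders (PSp m F) := by
  obtain ⟨r, hr, hh, hrs⟩ : ∃ r : ℕ, r.Prime ∧
      (∃ h : Matrix.symplecticGroup (Fin 1) F, orderOf h = r) ∧
      (r = s ∨ r * s ∈ elementOrders (PSp m F)) := by
    rcases exists_orderOf_eq_or_orderOf_card_eq hm hs hds with hgs | ⟨hs2, he⟩
    · obtain ⟨p, hp⟩ := CharP.exists F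
      have hpp := Fact.mk (CharP.char_is_prime F p)
      have hh := SymplecticGroup.exists_orderOf_eq_of_charP (F := F) p
      exact ⟨p, hpp.out, hh, or_iff_not_imp_left.mpr fun hne =>
        mul_mem_elementOrders_PSp hm hpp.out hs hne hgs hh⟩
    · obtain ⟨r, hr, hh, hrs⟩ := exists_prime_adjacent_of_orderOf_card_eq hF hm hmodd hs hs2 he
      exact ⟨r, hr, hh, Or.inr hrs⟩
  by_cases hrt : r = t
  · subst hrt
    rcases hrs with rfl | hrs
    · exact absurd rfl hst
    · exact Or.inl (mul_comm r s ▸ hrs)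
  have hadj := mul_mem_elementOrders_PSp hm hr ht hrt hgt hh
  rcases hrs with rfl | hrs
  · exact Or.inl hadj
  · exact Or.inr ⟨r, hr, dvd_card_of_mul_mem_elementOrders hrs, hrs, hadj⟩

end PrimeGraph

end SymplecticPrimeGraph

/-- If `S = PSp_{2m}(u)` with `u > 3` and `m ≥ 5` odd, and `s₁ ≠ s₂` are primes
dividing `|S|` with disjoint neighborhoods in the prime graph of `S`, then (up
to swapping) `ord_{s₁}(u) = 2m` and `ord_{s₂}(u) = m`. -/
theorem psp_odd_unique_disjoint
    (u : ℕ) (hu : IsPrimePow u) (hu3 : 3 < u)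
    (m : ℕ) (hm : 5 ≤ m) (hmodd : Odd m)
    (F : Type) [Field F] [Fintype F] (hF : Fintype.card F = u)
    (s1 s2 : ℕ) (hs1 : s1.Prime) (hs2 : s2.Prime) (hne : s1 ≠ s2)
    (hd1 : s1 ∣ Nat.card (PSp m F)) (hd2 : s2 ∣ Nat.card (PSp m F))
    (hnadj : s1 * s2 ∉ elementOrders (PSp m F))
    (hdisj : ¬ ∃ r : ℕ, r.Prime ∧ r ∣ Nat.card (PSp m F) ∧
      r * s1 ∈ elementOrders (PSp m F) ∧ r * s2 ∈ elementOrders (PSp m F)) :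
    (orderOf ((u : ZMod s1)) = 2 * m ∧ orderOf ((u : ZMod s2)) = m) ∨
    (orderOf ((u : ZMod s2)) = 2 * m ∧ orderOf ((u : ZMod s1)) = m) := by
  subst hF
  have hm2 : 2 ≤ m := by omega
  rcases exists_orderOf_eq_or_orderOf_card_eq hm2 hs1 hd1 with hg1 | ⟨hs12, he1⟩
  · exfalso
    rcases mul_mem_elementOrders_or_exists_common_neighbour hu3 hm2 hmodd hs2 hs1 hne.symm hd2 hg1
      with h | ⟨r, hr, hrd, h2, h1⟩
    · exact hnadj (mul_comm s2 s1 ▸ h)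
    · exact hdisj ⟨r, hr, hrd, h1, h2⟩
  rcases exists_orderOf_eq_or_orderOf_card_eq hm2 hs2 hd2 with hg2 | ⟨hs22, he2⟩
  · exfalso
    exact (mul_mem_elementOrders_or_exists_common_neighbour hu3 hm2 hmodd hs1 hs2 hne hd1 hg2).elim
      hnadj hdisj
  have hord : orderOf (Fintype.card F : ZMod s1) ≠ orderOf (Fintype.card F : ZMod s2) :=
    fun heq => hnadj
      (mul_mem_elementOrders_PSp_of_orderOf_eq (by omega) hs1 hs2 hne hs12 hs22 he1 heq)
  omega
end
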